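/- Let θ ∈ W_p^{1-1/p} with p ∈ (2,∞). Then there exist a function d on Δ with d(±1) = 0 which belongs to W_q^{1-1/q} for every q ∈ (2,p), and a polynomial ℓ with deg ℓ ≤ 1, such that sr^± · S(θ/sr⁺) = ± d + sr^± · ℓ on Δ°. -/

import Mathlib

open Complex MeasureTheory Filter Topology Set Metric Polynomial
open scoped ENNReal NNReal

noncomputable section

/-- The segment `[-1,1]` viewed inside `ℂ`. -/
def realSeg : Set ℂ := (fun x : ℝ => (x : ℂ)) '' Set.Icc (-1) 1

/-- A closed analytic Jordan arc with endpoints `-1` and `1`: the image of `[-1,1]`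
under a holomorphic univalent map defined on a neighborhood of `[-1,1]`. -/
structure AnalyticArc where
  U : Set ℂ
  Ξ : ℂ → ℂ
  isOpen_U : IsOpen U
  seg_sub : realSeg ⊆ U
  diff : DifferentiableOn ℂ Ξ U
  inj : Set.InjOn Ξ U
  map_neg_one : Ξ (-1) = -1
  map_one : Ξ 1 = 1

/-- The arc itself. -/
def AnalyticArc.arc (A : AnalyticArc) : Set ℂ := A.Ξ '' realSeg

/-- The open arc `Δ° = Δ \ {±1}`. -/
def AnalyticArc.arcInt (A : AnalyticArc) : Set ℂ := A.arc \ {1, -1}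

/-- Boundary value from the left (`+`) side of the arc. -/
def BVplus {E : Type*} [TopologicalSpace E] (Ξ : ℂ → ℂ) (f : ℂ → E) (fp : ℂ → E) : Prop :=
  ∀ x ∈ Set.Ioo (-1:ℝ) 1,
    Tendsto (fun y : ℝ => f (Ξ (x + y * Complex.I))) (𝓝[>] 0) (𝓝 (fp (Ξ (x:ℂ))))

/-- Boundary value from the right (`-`) side of the arc. -/
def BVminus {E : Type*} [TopologicalSpace E] (Ξ : ℂ → ℂ) (f : ℂ → E) (fm : ℂ → E) : Prop :=
  ∀ x ∈ Set.Ioo (-1:ℝ) 1,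
    Tendsto (fun y : ℝ => f (Ξ (x + y * Complex.I))) (𝓝[<] 0) (𝓝 (fm (Ξ (x:ℂ))))

/-- The branch of `√(z²-1)` holomorphic off the arc with `sr z / z → 1` at infinity. -/
structure SqrtBranch (A : AnalyticArc) where
  sr : ℂ → ℂ
  diff : DifferentiableOn ℂ sr A.arcᶜ
  sq : ∀ z ∈ A.arcᶜ, sr z ^ 2 = z ^ 2 - 1
  at_inf : Tendsto (fun z => sr z / z) (Bornology.cobounded ℂ) (𝓝 1)

/-- `φ(z) = z + sr z`. -/
def SqrtBranch.φ {A : AnalyticArc} (S : SqrtBranch A) (z : ℂ) : ℂ := z + S.sr z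

/-- The function `r_n` associated to a polynomial `v` with no zeros on the arc. -/
def rFun {A : AnalyticArc} (S : SqrtBranch A) (v : Polynomial ℂ) (n : ℕ) (z : ℂ) : ℂ :=
  (1 / S.φ z) ^ (2 * n - v.natDegree) *
    ((v.roots.map fun e => (S.φ z - S.φ e) / (1 - S.φ e * S.φ z)).prod)


/-- `IsPV A g τ v` : the principal value integral `∫_Δ g(t)/(t-τ) dt` exists and equals `v`,
computed through the analytic parametrization of the arc. -/
def IsPV (A : AnalyticArc) (g : ℂ → ℂ) (τ v : ℂ) : Prop :=
  Filter.Tendsto (fun ε : ℝ =>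
      ∫ x in {x ∈ Set.Icc (-1:ℝ) 1 | ε ≤ ‖A.Ξ (x:ℂ) - τ‖},
        g (A.Ξ (x:ℂ)) / (A.Ξ (x:ℂ) - τ) * deriv A.Ξ (x:ℂ))
    (𝓝[>] 0) (𝓝 v)

/-- The fractional Sobolev class `W_p^{1-1/p}(Δ)`, expressed through the analytic
parametrization of the arc (with arclength density `|Ξ'|`):
`∬_{Δ×Δ} |(θ(x)-θ(y))/(x-y)|^p |dx||dy| < ∞`. -/
def SobWOn (A : AnalyticArc) (p : ℝ) (θ : ℂ → ℂ) : Prop :=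
  (∫⁻ x in Set.Icc (-1:ℝ) 1, ∫⁻ y in Set.Icc (-1:ℝ) 1,
    ENNReal.ofReal ((‖θ (A.Ξ (x:ℂ)) - θ (A.Ξ (y:ℂ))‖ / ‖A.Ξ (x:ℂ) - A.Ξ (y:ℂ)‖) ^ p
      * ‖deriv A.Ξ (x:ℂ)‖ * ‖deriv A.Ξ (y:ℂ)‖)) < ⊤

/-- A system of derivatives of `θ` with respect to arclength along the arc `Δ`,
expressed through the analytic parametrization `Ξ`. -/
structure ArcCm (A : AnalyticArc) (m : ℕ) (θ : ℂ → ℂ) where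
  d : ℕ → ℂ → ℂ
  d0 : d 0 = θ
  hd : ∀ k < m, ∀ x ∈ Set.Icc (-1:ℝ) 1,
    HasDerivWithinAt (fun t : ℝ => d k (A.Ξ (t:ℂ)))
      (d (k + 1) (A.Ξ (x:ℂ)) * (‖deriv A.Ξ (x:ℂ)‖ : ℂ)) (Set.Icc (-1) 1) x

/-- The Hölder class `C^{m,ς}(Δ)` (w.r.t. arclength). -/
def ArcCmHolder (A : AnalyticArc) (m : ℕ) (ς : ℝ) (θ : ℂ → ℂ) : Prop :=
  ∃ D : ArcCm A m θ, ∃ C : ℝ≥0, HolderOnWith C ς.toNNReal (D.d m) A.arc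

/-- An injective holomorphic function has nonvanishing derivative. -/
theorem deriv_ne_zero_of_injOn {f : ℂ → ℂ} {U : Set ℂ} (hU : IsOpen U)
    (hf : DifferentiableOn ℂ f U) (hinj : InjOn f U) {z₀ : ℂ} (hz₀ : z₀ ∈ U) :
    deriv f z₀ ≠ 0 := by
  intro hd
  have hUn : U ∈ 𝓝 z₀ := hU.mem_nhds hz₀
  have hfa : AnalyticAt ℂ f z₀ := hf.analyticAt hUn
  have hfa' : AnalyticAt ℂ (fun z => f z - f z₀) z₀ := hfa.sub analyticAt_const
  have hne : ¬ ∀ᶠ z in 𝓝 z₀, f z - f z₀ = 0 := by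
    intro h
    have h2 : ∀ᶠ z in 𝓝[≠] z₀, False := by
      filter_upwards [h.filter_mono nhdsWithin_le_nhds, self_mem_nhdsWithin,
        mem_nhdsWithin_of_mem_nhds hUn] with z hz hz' hzU
      exact hz' (hinj hzU hz₀ (sub_eq_zero.mp hz))
    exact h2.exists.elim fun _ h => h
  obtain ⟨n, h, hh, hh0, hfac⟩ := hfa'.exists_eventuallyEq_pow_smul_nonzero_iff.mpr hne
  have hn0 : n ≠ 0 := by
    rintro rfl
    have := hfac.self_of_nhds
    simp at this
    exact hh0 this.symm
  have hn1 : n ≠ 1 := by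
    rintro rfl
    have h1 : HasDerivAt (fun z => (z - z₀) ^ 1 • h z) (h z₀) z₀ := by
      have := ((hasDerivAt_id z₀).sub_const z₀).fun_mul hh.differentiableAt.hasDerivAt
      simpa using this
    have h2 : HasDerivAt (fun z => f z - f z₀) (h z₀) z₀ := h1.congr_of_eventuallyEq hfac
    have h3 := h2.deriv
    rw [deriv_sub_const, hd] at h3
    exact hh0 h3.symm
  set φ : ℂ → ℂ := fun z => (z - z₀) * (h z / h z₀) ^ (1 / n : ℂ) with hφ
  have hk : AnalyticAt ℂ (fun z => (h z / h z₀) ^ (1 / n : ℂ)) z₀ := by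
    refine (hh.div analyticAt_const hh0).cpow analyticAt_const ?_
    simp [div_self hh0]
  have hφa : AnalyticAt ℂ φ z₀ := (analyticAt_id.sub analyticAt_const).mul hk
  have hφd : HasDerivAt φ 1 z₀ := by
    have := ((hasDerivAt_id z₀).sub_const z₀).fun_mul hk.differentiableAt.hasDerivAt
    simpa [hφ, div_self hh0] using this
  have hstrict : HasStrictDerivAt φ 1 z₀ := by
    have := hφa.hasStrictDerivAt
    rwa [hφd.deriv] at this
  have hmap := hstrict.map_nhds_eq one_ne_zero
  have hφ0 : φ z₀ = 0 := by simp [hφ]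
  rw [hφ0] at hmap
  have hgood : ∀ᶠ z in 𝓝 z₀, z ∈ U ∧ f z - f z₀ = h z₀ * φ z ^ n := by
    filter_upwards [hUn, hfac] with z hzU hz
    refine ⟨hzU, ?_⟩
    rw [hz, hφ]
    simp only [smul_eq_mul, mul_pow]
    rw [one_div, Complex.cpow_nat_inv_pow _ hn0]
    field_simp
  have himg : ∀ᶠ w in 𝓝 (0 : ℂ), ∃ z, (z ∈ U ∧ f z - f z₀ = h z₀ * φ z ^ n) ∧ φ z = w := by
    rw [← hmap]
    exact (Filter.eventually_map.mpr (hgood.mono fun z hz => ⟨z, hz, rfl⟩))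
  set ζ : ℂ := Complex.exp (2 * Real.pi * I / n) with hζ
  have hprim : IsPrimitiveRoot ζ n := Complex.isPrimitiveRoot_exp n hn0
  have hζ1 : ζ ≠ 1 := hprim.ne_one (by omega)
  have hmul : Tendsto (fun w : ℂ => ζ * w) (𝓝 0) (𝓝 0) := by
    have : Continuous fun w : ℂ => ζ * w := by fun_prop
    simpa using this.tendsto 0
  have hboth := (himg.and (hmul.eventually himg)).filter_mono
    (nhdsWithin_le_nhds (s := {0}ᶜ))
  obtain ⟨w, ⟨⟨z₁, ⟨hz₁, hf₁⟩, hw₁⟩, z₂, ⟨hz₂, hf₂⟩, hw₂⟩, hw0⟩ :=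
    (hboth.and self_mem_nhdsWithin).exists
  have heq : f z₁ = f z₂ := by
    have : f z₁ - f z₀ = f z₂ - f z₀ := by
      rw [hf₁, hf₂, hw₁, hw₂, mul_pow, hprim.pow_eq_one, one_mul]
    exact sub_left_injective this
  have hzz := hinj hz₁ hz₂ heq
  rw [hzz, hw₂] at hw₁
  have : (ζ - 1) * w = 0 := by linear_combination hw₁
  rcases mul_eq_zero.mp this with h0 | h0
  · exact hζ1 (sub_eq_zero.mp h0)
  · exact hw0 h0

theorem realSeg_compact : IsCompact realSeg :=
  isCompact_Icc.image Complex.continuous_ofReal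

theorem realSeg_convex : Convex ℝ realSeg := by
  have := (convex_Icc (-1 : ℝ) 1).linear_image Complex.ofRealCLM.toLinearMap
  exact this

theorem ofReal_mem_realSeg {x : ℝ} (hx : x ∈ Icc (-1 : ℝ) 1) : (x : ℂ) ∈ realSeg := ⟨x, hx, rfl⟩

/-- A continuous square root of a nonvanishing holomorphic function is holomorphic. -/
theorem differentiableOn_of_sq {g G : ℂ → ℂ} {V : Set ℂ} (hV : IsOpen V)
    (hg : ContinuousOn g V) (hG : DifferentiableOn ℂ G V) (hsq : ∀ z, g z ^ 2 = G z)
    (h0 : ∀ z ∈ V, G z ≠ 0) : DifferentiableOn ℂ g V := by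
  intro z hz
  have hgz : g z ≠ 0 := fun h => h0 z hz (by rw [← hsq, h]; simp)
  have hc : ContinuousAt g z := hg.continuousAt (hV.mem_nhds hz)
  have hGd := (hG.differentiableAt (hV.mem_nhds hz)).hasDerivAt
  have : HasDerivAt g (deriv G z / (2 * g z)) z := by
    rw [hasDerivAt_iff_tendsto_slope]
    have h1 : Tendsto (fun w => slope G z w / (g w + g z)) (𝓝[≠] z)
        (𝓝 (deriv G z / (2 * g z))) := by
      rw [two_mul]
      refine (hasDerivAt_iff_tendsto_slope.mp hGd).div
        ((hc.tendsto.mono_left nhdsWithin_le_nhds).add_const _) ?_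
      rw [← two_mul]
      exact mul_ne_zero two_ne_zero hgz
    refine h1.congr' ?_
    have hne : ∀ᶠ w in 𝓝[≠] z, g w + g z ≠ 0 := by
      have : Tendsto (fun w => g w + g z) (𝓝 z) (𝓝 (g z + g z)) := hc.tendsto.add_const _
      refine (this.eventually_ne ?_).filter_mono nhdsWithin_le_nhds
      rw [← two_mul]
      exact mul_ne_zero two_ne_zero hgz
    filter_upwards [hne, self_mem_nhdsWithin] with w hw hwz
    have hwz' : w - z ≠ 0 := sub_ne_zero.mpr hwz
    rw [slope_def_field, slope_def_field, ← hsq, ← hsq]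
    field_simp
    ring
  exact this.differentiableAt.differentiableWithinAt

theorem AnalyticArc.exists_branch (A : AnalyticArc) (S : SqrtBranch A)
    (srp : ℂ → ℂ) (hsrp : BVplus A.Ξ S.sr srp) :
    ∃ (δ : ℝ) (g : ℂ → ℂ) (c : ℂ), 0 < δ ∧ c ≠ 0 ∧ thickening δ realSeg ⊆ A.U ∧
      DifferentiableOn ℂ g (thickening δ realSeg) ∧ (∀ z ∈ thickening δ realSeg, g z ≠ 0) ∧
      ∀ x ∈ Ioo (-1 : ℝ) 1, srp (A.Ξ x) = c * Real.sqrt (1 - x ^ 2) * g x := by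
  obtain ⟨δ, hδ, hδU⟩ := realSeg_compact.exists_thickening_subset_open A.isOpen_U A.seg_sub
  set V := thickening δ realSeg with hV
  have hVo : IsOpen V := isOpen_thickening
  have hVc : Convex ℝ V := realSeg_convex.thickening δ
  have hsegV : realSeg ⊆ V := self_subset_thickening hδ _
  have h1V : (1 : ℂ) ∈ V := hsegV ⟨1, by simp, by simp⟩
  have hm1V : (-1 : ℂ) ∈ V := hsegV ⟨-1, by simp, by simp⟩
  set G : ℂ → ℂ := fun z => dslope A.Ξ 1 z * dslope A.Ξ (-1) z with hG
  have hΞV : DifferentiableOn ℂ A.Ξ V := A.diff.mono hδU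
  have hGd : DifferentiableOn ℂ G V :=
    ((Complex.differentiableOn_dslope (hVo.mem_nhds h1V)).mpr hΞV).mul
      ((Complex.differentiableOn_dslope (hVo.mem_nhds hm1V)).mpr hΞV)
  have hds : ∀ a ∈ A.U, ∀ z ∈ A.U, dslope A.Ξ a z ≠ 0 := by
    intro a ha z hz
    by_cases h : z = a
    · rw [h, dslope_same]
      exact deriv_ne_zero_of_injOn A.isOpen_U A.diff A.inj ha
    · rw [dslope_of_ne _ h, slope_def_field]
      exact div_ne_zero (sub_ne_zero.mpr fun e => h (A.inj hz ha e)) (sub_ne_zero.mpr h)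
  have hG0 : ∀ z ∈ V, G z ≠ 0 := fun z hz =>
    mul_ne_zero (hds 1 (hδU h1V) z (hδU hz)) (hds (-1) (hδU hm1V) z (hδU hz))
  have hGeq : ∀ z, A.Ξ z ^ 2 - 1 = (z ^ 2 - 1) * G z := by
    intro z
    have h1 := sub_smul_dslope A.Ξ 1 z
    have h2 := sub_smul_dslope A.Ξ (-1) z
    rw [A.map_one] at h1
    rw [A.map_neg_one] at h2
    simp only [smul_eq_mul] at h1 h2
    simp only [hG]
    linear_combination (-1 : ℂ) * (A.Ξ z + 1) * h1 - (z - 1) * dslope A.Ξ 1 z * h2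
  have hVsc : IsSimplyConnected V := by
    have := hVc.contractibleSpace ⟨_, h1V⟩
    exact (inferInstance : SimplyConnectedSpace V)
  obtain ⟨g, hgc, hgsq⟩ := exists_continuousOn_pow_eq hVsc hVo hGd.continuousOn
    (by rintro ⟨z, hz, h⟩; exact hG0 z hz h) (two_ne_zero)
  have hgd := differentiableOn_of_sq hVo hgc hGd hgsq hG0
  have hg0 : ∀ z ∈ V, g z ≠ 0 := fun z hz h => hG0 z hz (by rw [← hgsq, h]; simp)
  set W : Set ℂ := V ∩ {z | 0 < z.im} with hW
  have hWc : Convex ℝ W := hVc.inter (convex_halfSpace_im_gt 0)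
  set R : ℂ → ℂ := fun z => I * ((1 - z) ^ (1 / 2 : ℂ) * (1 + z) ^ (1 / 2 : ℂ)) * g z with hR
  have hcp : ∀ w : ℂ, (w ^ (1 / 2 : ℂ)) ^ 2 = w := by
    intro w
    simp
  have hRsq : ∀ z, R z ^ 2 = A.Ξ z ^ 2 - 1 := by
    intro z
    rw [hGeq, ← hgsq]
    simp only [hR, mul_pow, hcp, I_sq]
    ring
  have hWarc : ∀ z ∈ W, A.Ξ z ∈ A.arcᶜ := by
    rintro z ⟨hzV, hz⟩ ⟨w, ⟨x, hx, rfl⟩, hw⟩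
    have := A.inj (A.seg_sub ⟨x, hx, rfl⟩) (hδU hzV) hw
    rw [← this] at hz
    simp at hz
  have hR1 : ∀ z : ℂ, (1 - z).re > 0 ∨ (1 - z).im ≠ 0 → (1 + z).re > 0 ∨ (1 + z).im ≠ 0 →
      z ∈ V → ContinuousAt R z := by
    intro z h1 h2 hz
    have a1 : ContinuousAt (fun z : ℂ => (1 - z) ^ (1 / 2 : ℂ)) z :=
      ContinuousAt.cpow (by fun_prop) continuousAt_const h1
    have a2 : ContinuousAt (fun z : ℂ => (1 + z) ^ (1 / 2 : ℂ)) z :=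
      ContinuousAt.cpow (by fun_prop) continuousAt_const h2
    exact (continuousAt_const.mul (a1.mul a2)).mul (hgc.continuousAt (hVo.mem_nhds hz))
  have hRc : ContinuousOn R W := by
    rintro z ⟨hzV, hz⟩
    have hz' : z.im ≠ 0 := ne_of_gt hz
    exact (hR1 z (Or.inr (by simpa using hz')) (Or.inr (by simpa using hz')) hzV).continuousWithinAt
  have hsrc : ContinuousOn (fun z => S.sr (A.Ξ z)) W :=
    S.diff.continuousOn.comp (hΞV.continuousOn.mono inter_subset_left) hWarc
  have hR0 : ∀ {z}, z ∈ W → R z ≠ 0 := by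
    intro z hz h
    have h2 := hRsq z
    rw [h, hGeq] at h2
    have h3 : z ^ 2 - 1 = 0 := by
      have : (z ^ 2 - 1) * G z = 0 := by rw [← h2]; simp
      exact (mul_eq_zero.mp this).resolve_right (hG0 z hz.1)
    have h4 : (z - 1) * (z + 1) = 0 := by linear_combination h3
    have him : 0 < z.im := hz.2
    rcases mul_eq_zero.mp h4 with h5 | h5
    · rw [sub_eq_zero.mp h5] at him
      simp at him
    · rw [eq_neg_of_add_eq_zero_left h5] at him
      simp at him
  have hsign : ∃ c : ℂ, c ≠ 0 ∧ ∀ z ∈ W, S.sr (A.Ξ z) = c * R z := by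
    rcases hWc.isPreconnected.eq_or_eq_neg_of_sq_eq hsrc hRc (fun z hz => by
      simp only [Pi.pow_apply]
      rw [hRsq, S.sq _ (hWarc z hz)]) hR0 with h | h
    · exact ⟨1, one_ne_zero, fun z hz => by simpa using h hz⟩
    · exact ⟨-1, by simp, fun z hz => by simpa using h hz⟩
  obtain ⟨c, hc0, hc⟩ := hsign
  refine ⟨δ, g, c * I, hδ, mul_ne_zero hc0 I_ne_zero, hδU, hgd, hg0, fun x hx => ?_⟩
  have hxV : (x : ℂ) ∈ V := hsegV ⟨x, ⟨hx.1.le, hx.2.le⟩, rfl⟩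
  have hpath : Tendsto (fun y : ℝ => (x : ℂ) + y * I) (𝓝[>] 0) (𝓝 (x : ℂ)) := by
    have : Continuous fun y : ℝ => (x : ℂ) + y * I := by fun_prop
    have := this.tendsto 0
    simp only [ofReal_zero, zero_mul, add_zero] at this
    exact this.mono_left nhdsWithin_le_nhds
  have hlim1 := hsrp x hx
  have hRx : ContinuousAt R x := hR1 x (Or.inl (by simp; linarith [hx.2]))
    (Or.inl (by simp; linarith [hx.1])) hxV
  have hlim2 : Tendsto (fun y : ℝ => S.sr (A.Ξ (x + y * I))) (𝓝[>] 0) (𝓝 (c * R x)) := by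
    refine ((hRx.tendsto.comp hpath).const_mul c).congr' ?_
    filter_upwards [hpath.eventually (hVo.mem_nhds hxV), self_mem_nhdsWithin] with y hy hy0
    exact (hc _ ⟨hy, by simpa using hy0⟩).symm
  rw [tendsto_nhds_unique hlim1 hlim2]
  have hsqrt : (1 - (x : ℂ)) ^ (1 / 2 : ℂ) * (1 + (x : ℂ)) ^ (1 / 2 : ℂ)
      = (Real.sqrt (1 - x ^ 2) : ℂ) := by
    have e1 : (1 - (x : ℂ)) = ((1 - x : ℝ) : ℂ) := by push_cast; ring
    have e2 : (1 + (x : ℂ)) = ((1 + x : ℝ) : ℂ) := by push_cast; ring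
    have e3 : (1 / 2 : ℂ) = ((1 / 2 : ℝ) : ℂ) := by push_cast; ring
    rw [e1, e2, e3, ← ofReal_cpow (by linarith [hx.2]), ← ofReal_cpow (by linarith [hx.1]),
      ← ofReal_mul, ← Real.mul_rpow (by linarith [hx.2]) (by linarith [hx.1]), Real.sqrt_eq_rpow]
    congr 2
    ring
  simp only [hR]
  rw [hsqrt]
  ring

/-- The difference quotient of a holomorphic function is jointly continuous. -/
theorem continuousOn_uncurry_dslope {f : ℂ → ℂ} {V : Set ℂ} (hV : IsOpen V)
    (hf : DifferentiableOn ℂ f V) : ContinuousOn (fun z : ℂ × ℂ => dslope f z.1 z.2) (V ×ˢ V) := by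
  rintro ⟨a, b⟩ ⟨ha, hb⟩
  apply ContinuousAt.continuousWithinAt
  simp only at ha hb
  have hfa : ContinuousAt f a := (hf.differentiableAt (hV.mem_nhds ha)).continuousAt
  have hfb : ContinuousAt f b := (hf.differentiableAt (hV.mem_nhds hb)).continuousAt
  by_cases hab : a = b
  · subst hab
    have hd : ContinuousAt (deriv f) a :=
      ((hf.deriv hV).differentiableAt (hV.mem_nhds ha)).continuousAt
    have hs : HasStrictDerivAt f (deriv f a) a :=
      (hf.analyticAt (hV.mem_nhds ha)).hasStrictDerivAt
    rw [hasStrictDerivAt_iff_hasStrictFDerivAt, hasStrictFDerivAt_iff_isLittleO] at hs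
    rw [Metric.continuousAt_iff']
    intro ε hε
    have h1 := hs.def (half_pos hε)
    have h2 : ∀ᶠ z : ℂ × ℂ in 𝓝 (a, a), dist (deriv f z.1) (deriv f a) < ε :=
      (continuous_fst.tendsto (a, a)).eventually (Metric.continuousAt_iff'.mp hd ε hε)
    filter_upwards [h1, h2] with z hz1 hz2
    rw [dslope_same]
    by_cases hz : z.2 = z.1
    · rw [hz, dslope_same]; exact hz2
    · rw [dslope_of_ne _ hz, slope_def_field, dist_eq_norm]
      have hz' : z.2 - z.1 ≠ 0 := sub_ne_zero.mpr hz
      have hz'' : z.1 - z.2 ≠ 0 := sub_ne_zero.mpr (Ne.symm hz)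
      have e : (f z.2 - f z.1) / (z.2 - z.1) - deriv f a
          = (f z.1 - f z.2 - (z.1 - z.2) * deriv f a) / (z.1 - z.2) := by
        field_simp
        ring
      rw [e, norm_div, div_lt_iff₀ (norm_pos_iff.mpr hz'')]
      simp at hz1
      have : 0 < ‖z.1 - z.2‖ := norm_pos_iff.mpr hz''
      nlinarith
  · have : ∀ᶠ z : ℂ × ℂ in 𝓝 (a, b), dslope f z.1 z.2 = (f z.2 - f z.1) / (z.2 - z.1) := by
      have ho : IsOpen {z : ℂ × ℂ | z.1 ≠ z.2} :=
        isOpen_ne_fun continuous_fst continuous_snd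
      filter_upwards [ho.mem_nhds (show (a, b) ∈ {z : ℂ × ℂ | z.1 ≠ z.2} from hab)] with z hz
      rw [dslope_of_ne _ (Ne.symm hz), slope_def_field]
    refine ContinuousAt.congr ?_ (EventuallyEq.symm this)
    have h1 : Tendsto (fun z : ℂ × ℂ => f z.2) (𝓝 (a, b)) (𝓝 (f b)) :=
      hfb.tendsto.comp (continuous_snd.tendsto (a, b))
    have h2 : Tendsto (fun z : ℂ × ℂ => f z.1) (𝓝 (a, b)) (𝓝 (f a)) :=
      hfa.tendsto.comp (continuous_fst.tendsto (a, b))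
    have h3 : Tendsto (fun z : ℂ × ℂ => z.2 - z.1) (𝓝 (a, b)) (𝓝 (b - a)) :=
      (continuous_snd.sub continuous_fst).tendsto (a, b)
    exact (h1.sub h2).div h3 (sub_ne_zero.mpr (Ne.symm hab))

/-- On compact subsets, the difference quotient of a univalent function is bounded above and
below. -/
theorem exists_dslope_bounds {f : ℂ → ℂ} {V K : Set ℂ} (hV : IsOpen V)
    (hf : DifferentiableOn ℂ f V) (hinj : InjOn f V) (hK : IsCompact K) (hKV : K ⊆ V) :
    ∃ c C : ℝ, 0 < c ∧ 0 < C ∧ ∀ s ∈ K, ∀ z ∈ K, c ≤ ‖dslope f s z‖ ∧ ‖dslope f s z‖ ≤ C := by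
  have hcont := (continuousOn_uncurry_dslope hV hf).mono (prod_mono hKV hKV)
  rcases K.eq_empty_or_nonempty with rfl | ⟨k, hk⟩
  · exact ⟨1, 1, one_pos, one_pos, by simp⟩
  have hne : ∀ s ∈ K, ∀ z ∈ K, dslope f s z ≠ 0 := by
    intro s hs z hz
    by_cases h : z = s
    · rw [h, dslope_same]; exact deriv_ne_zero_of_injOn hV hf hinj (hKV hs)
    · rw [dslope_of_ne _ h, slope_def_field]
      exact div_ne_zero (sub_ne_zero.mpr fun e => h (hinj (hKV hz) (hKV hs) e))
        (sub_ne_zero.mpr h)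
  have hpm : IsCompact (K ×ˢ K) := hK.prod hK
  have hne2 : (K ×ˢ K).Nonempty := ⟨(k, k), mk_mem_prod hk hk⟩
  have hcn : ContinuousOn (fun z : ℂ × ℂ => ‖dslope f z.1 z.2‖) (K ×ˢ K) := hcont.norm
  obtain ⟨p, hp, hmin⟩ := hpm.exists_isMinOn hne2 hcn
  obtain ⟨C, hC⟩ := hpm.exists_bound_of_continuousOn hcont
  rw [isMinOn_iff] at hmin
  have hlo : ∀ s ∈ K, ∀ z ∈ K, ‖dslope f p.1 p.2‖ ≤ ‖dslope f s z‖ :=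
    fun s hs z hz => hmin (s, z) (mk_mem_prod hs hz)
  have hup : ∀ s ∈ K, ∀ z ∈ K, ‖dslope f s z‖ ≤ C :=
    fun s hs z hz => hC (s, z) (mk_mem_prod hs hz)
  refine ⟨‖dslope f p.1 p.2‖, C, norm_pos_iff.mpr (hne _ hp.1 _ hp.2), ?_, fun s hs z hz =>
    ⟨hlo s hs z hz, hup s hs z hz⟩⟩
  have h1 : 0 < ‖dslope f k k‖ := norm_pos_iff.mpr (hne k hk k hk)
  exact h1.trans_le (hup k hk k hk)

/-- Uniform bound for the difference quotient of a bounded holomorphic function. -/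
theorem norm_dslope_le {f : ℂ → ℂ} {s z : ℂ} {r M : ℝ} {V : Set ℂ} (hr : 0 < r)
    (hf : DifferentiableOn ℂ f V)
    (hs : closedBall s r ⊆ V) (hz : z ∈ V) (hM : ∀ w ∈ V, ‖f w‖ ≤ M) :
    ‖dslope f s z‖ ≤ 2 * M / r := by
  have hsV : s ∈ V := hs (mem_closedBall_self hr.le)
  have hM' : ∀ w ∈ V, ‖f w - f s‖ ≤ 2 * M := fun w hw => by
    linarith [norm_sub_le (f w) (f s), hM w hw, hM s hsV]
  by_cases h : z ∈ ball s r
  · refine Complex.norm_dslope_le_div_of_mapsTo_ball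
      (hf.mono (ball_subset_closedBall.trans hs)) ?_ h
    intro w hw
    rw [mem_closedBall, dist_eq_norm]
    exact hM' w (hs (ball_subset_closedBall hw))
  · rw [mem_ball, not_lt] at h
    have hzs : z ≠ s := by rintro rfl; simp at h; linarith
    rw [dslope_of_ne _ hzs, slope_def_field, norm_div, ← dist_eq_norm z s]
    have hM0 : 0 ≤ 2 * M := (norm_nonneg _).trans (hM' z hz)
    exact div_le_div₀ hM0 (hM' z hz) hr h

theorem closedBall_subset_thickening_realSeg {s : ℂ} (hs : s ∈ realSeg) {r δ : ℝ} (h : r < δ) :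
    closedBall s r ⊆ thickening δ realSeg := fun _ hw =>
  mem_thickening_iff.mpr ⟨s, hs, (mem_closedBall.mp hw).trans_lt h⟩

/-- The arc parametrization is bi-Lipschitz on `[-1,1]`. -/
theorem AnalyticArc.exists_bilipschitz (A : AnalyticArc) :
    ∃ c C : ℝ, 0 < c ∧ 0 < C ∧
      (∀ x ∈ Icc (-1 : ℝ) 1, ∀ y ∈ Icc (-1 : ℝ) 1, c * |x - y| ≤ ‖A.Ξ x - A.Ξ y‖ ∧
        ‖A.Ξ x - A.Ξ y‖ ≤ C * |x - y|) ∧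
      (∀ x ∈ Icc (-1 : ℝ) 1, c ≤ ‖deriv A.Ξ x‖ ∧ ‖deriv A.Ξ x‖ ≤ C) := by
  obtain ⟨c, C, hc, hC, h⟩ := exists_dslope_bounds A.isOpen_U A.diff A.inj realSeg_compact
    A.seg_sub
  refine ⟨c, C, hc, hC, fun x hx y hy => ?_, fun x hx => ?_⟩
  · have h1 := h y (ofReal_mem_realSeg hy) x (ofReal_mem_realSeg hx)
    have h2 : ‖A.Ξ x - A.Ξ y‖ = |x - y| * ‖dslope A.Ξ y x‖ := by
      rw [← sub_smul_dslope, norm_smul, ← ofReal_sub, norm_real, Real.norm_eq_abs]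
    rw [h2, mul_comm c, mul_comm C]
    exact ⟨mul_le_mul_of_nonneg_left h1.1 (abs_nonneg _),
      mul_le_mul_of_nonneg_left h1.2 (abs_nonneg _)⟩
  · have h1 := h x (ofReal_mem_realSeg hx) x (ofReal_mem_realSeg hx)
    rwa [dslope_same] at h1

/-- The Cauchy kernel on the arc is a Lipschitz perturbation of the Cauchy kernel on the
segment. -/
theorem AnalyticArc.exists_kernel (A : AnalyticArc) {δ : ℝ} {g : ℂ → ℂ} (hδ : 0 < δ)
    (hVU : thickening δ realSeg ⊆ A.U) (hg : DifferentiableOn ℂ g (thickening δ realSeg))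
    (hg0 : ∀ z ∈ thickening δ realSeg, g z ≠ 0) :
    ∃ (m : ℝ → ℝ → ℂ) (B L : ℝ),
      (∀ s ∈ Icc (-1 : ℝ) 1, ∀ σ ∈ Icc (-1 : ℝ) 1, ‖m s σ‖ ≤ B) ∧
      (∀ s ∈ Icc (-1 : ℝ) 1, ∀ σ ∈ Icc (-1 : ℝ) 1, ∀ τ ∈ Icc (-1 : ℝ) 1,
        ‖m s σ - m s τ‖ ≤ L * |σ - τ|) ∧
      (∀ s ∈ Icc (-1 : ℝ) 1, ∀ σ ∈ Icc (-1 : ℝ) 1, s ≠ σ →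
        g σ * deriv A.Ξ s / (g s * (A.Ξ s - A.Ξ σ)) = 1 / (s - σ) + m s σ) ∧
      (∀ σ ∈ Icc (-1 : ℝ) 1, ContinuousOn (fun s => m s σ) (Icc (-1 : ℝ) 1 \ {σ})) := by
  set V := thickening δ realSeg with hV
  have hVo : IsOpen V := isOpen_thickening
  have hSV : realSeg ⊆ V := self_subset_thickening hδ _
  set W := thickening (δ / 2) realSeg with hW
  have hWo : IsOpen W := isOpen_thickening
  have hSW : realSeg ⊆ W := self_subset_thickening (half_pos hδ) _
  set K := cthickening (δ / 2) realSeg with hK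
  have hKc : IsCompact K := realSeg_compact.cthickening
  have hKV : K ⊆ V := cthickening_subset_thickening' hδ (half_lt_self hδ) _
  have hWK : W ⊆ K := thickening_subset_cthickening _ _
  have hΞ : DifferentiableOn ℂ A.Ξ V := A.diff.mono hVU
  have hinj : InjOn A.Ξ V := A.inj.mono hVU
  obtain ⟨c, C, hc, hC, hcC⟩ := exists_dslope_bounds hVo hΞ hinj hKc hKV
  obtain ⟨Bg, hBg⟩ := hKc.exists_bound_of_continuousOn (hg.continuousOn.mono hKV)
  have hgi : ContinuousOn (fun z => (g z)⁻¹) realSeg :=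
    (hg.continuousOn.mono hSV).inv₀ fun z hz => hg0 z (hSV hz)
  obtain ⟨Bi, hBi⟩ := realSeg_compact.exists_bound_of_continuousOn hgi
  set F : ℂ → ℂ → ℂ := fun s z => g z / dslope A.Ξ s z with hF
  have hds0 : ∀ s ∈ K, ∀ z ∈ K, dslope A.Ξ s z ≠ 0 := fun s hs z hz h0 => by
    have := (hcC s hs z hz).1
    rw [h0, norm_zero] at this
    linarith
  have hFd : ∀ s ∈ realSeg, DifferentiableOn ℂ (F s) W := by
    intro s hs
    refine (hg.mono (hWK.trans hKV)).div ?_ fun z hz => hds0 s (hWK (hSW hs)) z (hWK hz)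
    exact (Complex.differentiableOn_dslope (hWo.mem_nhds (hSW hs))).mpr
      (hΞ.mono (hWK.trans hKV))
  have hFb : ∀ s ∈ realSeg, ∀ z ∈ W, ‖F s z‖ ≤ Bg / c := by
    intro s hs z hz
    rw [hF, norm_div]
    exact div_le_div₀ ((norm_nonneg _).trans (hBg z (hWK hz))) (hBg z (hWK hz)) hc
      (hcC s (hWK (hSW hs)) z (hWK hz)).1
  set M1 := 2 * (Bg / c) / (δ / 4) with hM1
  have hdb : ∀ s ∈ realSeg, ∀ z ∈ W, ‖dslope (F s) s z‖ ≤ M1 := fun s hs z hz =>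
    norm_dslope_le (by positivity) (hFd s hs)
      (closedBall_subset_thickening_realSeg hs (by linarith)) hz (hFb s hs)
  have hdd : ∀ s ∈ realSeg, DifferentiableOn ℂ (dslope (F s) s) W := fun s hs =>
    (Complex.differentiableOn_dslope (hWo.mem_nhds (hSW hs))).mpr (hFd s hs)
  have hder : ∀ s ∈ realSeg, ∀ z ∈ realSeg, ‖deriv (dslope (F s) s) z‖ ≤ M1 / (δ / 4) := by
    intro s hs z hz
    have hb := closedBall_subset_thickening_realSeg hz (show δ / 4 < δ / 2 by linarith)
    refine Complex.norm_deriv_le_of_forall_mem_sphere_norm_le (by positivity) ?_ ?_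
    · refine ((hdd s hs).mono ?_).diffContOnCl
      rw [closure_ball _ (by positivity)]
      exact hb
    · exact fun w hw => hdb s hs w (hb (sphere_subset_closedBall hw))
  have hlip : ∀ s ∈ realSeg, ∀ z ∈ realSeg, ∀ w ∈ realSeg,
      ‖dslope (F s) s z - dslope (F s) s w‖ ≤ M1 / (δ / 4) * ‖z - w‖ := by
    intro s hs z hz w hw
    exact realSeg_convex.norm_image_sub_le_of_norm_deriv_le
      (fun x hx => (hdd s hs).differentiableAt (hWo.mem_nhds (hSW hx))) (hder s hs) hw hz
  have hfac : ∀ s ∈ realSeg, ‖deriv A.Ξ s * (g s)⁻¹‖ ≤ C * Bi := by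
    intro s hs
    have h1 := (hcC s (hWK (hSW hs)) s (hWK (hSW hs))).2
    rw [dslope_same] at h1
    rw [norm_mul]
    exact mul_le_mul h1 (hBi s hs) (norm_nonneg _) hC.le
  have hform : ∀ s ∈ Icc (-1 : ℝ) 1, ∀ σ ∈ Icc (-1 : ℝ) 1, s ≠ σ →
        g σ * deriv A.Ξ s / (g s * (A.Ξ s - A.Ξ σ)) = 1 / (s - σ) +
          -(deriv A.Ξ s * (g s)⁻¹) * dslope (F s) s σ := by
    intro s hs σ hσ hne
    have hs' := ofReal_mem_realSeg hs
    have hσ' := ofReal_mem_realSeg hσ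
    have hne' : (σ : ℂ) ≠ s := fun h => hne (ofReal_injective h).symm
    have h0 : (s : ℂ) - σ ≠ 0 := sub_ne_zero.mpr (Ne.symm hne')
    have h0' : (σ : ℂ) - s ≠ 0 := sub_ne_zero.mpr hne'
    have hgs := hg0 _ (hSV hs')
    have hd0 : deriv A.Ξ s ≠ 0 := deriv_ne_zero_of_injOn hVo hΞ hinj (hSV hs')
    have hΞ0 : A.Ξ s - A.Ξ σ ≠ 0 :=
      sub_ne_zero.mpr fun h => hne' (hinj (hSV hσ') (hSV hs') h.symm)
    have hΞ0' : A.Ξ σ - A.Ξ s ≠ 0 :=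
      sub_ne_zero.mpr fun h => hne' (hinj (hSV hσ') (hSV hs') h)
    rw [dslope_of_ne _ hne', slope_def_field, hF]
    simp only
    rw [dslope_same, dslope_of_ne _ hne', slope_def_field]
    rw [← neg_sub (A.Ξ s) (A.Ξ σ), ← neg_sub (s : ℂ) σ]
    field_simp
    ring
  refine ⟨fun s σ => -(deriv A.Ξ s * (g s)⁻¹) * dslope (F s) s σ, C * Bi * M1,
    C * Bi * (M1 / (δ / 4)), ?_, ?_, hform, ?_⟩
  · intro s hs σ hσ
    have hs' := ofReal_mem_realSeg hs
    rw [norm_mul, norm_neg]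
    exact mul_le_mul (hfac s hs') (hdb s hs' σ (hSW (ofReal_mem_realSeg hσ))) (norm_nonneg _)
      ((norm_nonneg _).trans (hfac s hs'))
  · intro s hs σ hσ τ hτ
    have hs' := ofReal_mem_realSeg hs
    rw [← mul_sub, norm_mul, norm_neg, mul_assoc (C * Bi)]
    have h1 := hlip s hs' σ (ofReal_mem_realSeg hσ) τ (ofReal_mem_realSeg hτ)
    rw [← ofReal_sub, norm_real, Real.norm_eq_abs] at h1
    exact mul_le_mul (hfac s hs') h1 (norm_nonneg _) ((norm_nonneg _).trans (hfac s hs'))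
  · intro σ hσ
    have hofR : ContinuousOn (fun s : ℝ => (s : ℂ)) (Icc (-1 : ℝ) 1 \ {σ}) :=
      Complex.continuous_ofReal.continuousOn
    have hmaps : MapsTo (fun s : ℝ => (s : ℂ)) (Icc (-1 : ℝ) 1 \ {σ}) V :=
      fun s hs => hSV (ofReal_mem_realSeg hs.1)
    have c1 : ContinuousOn (fun s : ℝ => g s) (Icc (-1 : ℝ) 1 \ {σ}) :=
      hg.continuousOn.comp hofR hmaps
    have c2 : ContinuousOn (fun s : ℝ => A.Ξ s) (Icc (-1 : ℝ) 1 \ {σ}) :=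
      hΞ.continuousOn.comp hofR hmaps
    have c3 : ContinuousOn (fun s : ℝ => deriv A.Ξ s) (Icc (-1 : ℝ) 1 \ {σ}) :=
      (hΞ.deriv hVo).continuousOn.comp hofR hmaps
    have c4 : ContinuousOn (fun s : ℝ => g σ * deriv A.Ξ s / (g s * (A.Ξ s - A.Ξ σ))
        - 1 / ((s : ℂ) - σ)) (Icc (-1 : ℝ) 1 \ {σ}) := by
      refine ((continuousOn_const.mul c3).div (c1.mul (c2.sub continuousOn_const)) ?_).sub
        (continuousOn_const.div (hofR.sub continuousOn_const) ?_)
      · intro s hs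
        refine mul_ne_zero (hg0 _ (hmaps hs)) (sub_ne_zero.mpr fun h => hs.2 ?_)
        exact ofReal_injective (hinj (hmaps hs) (hSV (ofReal_mem_realSeg hσ)) h)
      · intro s hs
        exact sub_ne_zero.mpr fun h => hs.2 (ofReal_injective h)
    refine c4.congr fun s hs => ?_
    beta_reduce
    rw [hform s hs.1 σ hσ hs.2]
    ring

/-- Hölder's inequality with explicit bounds for the two factors. -/
theorem integral_mul_le_of_lintegral_rpow_le {X : Type*} [MeasurableSpace X] {μ : Measure X}
    {p p' : ℝ} (hpp : p.HolderConjugate p') {f w : X → ℝ} (hf0 : ∀ x, 0 ≤ f x)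
    (hw0 : ∀ x, 0 ≤ w x) (hf : AEStronglyMeasurable f μ) (hw : AEStronglyMeasurable w μ)
    {Q W : ℝ} (hQ : 0 ≤ Q) (hW : 0 ≤ W)
    (hfQ : ∫⁻ x, ENNReal.ofReal (f x ^ p) ∂μ ≤ ENNReal.ofReal (Q ^ p))
    (hwW : ∫⁻ x, ENNReal.ofReal (w x ^ p') ∂μ ≤ ENNReal.ofReal (W ^ p')) :
    Integrable (fun x => f x * w x) μ ∧ ∫ x, f x * w x ∂μ ≤ Q * W := by
  have h := ENNReal.lintegral_mul_le_Lp_mul_Lq μ hpp (hf.aemeasurable.ennreal_ofReal)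
    (hw.aemeasurable.ennreal_ofReal)
  have e1 : ∀ x, ENNReal.ofReal (f x) ^ p = ENNReal.ofReal (f x ^ p) := fun x =>
    ENNReal.ofReal_rpow_of_nonneg (hf0 x) hpp.nonneg
  have e2 : ∀ x, ENNReal.ofReal (w x) ^ p' = ENNReal.ofReal (w x ^ p') := fun x =>
    ENNReal.ofReal_rpow_of_nonneg (hw0 x) hpp.symm.nonneg
  have e3 : ∀ x, ((fun x => ENNReal.ofReal (f x)) * fun x => ENNReal.ofReal (w x)) x
      = ENNReal.ofReal (f x * w x) := fun x => by
    simp [ENNReal.ofReal_mul (hf0 x)]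
  simp only [e1, e2, e3] at h
  have h2 : ∫⁻ x, ENNReal.ofReal (f x * w x) ∂μ ≤ ENNReal.ofReal (Q * W) := by
    refine h.trans ?_
    rw [ENNReal.ofReal_mul hQ]
    refine mul_le_mul' ?_ ?_
    · refine (ENNReal.rpow_le_rpow hfQ (by have := hpp.pos; positivity)).trans ?_
      rw [ENNReal.ofReal_rpow_of_nonneg (by positivity) (by have := hpp.pos; positivity),
        ← Real.rpow_mul hQ, mul_one_div, div_self hpp.ne_zero, Real.rpow_one]
    · refine (ENNReal.rpow_le_rpow hwW (by have := hpp.symm.pos; positivity)).trans ?_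
      rw [ENNReal.ofReal_rpow_of_nonneg (by positivity) (by have := hpp.symm.pos; positivity),
        ← Real.rpow_mul hW, mul_one_div, div_self hpp.symm.ne_zero, Real.rpow_one]
  have hnn : ∀ x, 0 ≤ f x * w x := fun x => mul_nonneg (hf0 x) (hw0 x)
  have hInt : Integrable (fun x => f x * w x) μ := by
    refine ⟨hf.mul hw, ?_⟩
    rw [hasFiniteIntegral_iff_ofReal (Eventually.of_forall hnn)]
    exact h2.trans_lt ENNReal.ofReal_lt_top
  refine ⟨hInt, ?_⟩
  rw [integral_eq_lintegral_of_nonneg_ae (Eventually.of_forall hnn) (hf.mul hw)]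
  exact ENNReal.toReal_le_of_le_ofReal (mul_nonneg hQ hW) h2

/-- Hölder's inequality against the constant weight on a set of small measure. -/
theorem integral_le_of_lintegral_rpow_le {p p' : ℝ} (hpp : p.HolderConjugate p') {f : ℝ → ℝ}
    {E E' : Set ℝ} (hEE : E' ⊆ E)
    (hf0 : ∀ x, 0 ≤ f x) (hf : AEStronglyMeasurable f (volume.restrict E))
    {Q l : ℝ} (hQ : 0 ≤ Q) (hl : 0 ≤ l) (hlE : volume E' ≤ ENNReal.ofReal l)
    (hfQ : ∫⁻ x in E, ENNReal.ofReal (f x ^ p) ≤ ENNReal.ofReal (Q ^ p)) :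
    IntegrableOn f E' ∧ ∫ x in E', f x ≤ Q * l ^ (1 - 1 / p) := by
  have h1 : (1 - 1 / p) = 1 / p' := by
    have := hpp.inv_add_inv_eq_one
    rw [one_div, one_div]; linarith
  have h := integral_mul_le_of_lintegral_rpow_le (μ := volume.restrict E') hpp hf0
    (w := fun _ => 1) (fun _ => zero_le_one) (hf.mono_measure (Measure.restrict_mono hEE le_rfl))
    aestronglyMeasurable_const hQ (W := l ^ (1 / p')) (by positivity)
    ((lintegral_mono_set hEE).trans hfQ) ?_
  · simp only [mul_one] at h
    rw [h1]
    exact h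
  · rw [← Real.rpow_mul hl, one_div_mul_cancel hpp.symm.ne_zero, Real.rpow_one]
    simpa using hlE

/-- The pointwise (Hajłasz type) inequality for fractional Sobolev functions. -/
theorem norm_sub_le_of_lintegral_le {p p' : ℝ} (hpp : p.HolderConjugate p') {v : ℝ → ℂ}
    {E : Set ℝ} (hv : AEStronglyMeasurable v (volume.restrict E)) {σ τ Qσ Qτ : ℝ}
    (hE : uIoc σ τ ⊆ E) (hQσ : 0 ≤ Qσ) (hQτ : 0 ≤ Qτ)
    (hσ : ∫⁻ s in E, ENNReal.ofReal ((‖v s - v σ‖ / |s - σ|) ^ p) ≤ ENNReal.ofReal (Qσ ^ p))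
    (hτ : ∫⁻ s in E, ENNReal.ofReal ((‖v s - v τ‖ / |s - τ|) ^ p) ≤ ENNReal.ofReal (Qτ ^ p)) :
    ‖v σ - v τ‖ ≤ (Qσ + Qτ) * |σ - τ| ^ (1 - 1 / p) := by
  rcases eq_or_ne σ τ with rfl | hne
  · simp only [sub_self, norm_zero]
    positivity
  set h := |σ - τ| with hh
  have hpos : 0 < h := abs_pos.mpr (sub_ne_zero.mpr hne)
  have hvol : volume (uIoc σ τ) = ENNReal.ofReal h := by
    rw [uIoc, Real.volume_Ioc, max_sub_min_eq_abs, abs_sub_comm]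
  have hmeas : ∀ a : ℝ, AEStronglyMeasurable (fun s => ‖v s - v a‖ / |s - a|)
      (volume.restrict E) := fun a =>
    (((hv.sub aestronglyMeasurable_const).norm.aemeasurable).div
      (by fun_prop)).aestronglyMeasurable
  obtain ⟨i1, b1⟩ := integral_le_of_lintegral_rpow_le hpp hE
    (fun s => by positivity) (hmeas σ) hQσ hpos.le hvol.le hσ
  obtain ⟨i2, b2⟩ := integral_le_of_lintegral_rpow_le hpp hE
    (fun s => by positivity) (hmeas τ) hQτ hpos.le hvol.le hτ
  have hcon : ∫ s in uIoc σ τ, ‖v σ - v τ‖ / h = ‖v σ - v τ‖ := by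
    rw [setIntegral_const, Measure.real, hvol, ENNReal.toReal_ofReal hpos.le, smul_eq_mul]
    field_simp
  have hlin : ∀ a s : ℝ, |s - a| ≤ h → ‖v s - v a‖ ≤ ‖v s - v a‖ / |s - a| * h := by
    intro a s hs
    rcases eq_or_ne s a with rfl | hsa
    · simp
    · have h0 : 0 < |s - a| := abs_pos.mpr (sub_ne_zero.mpr hsa)
      rw [div_mul_eq_mul_div, le_div_iff₀ h0]
      exact mul_le_mul_of_nonneg_left hs (norm_nonneg _)
  have hpt : ∀ s ∈ uIoc σ τ,
      ‖v σ - v τ‖ / h ≤ ‖v s - v σ‖ / |s - σ| + ‖v s - v τ‖ / |s - τ| := by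
    intro s hs
    have hs' := uIoc_subset_uIcc hs
    have hs1 : |s - σ| ≤ h := by
      rw [hh, abs_sub_comm σ τ]; exact abs_sub_left_of_mem_uIcc hs'
    have hs2 : |s - τ| ≤ h := by
      rw [abs_sub_comm]
      exact (abs_sub_right_of_mem_uIcc hs').trans_eq (abs_sub_comm _ _)
    rw [div_le_iff₀ hpos, add_mul]
    calc ‖v σ - v τ‖ ≤ ‖v s - v σ‖ + ‖v s - v τ‖ := by
          rw [← norm_neg (v s - v σ), neg_sub]
          exact norm_sub_le_norm_sub_add_norm_sub _ _ _
      _ ≤ _ := add_le_add (hlin σ s hs1) (hlin τ s hs2)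
  have hmono := setIntegral_mono_on (integrableOn_const (by rw [hvol]; exact ENNReal.ofReal_ne_top))
    (i1.add i2) measurableSet_uIoc hpt
  rw [hcon, integral_add' i1 i2] at hmono
  linarith

/-- The inner integral in the Gagliardo seminorm on `[-1,1]`. -/
def gagliardo (p : ℝ) (v : ℝ → ℂ) (x : ℝ) : ℝ≥0∞ :=
  ∫⁻ s in Icc (-1 : ℝ) 1, ENNReal.ofReal ((‖v s - v x‖ / |s - x|) ^ p)

theorem measurable_gagliardo (p : ℝ) {v : ℝ → ℂ} (hv : Measurable v) :
    Measurable (gagliardo p v) := by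
  unfold gagliardo
  refine Measurable.lintegral_prod_right'
    (f := fun z : ℝ × ℝ => ENNReal.ofReal ((‖v z.2 - v z.1‖ / |z.2 - z.1|) ^ p)) ?_
  exact ((((hv.comp measurable_snd).sub (hv.comp measurable_fst)).norm.div
    (by fun_prop)).pow_const p).ennreal_ofReal

theorem holderConjugate_conj {p : ℝ} (hp : 2 < p) : p.HolderConjugate (p / (p - 1)) :=
  Real.HolderConjugate.conjExponent (by linarith)

theorem norm_sub_le_of_gagliardo_le {p : ℝ} (hp : 2 < p) {v : ℝ → ℂ} (hv : Measurable v)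
    {σ τ Qσ Qτ : ℝ} (hσI : σ ∈ Icc (-1 : ℝ) 1) (hτI : τ ∈ Icc (-1 : ℝ) 1)
    (hQσ : 0 ≤ Qσ) (hQτ : 0 ≤ Qτ)
    (hσ : gagliardo p v σ ≤ ENNReal.ofReal (Qσ ^ p))
    (hτ : gagliardo p v τ ≤ ENNReal.ofReal (Qτ ^ p)) :
    ‖v σ - v τ‖ ≤ (Qσ + Qτ) * |σ - τ| ^ (1 - 1 / p) :=
  norm_sub_le_of_lintegral_le (holderConjugate_conj hp) hv.aestronglyMeasurable
    (uIoc_subset_uIcc.trans (uIcc_subset_Icc hσI hτI)) hQσ hQτ hσ hτ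

/-- In a set on which the seminorm is finite one finds points with small inner integral. -/
theorem exists_gagliardo_le {p Λ a : ℝ} (hp : 0 < p) (hΛ : 0 ≤ Λ) (ha : 0 < a) {v : ℝ → ℂ}
    (hv : Measurable v) {J : Set ℝ}
    (hJI : J ⊆ Icc (-1 : ℝ) 1) (hJv : volume J = ENNReal.ofReal a)
    (hG : ∫⁻ x in Icc (-1 : ℝ) 1, gagliardo p v x ≤ ENNReal.ofReal (Λ ^ p)) :
    ∃ z ∈ J, gagliardo p v z ≤ ENNReal.ofReal ((Λ * a ^ (-1 / p)) ^ p) := by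
  have ha' : ENNReal.ofReal a ≠ 0 := by simpa using ha
  obtain ⟨z, hz, hz2⟩ := exists_le_setLAverage (μ := volume) (s := J) (f := gagliardo p v)
    (by rwa [hJv]) (by rw [hJv]; exact ENNReal.ofReal_ne_top)
    (measurable_gagliardo p hv).aemeasurable
  refine ⟨z, hz, hz2.trans ?_⟩
  rw [setLAverage_eq, hJv, Real.mul_rpow hΛ (by positivity), ← Real.rpow_mul ha.le,
    div_mul_cancel₀ _ hp.ne', Real.rpow_neg_one, ← div_eq_mul_inv, ENNReal.ofReal_div_of_pos ha]
  exact ENNReal.div_le_div_right ((lintegral_mono_set hJI).trans hG) _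

/-- Chaining estimate. -/
theorem norm_sub_le_of_chain {p Λ h : ℝ} (hp : 2 < p) (hΛ : 0 ≤ Λ) (hh : 0 < h) {v : ℝ → ℂ}
    (hv : Measurable v) (hG : ∫⁻ x in Icc (-1 : ℝ) 1, gagliardo p v x ≤ ENNReal.ofReal (Λ ^ p))
    {x : ℝ} (hx : x ∈ Icc (-1 : ℝ) 1) (hxG : gagliardo p v x ≠ ⊤) {J : ℕ → Set ℝ}
    (hJI : ∀ k, J k ⊆ Icc (-1 : ℝ) 1) (hJv : ∀ k, volume (J k) = ENNReal.ofReal (h / 2 ^ k))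
    (hJx : ∀ k, ∀ z ∈ J k, |z - x| ≤ h / 2 ^ k) {z₀ : ℝ} (hz₀ : z₀ ∈ J 0)
    (hz₀G : gagliardo p v z₀ ≤ ENNReal.ofReal ((Λ * h ^ (-1 / p)) ^ p)) :
    ‖v z₀ - v x‖ ≤ 8 / (1 - 2 ^ (-(1 - 2 / p))) * Λ * h ^ (1 - 2 / p) := by
  have hp0 : 0 < p := by linarith
  have hpi : 1 / p < 1 / 2 := one_div_lt_one_div_of_lt (by norm_num) hp
  have hpi0 : 0 < 1 / p := by positivity
  have h2p : 2 / p = 1 / p + 1 / p := by ring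
  set a : ℕ → ℝ := fun k => h / 2 ^ k with ha_def
  have ha : ∀ k, 0 < a k := fun k => by positivity
  set Q : ℕ → ℝ := fun k => Λ * a k ^ (-1 / p) with hQ_def
  have hQ : ∀ k, 0 ≤ Q k := fun k => by have := ha k; positivity
  have hex : ∀ k, ∃ z ∈ J k, gagliardo p v z ≤ ENNReal.ofReal (Q k ^ p) := fun k =>
    exists_gagliardo_le hp0 hΛ (ha k) hv (hJI k) (hJv k) hG
  choose z' hz' hz'G using hex
  obtain ⟨z, hz, hzG, hz0⟩ : ∃ z : ℕ → ℝ, (∀ k, z k ∈ J k) ∧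
      (∀ k, gagliardo p v (z k) ≤ ENNReal.ofReal (Q k ^ p)) ∧ z 0 = z₀ := by
    refine ⟨fun k => if k = 0 then z₀ else z' k, fun k => ?_, fun k => ?_, by simp⟩
    · by_cases hk : k = 0
      · subst hk; simpa using hz₀
      · simpa [hk] using hz' k
    · by_cases hk : k = 0
      · subst hk; simpa [hQ_def, ha_def] using hz₀G
      · simpa [hk] using hz'G k
  have hβ : 0 < 1 - 2 / p := by linarith
  set r : ℝ := 2 ^ (-(1 - 2 / p)) with hr_def
  have hr0 : 0 < r := by positivity
  have hr1 : r < 1 := Real.rpow_lt_one_of_one_lt_of_neg (by norm_num) (by linarith)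
  have har : ∀ k, a k ^ (1 - 2 / p) = h ^ (1 - 2 / p) * r ^ k := fun k => by
    rw [ha_def, hr_def]
    simp only
    rw [Real.div_rpow hh.le (by positivity), Real.rpow_neg (by norm_num), inv_pow, div_eq_mul_inv,
      ← Real.rpow_natCast, ← Real.rpow_natCast, ← Real.rpow_mul (by norm_num),
      ← Real.rpow_mul (by norm_num), mul_comm (k : ℝ)]
  have hasucc : ∀ k, a (k + 1) = a k / 2 := fun k => by
    simp only [ha_def, pow_succ]; field_simp
  have hstep : ∀ k, dist (v (z k)) (v (z (k + 1))) ≤ 8 * Λ * h ^ (1 - 2 / p) * r ^ k := by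
    intro k
    have hb := norm_sub_le_of_gagliardo_le hp hv (hJI _ (hz k)) (hJI _ (hz (k + 1))) (hQ k)
      (hQ (k + 1)) (hzG k) (hzG (k + 1))
    have hak := ha k
    have hd : |z k - z (k + 1)| ≤ 2 * a k := by
      have h1 := hJx k _ (hz k)
      have h2 := hJx (k + 1) _ (hz (k + 1))
      have h3 : h / 2 ^ (k + 1) = a k / 2 := hasucc k
      have h4 : h / 2 ^ k = a k := rfl
      rw [h3] at h2
      rw [h4] at h1
      rw [abs_le] at h1 h2 ⊢
      constructor <;> linarith
    have hq1 : Q (k + 1) ≤ 2 * Q k := by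
      simp only [hQ_def, hasucc]
      rw [Real.div_rpow hak.le (by norm_num), neg_div, Real.rpow_neg (by norm_num : (0:ℝ) ≤ 2),
        div_inv_eq_mul]
      have : (2 : ℝ) ^ (1 / p) ≤ 2 := by
        calc (2 : ℝ) ^ (1 / p) ≤ 2 ^ (1 : ℝ) :=
              Real.rpow_le_rpow_of_exponent_le (by norm_num) (by linarith)
          _ = 2 := Real.rpow_one _
      have h0 : 0 ≤ Λ * a k ^ (-(1 / p)) := by positivity
      nlinarith
    have h2b : (2 * a k) ^ (1 - 1 / p) ≤ 2 * a k ^ (1 - 1 / p) := by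
      rw [Real.mul_rpow (by norm_num) hak.le]
      refine mul_le_mul_of_nonneg_right ?_ (by positivity)
      calc (2 : ℝ) ^ (1 - 1 / p) ≤ 2 ^ (1 : ℝ) :=
            Real.rpow_le_rpow_of_exponent_le (by norm_num) (by linarith)
        _ = 2 := Real.rpow_one _
    have hmul : Q k * a k ^ (1 - 1 / p) = Λ * a k ^ (1 - 2 / p) := by
      simp only [hQ_def]
      rw [mul_assoc, ← Real.rpow_add hak]
      congr 2
      ring
    rw [dist_eq_norm, mul_assoc (8 * Λ), ← har]
    calc ‖v (z k) - v (z (k + 1))‖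
        ≤ (Q k + Q (k + 1)) * |z k - z (k + 1)| ^ (1 - 1 / p) := hb
      _ ≤ (3 * Q k) * (2 * a k ^ (1 - 1 / p)) := by
          refine mul_le_mul (by linarith) ((Real.rpow_le_rpow (abs_nonneg _) hd
            (by linarith)).trans h2b) (by positivity) (by have := hQ k; positivity)
      _ = 6 * (Λ * a k ^ (1 - 2 / p)) := by rw [← hmul]; ring
      _ ≤ 8 * Λ * a k ^ (1 - 2 / p) := by
          have : 0 ≤ Λ * a k ^ (1 - 2 / p) := by positivity
          linarith
  have hlim : Tendsto (fun k => v (z k)) atTop (𝓝 (v x)) := by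
    rw [tendsto_iff_norm_sub_tendsto_zero]
    set gx := (gagliardo p v x).toReal ^ (1 / p) with hgx
    have hgx0 : 0 ≤ gx := by positivity
    have hxle : gagliardo p v x ≤ ENNReal.ofReal (gx ^ p) := by
      rw [hgx, ← Real.rpow_mul ENNReal.toReal_nonneg, one_div_mul_cancel hp0.ne', Real.rpow_one,
        ENNReal.ofReal_toReal hxG]
    have hble : ∀ k, ‖v (z k) - v x‖ ≤ Λ * h ^ (1 - 2 / p) * r ^ k +
        gx * a k ^ (1 - 1 / p) := by
      intro k
      have hak := ha k
      have hb := norm_sub_le_of_gagliardo_le hp hv (hJI _ (hz k)) hx (hQ k) hgx0 (hzG k) hxle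
      have hmul : Q k * a k ^ (1 - 1 / p) = Λ * h ^ (1 - 2 / p) * r ^ k := by
        simp only [hQ_def]
        rw [mul_assoc, ← Real.rpow_add hak, mul_assoc, ← har]
        congr 2
        ring
      rw [← hmul, ← add_mul]
      refine hb.trans (mul_le_mul_of_nonneg_left ?_ (by have := hQ k; positivity))
      exact Real.rpow_le_rpow (abs_nonneg _) (hJx k _ (hz k)) (by linarith)
    have ha0 : Tendsto a atTop (𝓝 0) := by
      have := (tendsto_pow_atTop_nhds_zero_of_lt_one (r := (1 / 2 : ℝ)) (by norm_num)
        (by norm_num)).const_mul h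
      rw [mul_zero] at this
      refine this.congr fun k => ?_
      simp [ha_def, div_eq_mul_inv]
    have h1 : Tendsto (fun k => Λ * h ^ (1 - 2 / p) * r ^ k + gx * a k ^ (1 - 1 / p)) atTop
        (𝓝 (Λ * h ^ (1 - 2 / p) * 0 + gx * 0 ^ (1 - 1 / p))) :=
      ((tendsto_pow_atTop_nhds_zero_of_lt_one hr0.le hr1).const_mul _).add
        ((ha0.rpow_const (Or.inr (by linarith))).const_mul _)
    rw [Real.zero_rpow (by linarith), mul_zero, mul_zero, add_zero] at h1
    exact squeeze_zero (fun _ => norm_nonneg _) hble h1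
  have := dist_le_of_le_geometric_of_tendsto₀ r _ hr1 hstep hlim
  rw [hz0, dist_eq_norm] at this
  refine this.trans_eq ?_
  ring

theorem norm_sub_le_of_gagliardo_ne_top {p Λ : ℝ} (hp : 2 < p) (hΛ : 0 ≤ Λ) {v : ℝ → ℂ}
    (hv : Measurable v) (hG : ∫⁻ x in Icc (-1 : ℝ) 1, gagliardo p v x ≤ ENNReal.ofReal (Λ ^ p))
    {x y : ℝ} (hx : x ∈ Icc (-1 : ℝ) 1) (hy : y ∈ Icc (-1 : ℝ) 1) (hxG : gagliardo p v x ≠ ⊤)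
    (hyG : gagliardo p v y ≠ ⊤) :
    ‖v x - v y‖ ≤ 2 * (8 / (1 - 2 ^ (-(1 - 2 / p))) * Λ) * |x - y| ^ (1 - 2 / p) := by
  wlog hxy : x < y generalizing x y
  · rcases eq_or_lt_of_le (not_lt.mp hxy) with rfl | h
    · have h2p : 2 / p < 1 := by rw [div_lt_one (by linarith)]; exact hp
      rw [sub_self, sub_self, abs_zero, Real.zero_rpow (by linarith)]
      simp
    · rw [norm_sub_rev, abs_sub_comm]
      exact this hy hx hyG hxG h
  set h := y - x with hh
  have hpos : 0 < h := sub_pos.mpr hxy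
  have habs : |x - y| = h := by rw [abs_sub_comm, abs_of_pos hpos]
  have hk : ∀ k : ℕ, h / 2 ^ k ≤ h := fun k =>
    div_le_self hpos.le (one_le_pow₀ (by norm_num))
  have hkp : ∀ k : ℕ, 0 < h / 2 ^ k := fun k => by positivity
  obtain ⟨z, hz, hzG⟩ := exists_gagliardo_le (J := Icc x y) (a := h) (by linarith) hΛ hpos hv
    (Icc_subset_Icc hx.1 hy.2) (by rw [Real.volume_Icc]) hG
  have e1 : ‖v z - v x‖ ≤ 8 / (1 - 2 ^ (-(1 - 2 / p))) * Λ * h ^ (1 - 2 / p) := by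
    refine norm_sub_le_of_chain hp hΛ hpos hv hG hx hxG (J := fun k => Icc x (x + h / 2 ^ k))
      (fun k => Icc_subset_Icc hx.1 (by linarith [hk k, hy.2])) (fun k => ?_) (fun k z hz => ?_)
      ?_ hzG
    · rw [Real.volume_Icc, add_sub_cancel_left]
    · rw [abs_le]; constructor <;> linarith [hz.1, hz.2, hkp k]
    · exact ⟨hz.1, by simpa [hh] using hz.2⟩
  have e2 : ‖v z - v y‖ ≤ 8 / (1 - 2 ^ (-(1 - 2 / p))) * Λ * h ^ (1 - 2 / p) := by
    refine norm_sub_le_of_chain hp hΛ hpos hv hG hy hyG (J := fun k => Icc (y - h / 2 ^ k) y)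
      (fun k => Icc_subset_Icc (by linarith [hk k, hx.1]) hy.2) (fun k => ?_) (fun k z hz => ?_)
      ?_ hzG
    · rw [Real.volume_Icc, sub_sub_cancel]
    · rw [abs_le]; constructor <;> linarith [hz.1, hz.2, hkp k]
    · exact ⟨by simpa [hh] using hz.1, hz.2⟩
  rw [habs]
  calc ‖v x - v y‖ ≤ ‖v z - v x‖ + ‖v z - v y‖ := by
        rw [← norm_neg (v z - v x), neg_sub]
        exact norm_sub_le_norm_sub_add_norm_sub _ _ _
    _ ≤ _ := by linarith

/-- A Hölder function on a dense subset of `[-1,1]` extends. -/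
theorem exists_holder_extension {α C : ℝ} (hα : 0 < α) {v : ℝ → ℂ} {T : Set ℝ}
    (hTI : T ⊆ Icc (-1 : ℝ) 1) (hT : Icc (-1 : ℝ) 1 ⊆ closure T)
    (hv : ∀ x ∈ T, ∀ y ∈ T, ‖v x - v y‖ ≤ C * |x - y| ^ α) :
    ∃ w : ℝ → ℂ, Continuous w ∧ (∀ x ∈ T, w x = v x) ∧
      ∀ x ∈ Icc (-1 : ℝ) 1, ∀ y ∈ Icc (-1 : ℝ) 1, ‖w x - w y‖ ≤ C * |x - y| ^ α := by
  have hlim0 : ∀ x₀ : ℝ, Tendsto (fun z : ℝ × ℝ => C * |z.1 - z.2| ^ α) (𝓝 x₀ ×ˢ 𝓝 x₀)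
      (𝓝 0) := by
    intro x₀
    rw [← nhds_prod_eq]
    have : ContinuousAt (fun z : ℝ × ℝ => C * |z.1 - z.2| ^ α) (x₀, x₀) :=
      ContinuousAt.mul continuousAt_const
        (ContinuousAt.rpow_const (by fun_prop) (Or.inr hα.le))
    have h2 := this.tendsto
    simpa [Real.zero_rpow hα.ne'] using h2
  have hex : ∀ x ∈ Icc (-1 : ℝ) 1, ∃ l, Tendsto v (𝓝[T] x) (𝓝 l) := by
    intro x hx
    have : (𝓝[T] x).NeBot := mem_closure_iff_nhdsWithin_neBot.mp (hT hx)
    rw [← cauchy_map_iff_exists_tendsto, Metric.cauchy_iff]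
    refine ⟨inferInstance, fun ε hε => ?_⟩
    have h1 := (hlim0 x).eventually (gt_mem_nhds hε)
    obtain ⟨t, ht, h1⟩ := mem_prod_same_iff.mp h1
    refine ⟨v '' (t ∩ T), image_mem_map (inter_mem (mem_nhdsWithin_of_mem_nhds ht)
      self_mem_nhdsWithin), ?_⟩
    rintro _ ⟨a, ha, rfl⟩ _ ⟨b, hb, rfl⟩
    rw [dist_eq_norm]
    exact (hv a ha.2 b hb.2).trans_lt (h1 (mk_mem_prod ha.1 hb.1))
  have hcont : ContinuousOn (extendFrom T v) (Icc (-1 : ℝ) 1) := continuousOn_extendFrom hT hex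
  have hvc : ∀ x ∈ T, Tendsto v (𝓝[T] x) (𝓝 (v x)) := by
    intro x hx
    rw [tendsto_iff_norm_sub_tendsto_zero]
    have h1 : Tendsto (fun y => C * |y - x| ^ α) (𝓝[T] x) (𝓝 0) := by
      have := (hlim0 x).comp ((tendsto_id (α := ℝ) (x := 𝓝 x)).prodMk
        (tendsto_const_nhds (x := x)))
      exact this.mono_left nhdsWithin_le_nhds
    refine squeeze_zero' (Eventually.of_forall fun _ => norm_nonneg _) ?_ h1
    filter_upwards [self_mem_nhdsWithin] with y hy using hv y hy x hx
  have heq : ∀ x ∈ T, extendFrom T v x = v x := fun x hx =>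
    extendFrom_eq (subset_closure hx) (hvc x hx)
  have hI : (-1 : ℝ) ≤ 1 := by norm_num
  have hIcc : ∀ x ∈ Icc (-1 : ℝ) 1,
      IccExtend hI (domRestrict (Icc (-1 : ℝ) 1) (extendFrom T v)) x = extendFrom T v x :=
    fun x hx => by rw [IccExtend_of_mem _ _ hx, domRestrict_apply]
  refine ⟨IccExtend hI (domRestrict (Icc (-1 : ℝ) 1) (extendFrom T v)),
    (continuousOn_iff_continuous_domRestrict.mp hcont).Icc_extend', fun x hx => ?_, ?_⟩
  · rw [hIcc x (hTI hx), heq x hx]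
  · intro x hx y hy
    rw [hIcc x hx, hIcc y hy]
    have : (𝓝[T] x).NeBot := mem_closure_iff_nhdsWithin_neBot.mp (hT hx)
    have : (𝓝[T] y).NeBot := mem_closure_iff_nhdsWithin_neBot.mp (hT hy)
    have hx' := tendsto_extendFrom (hex x hx)
    have hy' := tendsto_extendFrom (hex y hy)
    have h1 : Tendsto (fun z : ℝ × ℝ => ‖v z.1 - v z.2‖) (𝓝[T] x ×ˢ 𝓝[T] y)
        (𝓝 ‖extendFrom T v x - extendFrom T v y‖) :=
      ((hx'.comp tendsto_fst).sub (hy'.comp tendsto_snd)).norm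
    have h2 : Tendsto (fun z : ℝ × ℝ => C * |z.1 - z.2| ^ α) (𝓝[T] x ×ˢ 𝓝[T] y)
        (𝓝 (C * |x - y| ^ α)) := by
      have t1 : Tendsto (fun z : ℝ × ℝ => z.1 - z.2) (𝓝[T] x ×ˢ 𝓝[T] y) (𝓝 (x - y)) :=
        ((tendsto_id.mono_right nhdsWithin_le_nhds).comp tendsto_fst).sub
          ((tendsto_id.mono_right nhdsWithin_le_nhds).comp tendsto_snd)
      exact (t1.abs.rpow_const (Or.inr hα.le)).const_mul C
    refine le_of_tendsto_of_tendsto h1 h2 ?_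
    filter_upwards [prod_mem_prod (self_mem_nhdsWithin (s := T) (a := x))
      (self_mem_nhdsWithin (s := T) (a := y))] with z hz using hv _ hz.1 _ hz.2

/-- A set of full measure in `[-1,1]` is dense in it. -/
theorem Icc_subset_closure_of_ae {T : Set ℝ}
    (hT : ∀ᵐ x ∂(volume.restrict (Icc (-1 : ℝ) 1)), x ∈ T) : Icc (-1 : ℝ) 1 ⊆ closure T := by
  have h1 : Ioo (-1 : ℝ) 1 ⊆ closure T := by
    intro x hx
    by_contra hc
    have ho : IsOpen (Ioo (-1 : ℝ) 1 ∩ (closure T)ᶜ) :=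
      isOpen_Ioo.inter isClosed_closure.isOpen_compl
    have hpos := ho.measure_pos volume ⟨x, hx, hc⟩
    rw [ae_restrict_iff' measurableSet_Icc] at hT
    have h0 : volume (Ioo (-1 : ℝ) 1 ∩ (closure T)ᶜ) = 0 := by
      refine measure_mono_null ?_ hT
      intro y hy hy'
      exact hy.2 (subset_closure (hy' (Ioo_subset_Icc_self hy.1)))
    exact hpos.ne' h0
  rw [← closure_Ioo (by norm_num : (-1 : ℝ) ≠ 1)]
  exact closure_minimal h1 isClosed_closure

/-- Functions with finite Gagliardo seminorm have a Hölder continuous representative. -/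
theorem exists_holder_representative {p : ℝ} (hp : 2 < p) {u : ℝ → ℂ}
    (hu : AEStronglyMeasurable u (volume.restrict (Icc (-1 : ℝ) 1)))
    (hG : ∫⁻ x in Icc (-1 : ℝ) 1, gagliardo p u x ≠ ⊤) :
    ∃ (w : ℝ → ℂ) (C : ℝ), Continuous w ∧ (∀ᵐ x ∂(volume.restrict (Icc (-1 : ℝ) 1)), u x = w x) ∧
      (∀ x ∈ Icc (-1 : ℝ) 1, ∀ y ∈ Icc (-1 : ℝ) 1, ‖w x - w y‖ ≤ C * |x - y| ^ (1 - 2 / p)) ∧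
      ∫⁻ x in Icc (-1 : ℝ) 1, gagliardo p w x ≠ ⊤ := by
  have hcongr : ∀ {f g : ℝ → ℂ}, f =ᵐ[volume.restrict (Icc (-1 : ℝ) 1)] g →
      ∫⁻ x in Icc (-1 : ℝ) 1, gagliardo p f x = ∫⁻ x in Icc (-1 : ℝ) 1, gagliardo p g x := by
    intro f g hfg
    refine lintegral_congr_ae ?_
    filter_upwards [hfg] with x hx
    refine lintegral_congr_ae ?_
    filter_upwards [hfg] with s hs
    rw [hs, hx]
  obtain ⟨v, hvm, hv⟩ := hu
  have hvG : ∫⁻ x in Icc (-1 : ℝ) 1, gagliardo p v x ≠ ⊤ := by rwa [← hcongr hv]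
  have hvm' := hvm.measurable
  set T := {x ∈ Icc (-1 : ℝ) 1 | gagliardo p v x ≠ ⊤} with hT
  have hTae : ∀ᵐ x ∂(volume.restrict (Icc (-1 : ℝ) 1)), x ∈ T := by
    filter_upwards [ae_lt_top (measurable_gagliardo p hvm') hvG,
      ae_restrict_mem measurableSet_Icc] with x hx hxI using ⟨hxI, hx.ne⟩
  set Λ := (∫⁻ x in Icc (-1 : ℝ) 1, gagliardo p v x).toReal ^ (1 / p) with hΛ
  have hΛG : ∫⁻ x in Icc (-1 : ℝ) 1, gagliardo p v x ≤ ENNReal.ofReal (Λ ^ p) := by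
    rw [hΛ, ← Real.rpow_mul ENNReal.toReal_nonneg, one_div_mul_cancel (by linarith),
      Real.rpow_one, ENNReal.ofReal_toReal hvG]
  have h2p : 2 / p < 1 := by rw [div_lt_one (by linarith)]; exact hp
  obtain ⟨w, hwc, hwT, hwH⟩ := exists_holder_extension (α := 1 - 2 / p) (by linarith)
    (T := T) (fun x hx => hx.1) (Icc_subset_closure_of_ae hTae) fun x hx y hy =>
      norm_sub_le_of_gagliardo_ne_top hp (by positivity) hvm' hΛG hx.1 hy.1 hx.2 hy.2
  have hvw : v =ᵐ[volume.restrict (Icc (-1 : ℝ) 1)] w := by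
    filter_upwards [hTae] with x hx using (hwT x hx).symm
  exact ⟨w, _, hwc, hv.trans hvw, hwH, by rwa [← hcongr hvw]⟩

theorem lintegral_comp_abs_sub_le {F : ℝ → ℝ≥0∞} (hF : Measurable F) (σ : ℝ) :
    ∫⁻ s, F |s - σ| ≤ 2 * ∫⁻ t in Ioi (0 : ℝ), F t := by
  set f := (Ioi (0 : ℝ)).indicator F with hf
  have hfm : Measurable f := hF.indicator measurableSet_Ioi
  have hfs : Measurable fun s => f (s - σ) := hfm.comp (by fun_prop)
  have h0 : ∀ᵐ s : ℝ, s ≠ σ := by simp [ae_iff]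
  calc ∫⁻ s, F |s - σ| ≤ ∫⁻ s, (f (s - σ) + f (σ - s)) := by
        refine lintegral_mono_ae (h0.mono fun s hs => ?_)
        rcases lt_or_gt_of_ne hs with h | h
        · rw [abs_of_neg (by linarith), neg_sub]
          have : f (σ - s) = F (σ - s) := indicator_of_mem (mem_Ioi.mpr (by linarith)) _
          rw [this]; exact le_add_self
        · rw [abs_of_pos (by linarith)]
          have : f (s - σ) = F (s - σ) := indicator_of_mem (mem_Ioi.mpr (by linarith)) _
          rw [this]; exact le_self_add
    _ = (∫⁻ s, f s) + ∫⁻ s, f s := by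
        rw [lintegral_add_left hfs,
          lintegral_sub_right_eq_self, lintegral_sub_left_eq_self]
    _ = 2 * ∫⁻ t in Ioi (0 : ℝ), F t := by
        rw [← two_mul, hf, lintegral_indicator measurableSet_Ioi]

theorem setLIntegral_abs_sub_rpow_near_le {β R : ℝ} (hβ : -1 < β) (hR : 0 ≤ R) (σ : ℝ) :
    ∫⁻ s in {s | |s - σ| < R}, ENNReal.ofReal (|s - σ| ^ β) ≤
      ENNReal.ofReal (2 / (β + 1) * R ^ (β + 1)) := by
  have hm : MeasurableSet {s : ℝ | |s - σ| < R} := measurableSet_lt (by fun_prop) measurable_const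
  set F : ℝ → ℝ≥0∞ := (Iio R).indicator fun t => ENNReal.ofReal (t ^ β) with hF
  have hFm : Measurable F := (measurable_id.pow_const β).ennreal_ofReal.indicator measurableSet_Iio
  calc ∫⁻ s in {s | |s - σ| < R}, ENNReal.ofReal (|s - σ| ^ β) = ∫⁻ s, F |s - σ| := by
        rw [← lintegral_indicator hm]
        rfl
    _ ≤ 2 * ∫⁻ t in Ioi (0 : ℝ), F t := lintegral_comp_abs_sub_le hFm σ
    _ = 2 * ∫⁻ t in Ioc 0 R, ENNReal.ofReal (t ^ β) := by
        rw [hF, lintegral_indicator measurableSet_Iio, Measure.restrict_restrict measurableSet_Iio,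
          inter_comm, Ioi_inter_Iio, restrict_Ioo_eq_restrict_Ioc]
    _ = ENNReal.ofReal (2 / (β + 1) * R ^ (β + 1)) := by
        have hi := intervalIntegral.intervalIntegrable_rpow' (a := 0) (b := R) hβ
        have hI : IntegrableOn (fun t : ℝ => t ^ β) (Ioc 0 R) :=
          (intervalIntegrable_iff_integrableOn_Ioc_of_le hR).mp hi
        rw [← ofReal_integral_eq_lintegral_ofReal hI, ← intervalIntegral.integral_of_le hR,
          integral_rpow (Or.inl hβ), Real.zero_rpow (by linarith)]
        · rw [← ENNReal.ofReal_ofNat, ← ENNReal.ofReal_mul (by norm_num)]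
          congr 1
          ring
        · filter_upwards [ae_restrict_mem measurableSet_Ioc] with t ht
          exact Real.rpow_nonneg ht.1.le _

theorem setLIntegral_abs_sub_rpow_far_le {β R : ℝ} (hβ : β < -1) (hR : 0 < R) (σ : ℝ) :
    ∫⁻ s in {s | R ≤ |s - σ|}, ENNReal.ofReal (|s - σ| ^ β) ≤
      ENNReal.ofReal (2 / (-(β + 1)) * R ^ (β + 1)) := by
  have hm : MeasurableSet {s : ℝ | R ≤ |s - σ|} := measurableSet_le measurable_const (by fun_prop)
  set F : ℝ → ℝ≥0∞ := (Ici R).indicator fun t => ENNReal.ofReal (t ^ β) with hF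
  have hFm : Measurable F := (measurable_id.pow_const β).ennreal_ofReal.indicator measurableSet_Ici
  calc ∫⁻ s in {s | R ≤ |s - σ|}, ENNReal.ofReal (|s - σ| ^ β) = ∫⁻ s, F |s - σ| := by
        rw [← lintegral_indicator hm]
        rfl
    _ ≤ 2 * ∫⁻ t in Ioi (0 : ℝ), F t := lintegral_comp_abs_sub_le hFm σ
    _ = 2 * ∫⁻ t in Ioi R, ENNReal.ofReal (t ^ β) := by
        rw [hF, lintegral_indicator measurableSet_Ici, Measure.restrict_restrict measurableSet_Ici,
          inter_eq_left.mpr (Ici_subset_Ioi.mpr hR), restrict_Ioi_eq_restrict_Ici]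
    _ = ENNReal.ofReal (2 / (-(β + 1)) * R ^ (β + 1)) := by
        rw [← ofReal_integral_eq_lintegral_ofReal (integrableOn_Ioi_rpow_of_lt hβ hR),
          integral_Ioi_rpow_of_lt hβ hR]
        · rw [← ENNReal.ofReal_ofNat, ← ENNReal.ofReal_mul (by norm_num)]
          congr 1
          have : β + 1 ≠ 0 := by linarith
          field_simp
        · filter_upwards [ae_restrict_mem measurableSet_Ioi] with t ht
          exact Real.rpow_nonneg (hR.trans ht).le _

/-- Passing from a bound on the lower integral to integrability and a bound on the integral. -/
theorem integrable_and_integral_le {X : Type*} [MeasurableSpace X] {μ : Measure X} {f : X → ℝ}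
    (hf : AEStronglyMeasurable f μ) (h0 : ∀ x, 0 ≤ f x) {B : ℝ} (hB : 0 ≤ B)
    (h : ∫⁻ x, ENNReal.ofReal (f x) ∂μ ≤ ENNReal.ofReal B) :
    Integrable f μ ∧ ∫ x, f x ∂μ ≤ B := by
  refine ⟨⟨hf, ?_⟩, ?_⟩
  · rw [hasFiniteIntegral_iff_ofReal (Eventually.of_forall h0)]
    exact h.trans_lt ENNReal.ofReal_lt_top
  · rw [integral_eq_lintegral_of_nonneg_ae (Eventually.of_forall h0) hf]
    exact ENNReal.toReal_le_of_le_ofReal hB h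

theorem measurable_abs_sub_rpow (σ β : ℝ) : Measurable fun s : ℝ => |s - σ| ^ β :=
  Measurable.pow_const (by fun_prop) _

theorem measurable_endpoint_weight (e : ℝ) : Measurable fun s : ℝ => (1 - |s|) ^ e :=
  Measurable.pow_const (by fun_prop) _

theorem integrableOn_abs_sub_rpow_near {β R : ℝ} (hβ : -1 < β) (hR : 0 ≤ R) (σ : ℝ) :
    IntegrableOn (fun s => |s - σ| ^ β) {s | |s - σ| < R} ∧
      ∫ s in {s | |s - σ| < R}, |s - σ| ^ β ≤ 2 / (β + 1) * R ^ (β + 1) := by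
  have : 0 < β + 1 := by linarith
  exact integrable_and_integral_le (measurable_abs_sub_rpow σ β).aestronglyMeasurable
    (fun s => by positivity) (by positivity)
    (setLIntegral_abs_sub_rpow_near_le hβ hR σ)

theorem abs_sub_mem_endpoints (s : ℝ) (hs : s ∈ Icc (-1 : ℝ) 1) :
    1 - |s| = |s - 1| ∨ 1 - |s| = |s - (-1)| := by
  rcases le_or_gt 0 s with h | h
  · left; rw [abs_of_nonneg h, abs_of_nonpos (by linarith [hs.2])]; ring
  · right; rw [abs_of_neg h, abs_of_nonneg (by linarith [hs.1])]; ring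

/-- The weight `(1-|s|)^(-e)` is integrable. -/
theorem integrableOn_endpoint_weight {e : ℝ} (he : e < 1) :
    IntegrableOn (fun s : ℝ => (1 - |s|) ^ (-e)) (Icc (-1 : ℝ) 1) := by
  have h : ∀ a ∈ ({1, -1} : Set ℝ), IntegrableOn (fun s => |s - a| ^ (-e)) (Icc (-1 : ℝ) 1) := by
    intro a ha
    refine (integrableOn_abs_sub_rpow_near (β := -e) (R := 3) (by linarith) (by norm_num)
      a).1.mono_set fun s hs => ?_
    rcases ha with rfl | rfl <;> rw [mem_ofPred_eq, abs_lt] <;> constructor <;>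
      linarith [hs.1, hs.2]
  refine Integrable.mono' ((h 1 (by simp)).add (h (-1) (by simp)))
    (measurable_endpoint_weight _).aestronglyMeasurable ?_
  filter_upwards [ae_restrict_mem measurableSet_Icc] with s hs
  have h1 : 0 ≤ |s - 1| ^ (-e) := by positivity
  have h2 : 0 ≤ |s - (-1)| ^ (-e) := by positivity
  simp only [Pi.add_apply]
  rcases abs_sub_mem_endpoints s hs with h | h <;> rw [h, Real.norm_of_nonneg (by positivity)] <;>
    linarith

/-- Integral of the endpoint weight against a truncated Cauchy kernel. -/
theorem setIntegral_endpoint_weight_div_le {e X : ℝ} (he0 : 0 < e) (he1 : e < 1) (hX : 0 < X) :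
    IntegrableOn (fun s : ℝ => (1 - |s|) ^ (-e) / (X + (1 - |s|))) (Icc (-1 : ℝ) 1) ∧
    ∫ s in Icc (-1 : ℝ) 1, (1 - |s|) ^ (-e) / (X + (1 - |s|)) ≤
      (4 / (1 - e) + 4 / e) * X ^ (-e) := by
  set H : ℝ → ℝ := fun t => (Iio X).indicator (fun t => X⁻¹ * t ^ (-e)) t +
    (Ici X).indicator (fun t => t ^ (-e - 1)) t with hH
  have hHm : Measurable H :=
    (((measurable_id.pow_const (-e)).const_mul _).indicator measurableSet_Iio).add
      ((measurable_id.pow_const (-e - 1)).indicator measurableSet_Ici)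
  have he1' : 0 < 1 - e := by linarith
  have hle : ∀ t : ℝ, 0 ≤ t → t ^ (-e) / (X + t) ≤ H t := by
    intro t ht
    simp only [hH]
    rcases lt_or_ge t X with h | h
    · rw [indicator_of_mem (mem_Iio.mpr h), indicator_of_notMem (by simpa using h), add_zero,
        div_eq_inv_mul]
      exact mul_le_mul_of_nonneg_right (inv_anti₀ hX (by linarith)) (by positivity)
    · have htp : 0 < t := hX.trans_le h
      rw [indicator_of_mem (mem_Ici.mpr h), indicator_of_notMem (by simpa using h), zero_add,
        Real.rpow_sub_one htp.ne']
      exact div_le_div_of_nonneg_left (by positivity) htp (by linarith)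
  have hH0 : ∀ t : ℝ, 0 ≤ t → 0 ≤ H t := fun t ht => le_trans (by positivity) (hle t ht)
  have hHint : ∀ a : ℝ, Integrable (fun s => H |s - a|) ∧
      ∫ s, H |s - a| ≤ (2 / (1 - e) + 2 / e) * X ^ (-e) := by
    intro a
    obtain ⟨i1, b1⟩ := integrableOn_abs_sub_rpow_near (β := -e) (R := X) (by linarith) hX.le a
    obtain ⟨i2, b2⟩ := integrable_and_integral_le
      (measurable_abs_sub_rpow a (-e - 1)).aestronglyMeasurable (fun s => by positivity)
      (by rw [show -(-e - 1 + 1) = e by ring]; positivity)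
      (setLIntegral_abs_sub_rpow_far_le (β := -e - 1) (by linarith) hX a)
    have m1 : MeasurableSet {s : ℝ | |s - a| < X} := measurableSet_lt (by fun_prop) measurable_const
    have m2 : MeasurableSet {s : ℝ | X ≤ |s - a|} := measurableSet_le measurable_const (by fun_prop)
    have e1 : (fun s => H |s - a|) = fun s =>
        {s | |s - a| < X}.indicator (fun s => X⁻¹ * |s - a| ^ (-e)) s +
        {s | X ≤ |s - a|}.indicator (fun s => |s - a| ^ (-e - 1)) s := by
      funext s
      simp only [hH, indicator, mem_Iio, mem_Ici, mem_ofPred_eq]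
    rw [e1]
    have j1 := (integrable_indicator_iff m1).mpr (i1.const_mul X⁻¹)
    have j2 := (integrable_indicator_iff m2).mpr i2
    refine ⟨j1.add j2, ?_⟩
    rw [integral_add j1 j2, integral_indicator m1, integral_indicator m2, integral_const_mul]
    have h1 : X⁻¹ * (2 / (-e + 1) * X ^ (-e + 1)) = 2 / (1 - e) * X ^ (-e) := by
      rw [Real.rpow_add_one hX.ne', neg_add_eq_sub]
      field_simp
    have h2 : 2 / (-(-e - 1 + 1)) * X ^ (-e - 1 + 1) = 2 / e * X ^ (-e) := by
      rw [show -e - 1 + 1 = -e by ring, neg_neg]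
    rw [h2] at b2
    rw [add_mul, ← h1]
    exact add_le_add (mul_le_mul_of_nonneg_left b1 (by positivity)) b2
  have hpt : ∀ s ∈ Icc (-1 : ℝ) 1, (1 - |s|) ^ (-e) / (X + (1 - |s|)) ≤
      H |s - 1| + H |s - (-1)| := by
    intro s hs
    have h1 := hH0 |s - 1| (abs_nonneg _)
    have h2 := hH0 |s - (-1)| (abs_nonneg _)
    rcases abs_sub_mem_endpoints s hs with h | h
    · rw [h]; linarith [hle |s - 1| (abs_nonneg _)]
    · rw [h]; linarith [hle |s - (-1)| (abs_nonneg _)]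
  have hnn : ∀ s ∈ Icc (-1 : ℝ) 1, 0 ≤ (1 - |s|) ^ (-e) / (X + (1 - |s|)) := by
    intro s hs
    have : 0 ≤ 1 - |s| := by linarith [abs_le.mpr hs]
    positivity
  have hsum : Integrable (fun s => H |s - 1| + H |s - (-1)|) := (hHint 1).1.add (hHint (-1)).1
  have hInt : IntegrableOn (fun s : ℝ => (1 - |s|) ^ (-e) / (X + (1 - |s|))) (Icc (-1 : ℝ) 1) := by
    refine Integrable.mono' hsum.integrableOn
      ((measurable_endpoint_weight _).div (by fun_prop)).aestronglyMeasurable ?_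
    filter_upwards [ae_restrict_mem measurableSet_Icc] with s hs
    rw [Real.norm_of_nonneg (hnn s hs)]
    exact hpt s hs
  refine ⟨hInt, ?_⟩
  calc ∫ s in Icc (-1 : ℝ) 1, (1 - |s|) ^ (-e) / (X + (1 - |s|))
      ≤ ∫ s in Icc (-1 : ℝ) 1, (H |s - 1| + H |s - (-1)|) :=
        setIntegral_mono_on hInt hsum.integrableOn measurableSet_Icc hpt
    _ ≤ ∫ s, (H |s - 1| + H |s - (-1)|) :=
        setIntegral_le_integral hsum (Eventually.of_forall fun s =>
          add_nonneg (hH0 _ (abs_nonneg _)) (hH0 _ (abs_nonneg _)))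
    _ ≤ _ := by
        rw [integral_add (hHint 1).1 (hHint (-1)).1]
        have := (hHint 1).2
        have := (hHint (-1)).2
        have e4 : (4 / (1 - e) + 4 / e) * X ^ (-e) = (2 / (1 - e) + 2 / e) * X ^ (-e) +
          (2 / (1 - e) + 2 / e) * X ^ (-e) := by ring
        linarith

/-- The finite Hilbert transform on `[-1,1]`, written without principal values. -/
def finHilbert (ψ : ℝ → ℂ) (σ : ℝ) : ℂ :=
  (∫ s in Icc (-1 : ℝ) 1, (ψ s - ψ σ) / ((s : ℂ) - σ)) + ψ σ * Real.log ((1 - σ) / (1 + σ))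

theorem norm_ofReal_sub_ofReal (s σ : ℝ) : ‖(s : ℂ) - σ‖ = |s - σ| := by
  rw [← ofReal_sub, norm_real, Real.norm_eq_abs]

theorem ofReal_sub_ne_zero {s σ : ℝ} (h : s ≠ σ) : (s : ℂ) - σ ≠ 0 :=
  sub_ne_zero.mpr fun e => h (ofReal_injective e)

theorem integrableOn_inv_sub {σ δ : ℝ} (hδ : 0 < δ) {E : Set ℝ} (hE : MeasurableSet E)
    (hEI : E ⊆ Icc (-1 : ℝ) 1) (h : ∀ s ∈ E, δ ≤ |s - σ|) :
    IntegrableOn (fun s : ℝ => (s - σ)⁻¹) E := by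
  have hfin : volume E ≠ ⊤ := (measure_mono hEI).trans_lt (by simp) |>.ne
  refine Measure.integrableOn_of_bounded hfin (by fun_prop) (M := δ⁻¹) ?_
  filter_upwards [ae_restrict_mem hE] with s hs
  rw [norm_inv, Real.norm_eq_abs]
  exact inv_anti₀ hδ (h s hs)

theorem integral_inv_sub {a b σ : ℝ} (hab : a ≤ b) (h : σ < a ∨ b < σ) :
    ∫ s in Icc a b, (s - σ)⁻¹ = Real.log ((b - σ) / (a - σ)) := by
  rw [integral_Icc_eq_integral_Ioc, ← intervalIntegral.integral_of_le hab,
    intervalIntegral.integral_comp_sub_right (fun x => x⁻¹), integral_inv]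
  rw [uIcc_of_le (by linarith)]
  intro h0
  rcases h with h | h <;> linarith [h0.1, h0.2]

theorem integral_inv_sub_diff {a b σ : ℝ} (ha : -1 ≤ a) (haσ : a < σ) (hσb : σ < b) (hb : b ≤ 1) :
    IntegrableOn (fun s : ℝ => (s - σ)⁻¹) (Icc (-1 : ℝ) 1 \ Ioo a b) ∧
    ∫ s in Icc (-1 : ℝ) 1 \ Ioo a b, (s - σ)⁻¹ =
      Real.log ((1 - σ) / (1 + σ)) - Real.log ((b - σ) / (σ - a)) := by
  have hset : Icc (-1 : ℝ) 1 \ Ioo a b = Icc (-1) a ∪ Icc b 1 := by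
    ext s
    simp only [Set.mem_sdiff, mem_Icc, mem_Ioo, not_and, not_lt, mem_union]
    constructor
    · rintro ⟨⟨h1, h2⟩, h3⟩
      rcases le_or_gt s a with h | h
      · exact Or.inl ⟨h1, h⟩
      · exact Or.inr ⟨h3 h, h2⟩
    · rintro (⟨h1, h2⟩ | ⟨h1, h2⟩)
      · exact ⟨⟨h1, by linarith⟩, fun h => by linarith⟩
      · exact ⟨⟨by linarith, h2⟩, fun h => h1⟩
  have hdis : Disjoint (Icc (-1) a) (Icc b 1) := by
    rw [Set.disjoint_left]
    intro s h1 h2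
    linarith [h1.2, h2.1]
  have i1 : IntegrableOn (fun s : ℝ => (s - σ)⁻¹) (Icc (-1) a) :=
    integrableOn_inv_sub (sub_pos.mpr haσ) measurableSet_Icc (Icc_subset_Icc_right (by linarith))
      fun s hs => by
        rw [abs_sub_comm]
        exact (by linarith [hs.2] : σ - a ≤ σ - s).trans (le_abs_self _)
  have i2 : IntegrableOn (fun s : ℝ => (s - σ)⁻¹) (Icc b 1) :=
    integrableOn_inv_sub (sub_pos.mpr hσb) measurableSet_Icc (Icc_subset_Icc_left (by linarith))
      fun s hs => (by linarith [hs.1] : b - σ ≤ s - σ).trans (le_abs_self _)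
  rw [hset]
  refine ⟨i1.union i2, ?_⟩
  rw [setIntegral_union hdis measurableSet_Icc i1 i2, integral_inv_sub ha (Or.inr haσ),
    integral_inv_sub hb (Or.inl hσb)]
  have e1 : (a - σ) / (-1 - σ) = (σ - a) / (1 + σ) := by
    rw [← neg_sub σ a, ← neg_add', neg_div_neg_eq]
  rw [e1, Real.log_div, Real.log_div, Real.log_div, Real.log_div] <;> linarith

theorem ofReal_inv_sub (s σ : ℝ) : (((s - σ)⁻¹ : ℝ) : ℂ) = 1 / ((s : ℂ) - σ) := by
  push_cast; rw [one_div]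

/-- The finite Hilbert transform computed with a window around the singularity. -/
theorem finHilbert_eq_window {ψ : ℝ → ℂ} {σ a b : ℝ}
    (hd : IntegrableOn (fun s => (ψ s - ψ σ) / ((s : ℂ) - σ)) (Icc (-1 : ℝ) 1))
    (ha : -1 ≤ a) (haσ : a < σ) (hσb : σ < b) (hb : b ≤ 1) :
    finHilbert ψ σ = (∫ s in Ioo a b, (ψ s - ψ σ) / ((s : ℂ) - σ)) +
      ψ σ * Real.log ((b - σ) / (σ - a)) +
      ∫ s in Icc (-1 : ℝ) 1 \ Ioo a b, ψ s / ((s : ℂ) - σ) := by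
  have hsub : Ioo a b ⊆ Icc (-1 : ℝ) 1 := fun s hs => ⟨by linarith [hs.1], by linarith [hs.2]⟩
  have h1 : ∫ s in Icc (-1 : ℝ) 1, (ψ s - ψ σ) / ((s : ℂ) - σ) =
      (∫ s in Icc (-1 : ℝ) 1 \ Ioo a b, (ψ s - ψ σ) / ((s : ℂ) - σ)) +
      ∫ s in Ioo a b, (ψ s - ψ σ) / ((s : ℂ) - σ) := by
    conv_lhs => rw [← sdiff_union_of_subset hsub]
    exact setIntegral_union disjoint_sdiff_left measurableSet_Ioo (hd.mono_set sdiff_subset)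
      (hd.mono_set hsub)
  obtain ⟨i1, e1⟩ := integral_inv_sub_diff ha haσ hσb hb
  have i2 : IntegrableOn (fun s : ℝ => ψ σ * (((s - σ)⁻¹ : ℝ) : ℂ)) (Icc (-1 : ℝ) 1 \ Ioo a b) :=
    (i1.ofReal).const_mul _
  have h2 : ∫ s in Icc (-1 : ℝ) 1 \ Ioo a b, ψ s / ((s : ℂ) - σ) =
      (∫ s in Icc (-1 : ℝ) 1 \ Ioo a b, (ψ s - ψ σ) / ((s : ℂ) - σ)) +
      ψ σ * (Real.log ((1 - σ) / (1 + σ)) - Real.log ((b - σ) / (σ - a)) : ℝ) := by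
    rw [← e1, ← integral_complex_ofReal, ← integral_const_mul,
      ← integral_add (hd.mono_set sdiff_subset) i2]
    refine integral_congr_ae (Eventually.of_forall fun s => ?_)
    simp only [ofReal_inv_sub]
    ring
  rw [finHilbert, h1, h2]
  push_cast
  ring

theorem finHilbert_add {ψ₁ ψ₂ : ℝ → ℂ} {σ : ℝ}
    (h₁ : IntegrableOn (fun s => (ψ₁ s - ψ₁ σ) / ((s : ℂ) - σ)) (Icc (-1 : ℝ) 1))
    (h₂ : IntegrableOn (fun s => (ψ₂ s - ψ₂ σ) / ((s : ℂ) - σ)) (Icc (-1 : ℝ) 1)) :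
    finHilbert (fun s => ψ₁ s + ψ₂ s) σ = finHilbert ψ₁ σ + finHilbert ψ₂ σ := by
  simp only [finHilbert]
  have : ∫ s in Icc (-1 : ℝ) 1, (ψ₁ s + ψ₂ s - (ψ₁ σ + ψ₂ σ)) / ((s : ℂ) - σ) =
      (∫ s in Icc (-1 : ℝ) 1, (ψ₁ s - ψ₁ σ) / ((s : ℂ) - σ)) +
      ∫ s in Icc (-1 : ℝ) 1, (ψ₂ s - ψ₂ σ) / ((s : ℂ) - σ) := by
    rw [← integral_add h₁ h₂]
    refine integral_congr_ae (Eventually.of_forall fun s => ?_)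
    simp only
    ring
  rw [this]
  ring

/-- Multiplication by a function `φ` whose difference quotient at `σ` is `κ`. -/
theorem finHilbert_mul {ψ φ κ : ℝ → ℂ} {σ : ℝ}
    (h : IntegrableOn (fun s => (ψ s - ψ σ) / ((s : ℂ) - σ)) (Icc (-1 : ℝ) 1))
    (hκ : IntegrableOn (fun s => ψ s * κ s) (Icc (-1 : ℝ) 1))
    (hφ : ∀ s, φ s - φ σ = κ s * ((s : ℂ) - σ)) :
    IntegrableOn (fun s => (φ s * ψ s - φ σ * ψ σ) / ((s : ℂ) - σ)) (Icc (-1 : ℝ) 1) ∧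
    finHilbert (fun s => φ s * ψ s) σ = φ σ * finHilbert ψ σ +
      ∫ s in Icc (-1 : ℝ) 1, ψ s * κ s := by
  have h0 : ∀ᵐ s : ℝ ∂(volume.restrict (Icc (-1 : ℝ) 1)), s ≠ σ :=
    ae_restrict_of_ae (by simp [ae_iff])
  have hae : (fun s => φ σ * ((ψ s - ψ σ) / ((s : ℂ) - σ)) + ψ s * κ s)
      =ᵐ[volume.restrict (Icc (-1 : ℝ) 1)]
      fun s => (φ s * ψ s - φ σ * ψ σ) / ((s : ℂ) - σ) := by
    refine h0.mono fun s hs => ?_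
    have h1 := ofReal_sub_ne_zero hs
    have h2 : φ s = φ σ + κ s * ((s : ℂ) - σ) := by rw [← hφ]; ring
    simp only
    rw [h2]
    field_simp
    ring
  refine ⟨((h.const_mul (φ σ)).add hκ).congr hae, ?_⟩
  simp only [finHilbert]
  rw [← integral_congr_ae hae, integral_add (h.const_mul _) hκ, integral_const_mul]
  ring

theorem aestronglyMeasurable_sub_div {ψ : ℝ → ℂ} {μ : Measure ℝ} (hψ : AEStronglyMeasurable ψ μ)
    (c : ℂ) (σ : ℝ) : AEStronglyMeasurable (fun s : ℝ => (ψ s - c) / ((s : ℂ) - σ)) μ := by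
  have h : Measurable fun s : ℝ => (s : ℂ) - σ := by fun_prop
  exact ((hψ.aemeasurable.sub_const c).div h.aemeasurable).aestronglyMeasurable

/-- Local Hölder continuity makes the difference quotient integrable. -/
theorem integrableOn_sub_div {ψ : ℝ → ℂ} {σ C r α : ℝ}
    (hψ : IntegrableOn ψ (Icc (-1 : ℝ) 1)) (hr : 0 < r) (hα : 0 < α)
    (h : ∀ s ∈ Icc (-1 : ℝ) 1, |s - σ| < r → ‖ψ s - ψ σ‖ ≤ C * |s - σ| ^ α) :
    IntegrableOn (fun s => (ψ s - ψ σ) / ((s : ℂ) - σ)) (Icc (-1 : ℝ) 1) := by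
  have m1 : MeasurableSet {s : ℝ | |s - σ| < r} := measurableSet_lt (by fun_prop) measurable_const
  have i1 : IntegrableOn ({s : ℝ | |s - σ| < r}.indicator fun s => |C| * |s - σ| ^ (α - 1))
      (Icc (-1 : ℝ) 1) :=
    ((integrable_indicator_iff m1).mpr ((integrableOn_abs_sub_rpow_near (β := α - 1)
      (by linarith) hr.le σ).1.const_mul _)).integrableOn
  have i2 : IntegrableOn (fun s => (‖ψ s‖ + ‖ψ σ‖) / r) (Icc (-1 : ℝ) 1) :=
    (hψ.norm.add (integrable_const _)).div_const r
  refine Integrable.mono' (i1.add i2) (aestronglyMeasurable_sub_div hψ.1 _ _) ?_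
  filter_upwards [ae_restrict_mem measurableSet_Icc] with s hs
  rw [norm_div, norm_ofReal_sub_ofReal, Pi.add_apply]
  have n2 : 0 ≤ (‖ψ s‖ + ‖ψ σ‖) / r := by positivity
  rcases lt_or_ge |s - σ| r with hsr | hsr
  · have e1 : {s : ℝ | |s - σ| < r}.indicator (fun s => |C| * |s - σ| ^ (α - 1)) s =
        |C| * |s - σ| ^ (α - 1) := indicator_of_mem (by simpa using hsr) _
    rw [e1]
    rcases eq_or_ne s σ with rfl | hne
    · simp only [sub_self, norm_zero, zero_div]; positivity
    · have hp : 0 < |s - σ| := abs_pos.mpr (sub_ne_zero.mpr hne)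
      have : ‖ψ s - ψ σ‖ / |s - σ| ≤ |C| * |s - σ| ^ (α - 1) := by
        rw [Real.rpow_sub_one hp.ne', ← mul_div_assoc]
        gcongr
        exact (h s hs hsr).trans (by gcongr; exact le_abs_self C)
      linarith
  · have n1 : 0 ≤ {s : ℝ | |s - σ| < r}.indicator (fun s => |C| * |s - σ| ^ (α - 1)) s :=
      indicator_nonneg (fun s _ => by positivity) s
    have : ‖ψ s - ψ σ‖ / |s - σ| ≤ (‖ψ s‖ + ‖ψ σ‖) / r := by
      gcongr
      exact norm_sub_le _ _
    linarith

/-- Removing the sets `{N < ε}` does not change the integral in the limit. -/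
theorem tendsto_setIntegral_truncated {f : ℝ → ℂ} {N : ℝ → ℝ} {σ : ℝ}
    (hf : IntegrableOn f (Icc (-1 : ℝ) 1))
    (hN : ∀ ε, MeasurableSet {s ∈ Icc (-1 : ℝ) 1 | ε ≤ N s})
    (hpos : ∀ s ∈ Icc (-1 : ℝ) 1, s ≠ σ → 0 < N s) :
    Tendsto (fun ε : ℝ => ∫ s in {s ∈ Icc (-1 : ℝ) 1 | ε ≤ N s}, f s) (𝓝[>] 0)
      (𝓝 (∫ s in Icc (-1 : ℝ) 1, f s)) := by
  have hsub : ∀ ε : ℝ, {s ∈ Icc (-1 : ℝ) 1 | ε ≤ N s} ⊆ Icc (-1 : ℝ) 1 := fun ε s hs => hs.1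
  have h0 : ∀ᵐ s : ℝ ∂(volume.restrict (Icc (-1 : ℝ) 1)), s ≠ σ :=
    ae_restrict_of_ae (by simp [ae_iff])
  have e : ∀ ε : ℝ, ∫ s in {s ∈ Icc (-1 : ℝ) 1 | ε ≤ N s}, f s =
      ∫ s in Icc (-1 : ℝ) 1, {s ∈ Icc (-1 : ℝ) 1 | ε ≤ N s}.indicator f s := fun ε => by
    rw [setIntegral_indicator (hN ε), inter_eq_right.mpr (hsub ε)]
  simp only [e]
  refine tendsto_integral_filter_of_dominated_convergence (fun s => ‖f s‖)
    (Eventually.of_forall fun ε => hf.1.indicator (hN ε))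
    (Eventually.of_forall fun ε => Eventually.of_forall fun s => norm_indicator_le_norm_self _ _)
    hf.norm ?_
  filter_upwards [h0, ae_restrict_mem measurableSet_Icc] with s hs hsI
  refine tendsto_const_nhds.congr' ?_
  have : ∀ᶠ ε : ℝ in 𝓝[>] 0, ε < N s :=
    nhdsWithin_le_nhds (Iio_mem_nhds (hpos s hsI hs))
  filter_upwards [this] with ε hε
  exact (indicator_of_mem (show s ∈ {s ∈ Icc (-1 : ℝ) 1 | ε ≤ N s} from ⟨hsI, hε.le⟩) f).symm

theorem volume_annulus_le {σ r η : ℝ} (hr : 0 < r) (hη : 0 < η) :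
    volume {s : ℝ | r * (1 - η) ≤ |s - σ| ∧ |s - σ| ≤ r * (1 + 2 * η)} ≤
      ENNReal.ofReal (6 * η * r) := by
  have hsub : {s : ℝ | r * (1 - η) ≤ |s - σ| ∧ |s - σ| ≤ r * (1 + 2 * η)} ⊆
      Icc (σ + r * (1 - η)) (σ + r * (1 + 2 * η)) ∪
        Icc (σ - r * (1 + 2 * η)) (σ - r * (1 - η)) := by
    rintro s ⟨h1, h2⟩
    rcases abs_cases (s - σ) with ⟨h, _⟩ | ⟨h, _⟩
    · left; constructor <;> linarith
    · right; constructor <;> linarith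
  refine (measure_mono hsub).trans ((measure_union_le _ _).trans ?_)
  rw [Real.volume_Icc, Real.volume_Icc, ← ENNReal.ofReal_add] <;> ring_nf
  · rfl
  · positivity
  · positivity

theorem norm_setIntegral_inv_sub_le {E : Set ℝ} {σ r η : ℝ} (hr : 0 < r) (hη : 0 < η)
    (hη2 : η < 1 / 2)
    (hE : ∀ s ∈ E, r * (1 - η) ≤ |s - σ| ∧ |s - σ| ≤ r * (1 + 2 * η)) :
    ‖∫ s in E, (s - σ)⁻¹‖ ≤ 12 * η := by
  have hv : volume E ≤ ENNReal.ofReal (6 * η * r) :=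
    (measure_mono hE).trans (volume_annulus_le hr hη)
  have h1 : ‖∫ s in E, (s - σ)⁻¹‖ ≤ (2 / r) * volume.real E := by
    refine norm_setIntegral_le_of_norm_le_const (hv.trans_lt ENNReal.ofReal_lt_top) fun s hs => ?_
    have : r / 2 ≤ |s - σ| := by nlinarith [(hE s hs).1]
    rw [norm_inv, Real.norm_eq_abs, ← inv_div]
    exact inv_anti₀ (by positivity) this
  have h2 : volume.real E ≤ 6 * η * r := ENNReal.toReal_le_of_le_ofReal (by positivity) hv
  calc _ ≤ (2 / r) * (6 * η * r) := h1.trans (by gcongr)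
    _ = 12 * η := by field_simp; norm_num

theorem tendsto_setIntegral_inv_sub {N : ℝ → ℝ} {σ c k : ℝ} (hσ : σ ∈ Ioo (-1 : ℝ) 1)
    (hc : 0 < c) (hk : 0 < k)
    (hN : ∀ ε, MeasurableSet {s ∈ Icc (-1 : ℝ) 1 | ε ≤ N s})
    (hcN : ∀ s ∈ Icc (-1 : ℝ) 1, c * |s - σ| ≤ N s) (hN0 : N σ = 0)
    (hlim : Tendsto (fun s => N s / |s - σ|) (𝓝[≠] σ) (𝓝 k)) :
    Tendsto (fun ε : ℝ => ∫ s in {s ∈ Icc (-1 : ℝ) 1 | ε ≤ N s}, (s - σ)⁻¹) (𝓝[>] 0)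
      (𝓝 (Real.log ((1 - σ) / (1 + σ)))) := by
  rw [Metric.tendsto_nhds]
  intro κ hκ
  obtain ⟨η, hη, hη1⟩ : ∃ η : ℝ, 0 < η ∧ η < min (1 / 2) (κ / 24) := exists_between (by positivity)
  have hη2 : η < 1 / 2 := hη1.trans_le (min_le_left _ _)
  have hη3 : η < κ / 24 := hη1.trans_le (min_le_right _ _)
  obtain ⟨δ, hδ, hδN⟩ : ∃ δ > 0, ∀ s, |s - σ| < δ → s ≠ σ → |N s / |s - σ| - k| < η * k := by
    have := (Metric.tendsto_nhds.mp hlim) (η * k) (by positivity)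
    rw [eventually_nhdsWithin_iff, Metric.eventually_nhds_iff] at this
    obtain ⟨δ, hδ, h⟩ := this
    exact ⟨δ, hδ, fun s hs hne => h (by rwa [Real.dist_eq]) hne⟩
  have hδN' : ∀ s, |s - σ| < δ → s ≠ σ →
      k * (1 - η) * |s - σ| < N s ∧ N s < k * (1 + η) * |s - σ| := by
    intro s hs hne
    have hp : 0 < |s - σ| := abs_pos.mpr (sub_ne_zero.mpr hne)
    obtain ⟨h1, h2⟩ := abs_lt.mp (hδN s hs hne)
    constructor
    · rw [← lt_div_iff₀ hp]; linarith
    · rw [← div_lt_iff₀ hp]; linarith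
  set μ := min δ (min (1 - σ) (1 + σ)) with hμ
  have hμ0 : 0 < μ := lt_min hδ (lt_min (by linarith [hσ.2]) (by linarith [hσ.1]))
  have hsmall : ∀ᶠ ε : ℝ in 𝓝[>] 0, ε < min (c * δ) (k * μ / 2) :=
    nhdsWithin_le_nhds (Iio_mem_nhds (by positivity))
  filter_upwards [hsmall, self_mem_nhdsWithin] with ε hε hε0
  have hε1 : ε < c * δ := hε.trans_le (min_le_left _ _)
  have hε2 : ε < k * μ / 2 := hε.trans_le (min_le_right _ _)
  have hε0 : 0 < ε := hε0
  obtain ⟨r, rfl⟩ : ∃ r, ε = k * r := ⟨ε / k, by field_simp⟩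
  have hr : 0 < r := pos_of_mul_pos_right hε0 hk.le
  have hrμ : r < μ / 2 := by
    rw [mul_div_assoc] at hε2
    exact lt_of_mul_lt_mul_left hε2 hk.le
  have hrδ : 2 * r < δ := by linarith [min_le_left δ (min (1 - σ) (1 + σ))]
  have hrσ : r < 1 - σ ∧ r < 1 + σ := by
    have h1 := min_le_right δ (min (1 - σ) (1 + σ))
    constructor
    · linarith [min_le_left (1 - σ) (1 + σ)]
    · linarith [min_le_right (1 - σ) (1 + σ)]
  set E := {s ∈ Icc (-1 : ℝ) 1 | k * r ≤ N s} with hE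
  set J := Icc (-1 : ℝ) 1 \ Ioo (σ - r) (σ + r) with hJ
  obtain ⟨iJ, eJ⟩ := integral_inv_sub_diff (a := σ - r) (b := σ + r) (σ := σ) (by linarith)
    (by linarith) (by linarith) (by linarith)
  have hJr : ∀ s ∈ J, r ≤ |s - σ| := by
    intro s hs
    by_contra! h
    rw [abs_lt] at h
    exact hs.2 ⟨by linarith, by linarith⟩
  have hJlog : ∫ s in J, (s - σ)⁻¹ = Real.log ((1 - σ) / (1 + σ)) := by
    rw [eJ, add_sub_cancel_left, sub_sub_cancel, div_self hr.ne', Real.log_one, sub_zero]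
  have hEne : ∀ s ∈ E, s ≠ σ := by
    rintro s hs rfl
    have := hs.2
    rw [hN0] at this
    linarith
  have hEfar : ∀ s ∈ E, min δ r / 2 ≤ |s - σ| := by
    intro s hs
    rcases lt_or_ge |s - σ| δ with h | h
    · have h1 := (hδN' s h (hEne s hs)).2
      have h2 := hs.2
      have h3 : r < (1 + η) * |s - σ| := by
        rw [mul_assoc] at h1
        exact lt_of_mul_lt_mul_left (h2.trans_lt h1) hk.le
      have h4 : 0 ≤ |s - σ| := abs_nonneg _
      nlinarith [min_le_right δ r]
    · linarith [min_le_left δ r, abs_nonneg (s - σ)]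
  have iE : IntegrableOn (fun s : ℝ => (s - σ)⁻¹) E :=
    integrableOn_inv_sub (by positivity) (hN _) (fun s hs => hs.1) hEfar
  have hJm : MeasurableSet J := measurableSet_Icc.diff measurableSet_Ioo
  have b1 : ‖∫ s in E \ J, (s - σ)⁻¹‖ ≤ 12 * η := by
    refine norm_setIntegral_inv_sub_le hr hη hη2 fun s hs => ?_
    have hs1 : |s - σ| < r := by
      by_contra! h
      refine hs.2 ⟨hs.1.1, fun hh => ?_⟩
      have : |s - σ| < r := abs_lt.mpr ⟨by linarith [hh.1], by linarith [hh.2]⟩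
      linarith
    have h1 := (hδN' s (by linarith) (hEne s hs.1)).2
    have h3 : r < (1 + η) * |s - σ| := by
      rw [mul_assoc] at h1
      exact lt_of_mul_lt_mul_left (hs.1.2.trans_lt h1) hk.le
    constructor
    · nlinarith [abs_nonneg (s - σ)]
    · nlinarith
  have b2 : ‖∫ s in J \ E, (s - σ)⁻¹‖ ≤ 12 * η := by
    refine norm_setIntegral_inv_sub_le hr hη hη2 fun s hs => ?_
    have hs1 := hJr s hs.1
    have hs2 : N s < k * r := by
      by_contra! h
      exact hs.2 ⟨hs.1.1, h⟩
    have hs3 : |s - σ| < δ := by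
      have : c * |s - σ| < c * δ := (hcN s hs.1.1).trans_lt (hs2.trans hε1)
      exact lt_of_mul_lt_mul_left this hc.le
    have hne : s ≠ σ := by
      rintro rfl
      rw [sub_self, abs_zero] at hs1
      linarith
    have h1 := (hδN' s hs3 hne).1
    have h3 : (1 - η) * |s - σ| < r := by
      rw [mul_assoc] at h1
      exact lt_of_mul_lt_mul_left (h1.trans hs2) hk.le
    constructor
    · nlinarith
    · by_contra! h
      nlinarith
  have d1 := integral_inter_add_sdiff hJm iE
  have d2 := integral_inter_add_sdiff (hN (k * r)) iJ
  rw [inter_comm] at d2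
  rw [dist_eq_norm, ← hJlog, ← d1, ← d2, add_sub_add_left_eq_sub]
  refine (norm_sub_le _ _).trans_lt ?_
  linarith

/-- The principal value through symmetric or skewed truncations is `finHilbert`. -/
theorem tendsto_truncated_finHilbert {ψ : ℝ → ℂ} {N : ℝ → ℝ} {σ c k : ℝ}
    (hσ : σ ∈ Ioo (-1 : ℝ) 1) (hc : 0 < c) (hk : 0 < k)
    (hd : IntegrableOn (fun s => (ψ s - ψ σ) / ((s : ℂ) - σ)) (Icc (-1 : ℝ) 1))
    (hN : ∀ ε, MeasurableSet {s ∈ Icc (-1 : ℝ) 1 | ε ≤ N s})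
    (hcN : ∀ s ∈ Icc (-1 : ℝ) 1, c * |s - σ| ≤ N s) (hN0 : N σ = 0)
    (hlim : Tendsto (fun s => N s / |s - σ|) (𝓝[≠] σ) (𝓝 k))
    {C : ℝ} (hC : 0 < C) (hCN : ∀ s ∈ Icc (-1 : ℝ) 1, N s ≤ C * |s - σ|) :
    Tendsto (fun ε : ℝ => ∫ s in {s ∈ Icc (-1 : ℝ) 1 | ε ≤ N s}, ψ s / ((s : ℂ) - σ)) (𝓝[>] 0)
      (𝓝 (finHilbert ψ σ)) := by
  have hpos : ∀ s ∈ Icc (-1 : ℝ) 1, s ≠ σ → 0 < N s := fun s hs hne =>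
    (mul_pos hc (abs_pos.mpr (sub_ne_zero.mpr hne))).trans_le (hcN s hs)
  have h1 := tendsto_setIntegral_truncated hd hN hpos
  have h2 := (Complex.continuous_ofReal.tendsto _).comp
    (tendsto_setIntegral_inv_sub hσ hc hk hN hcN hN0 hlim)
  have h3 := h1.add (h2.const_mul (ψ σ))
  refine h3.congr' ?_
  filter_upwards [self_mem_nhdsWithin] with ε hε
  have hε : 0 < ε := hε
  have iE : IntegrableOn (fun s : ℝ => (s - σ)⁻¹) {s ∈ Icc (-1 : ℝ) 1 | ε ≤ N s} := by
    refine integrableOn_inv_sub (δ := ε / C) (by positivity) (hN _) (fun s hs => hs.1)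
      fun s hs => ?_
    rw [div_le_iff₀' hC]
    exact hs.2.trans (hCN s hs.1)
  have i2 : IntegrableOn (fun s : ℝ => ψ σ * (((s - σ)⁻¹ : ℝ) : ℂ))
    {s ∈ Icc (-1 : ℝ) 1 | ε ≤ N s} := (iE.ofReal).const_mul _
  simp only [Function.comp]
  rw [← integral_complex_ofReal, ← integral_const_mul,
    ← integral_add (hd.mono_set fun s hs => hs.1) i2]
  refine integral_congr_ae (Eventually.of_forall fun s => ?_)
  simp only [ofReal_inv_sub]
  ring

theorem one_sub_abs_le_one_sub_sq {s : ℝ} (hs : s ∈ Icc (-1 : ℝ) 1) :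
    1 - |s| ≤ 1 - s ^ 2 ∧ 1 - s ^ 2 ≤ 2 * (1 - |s|) := by
  have h1 : |s| ≤ 1 := abs_le.mpr hs
  have h2 := abs_nonneg s
  have h3 := sq_abs s
  constructor <;> nlinarith

theorem one_sub_abs_pos {s : ℝ} (hs : s ∈ Ioo (-1 : ℝ) 1) : 0 < 1 - |s| :=
  sub_pos.mpr (abs_lt.mpr hs)

theorem one_sub_sq_pos {s : ℝ} (hs : s ∈ Ioo (-1 : ℝ) 1) : 0 < 1 - s ^ 2 :=
  (one_sub_abs_pos hs).trans_le (one_sub_abs_le_one_sub_sq (Ioo_subset_Icc_self hs)).1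

theorem ae_mem_Ioo : ∀ᵐ s : ℝ ∂(volume.restrict (Icc (-1 : ℝ) 1)), s ∈ Ioo (-1 : ℝ) 1 := by
  rw [← restrict_Ioo_eq_restrict_Icc]
  exact ae_restrict_mem measurableSet_Ioo

theorem integrableOn_inv_sqrt :
    IntegrableOn (fun s : ℝ => (Real.sqrt (1 - s ^ 2))⁻¹) (Icc (-1 : ℝ) 1) := by
  refine Integrable.mono' (integrableOn_endpoint_weight (e := 1 / 2) (by norm_num))
    (by fun_prop) ?_
  filter_upwards [ae_mem_Ioo] with s hs
  have h := one_sub_abs_pos hs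
  rw [Real.norm_of_nonneg (by positivity), Real.rpow_neg h.le, ← Real.sqrt_eq_rpow]
  exact inv_anti₀ (by positivity)
    (Real.sqrt_le_sqrt (one_sub_abs_le_one_sub_sq (Ioo_subset_Icc_self hs)).1)

/-- The finite Hilbert transform of `1/√(1-s²)` vanishes. -/
theorem finHilbert_inv_sqrt {σ : ℝ} (hσ : σ ∈ Ioo (-1 : ℝ) 1) :
    IntegrableOn (fun s : ℝ => ((((Real.sqrt (1 - s ^ 2))⁻¹ : ℝ) : ℂ) -
      (((Real.sqrt (1 - σ ^ 2))⁻¹ : ℝ) : ℂ)) / ((s : ℂ) - σ)) (Icc (-1 : ℝ) 1) ∧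
    finHilbert (fun s => (((Real.sqrt (1 - s ^ 2))⁻¹ : ℝ) : ℂ)) σ = 0 := by
  set ρ : ℝ → ℝ := fun s => Real.sqrt (1 - s ^ 2) with hρ
  have hρ2 : ∀ s ∈ Ioo (-1 : ℝ) 1, 0 < ρ s ∧ ρ s ^ 2 = 1 - s ^ 2 := fun s hs =>
    ⟨Real.sqrt_pos.mpr (one_sub_sq_pos hs), Real.sq_sqrt (one_sub_sq_pos hs).le⟩
  obtain ⟨hρσ, hρσ2⟩ := hρ2 σ hσ
  have hρ0 : ∀ s, 0 ≤ ρ s := fun s => Real.sqrt_nonneg _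
  have hpos : ∀ s ∈ Icc (-1 : ℝ) 1, 0 < 1 - σ * s + ρ σ * ρ s := by
    intro s hs
    have h1 : 0 < 1 - σ * s := by
      have : |σ * s| < 1 := by
        rw [abs_mul]
        nlinarith [abs_lt.mpr hσ, abs_le.mpr hs, abs_nonneg s, abs_nonneg σ]
      linarith [le_abs_self (σ * s)]
    linarith [mul_nonneg hρσ.le (hρ0 s)]
  set q : ℝ → ℝ := fun s => (s + σ) / (ρ s * ρ σ * (ρ s + ρ σ)) with hq
  have hρm : Measurable ρ := by fun_prop
  have hqi : IntegrableOn q (Icc (-1 : ℝ) 1) := by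
    refine Integrable.mono' (integrableOn_inv_sqrt.const_mul (2 / ρ σ ^ 2)) ?_ ?_
    · exact (Measurable.div (by fun_prop) (by fun_prop)).aestronglyMeasurable
    filter_upwards [ae_mem_Ioo] with s hs
    obtain ⟨h1, h2⟩ := hρ2 s hs
    rw [hq, norm_div, Real.norm_of_nonneg (by positivity : 0 ≤ ρ s * ρ σ * (ρ s + ρ σ)),
      div_le_iff₀ (by positivity), Real.norm_eq_abs]
    have h3 : |s + σ| ≤ 2 := abs_le.mpr ⟨by linarith [hs.1, hσ.1], by linarith [hs.2, hσ.2]⟩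
    have h4 : 2 / ρ σ ^ 2 * (Real.sqrt (1 - s ^ 2))⁻¹ * (ρ s * ρ σ * (ρ s + ρ σ)) =
        2 + 2 * ρ s / ρ σ := by
      have : Real.sqrt (1 - s ^ 2) = ρ s := rfl
      rw [this]
      field_simp
      ring
    rw [h4]
    have : 0 ≤ 2 * ρ s / ρ σ := by positivity
    linarith
  have hInt : ∫ s in Icc (-1 : ℝ) 1, q s = -(ρ σ)⁻¹ * Real.log ((1 - σ) / (1 + σ)) := by
    have hc : ContinuousOn (fun s => -(ρ σ)⁻¹ * Real.log (1 - σ * s + ρ σ * ρ s))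
        (Icc (-1 : ℝ) 1) := by
      refine ContinuousOn.mul continuousOn_const (ContinuousOn.log ?_ fun s hs => (hpos s hs).ne')
      fun_prop
    have hder : ∀ s ∈ Ioo (-1 : ℝ) 1,
        HasDerivAt (fun s => -(ρ σ)⁻¹ * Real.log (1 - σ * s + ρ σ * ρ s)) (q s) s := by
      intro s hs
      obtain ⟨h1, h2⟩ := hρ2 s hs
      have hp := hpos s (Ioo_subset_Icc_self hs)
      have d1 : HasDerivAt (fun s : ℝ => 1 - s ^ 2) (-(2 * s)) s := by
        simpa using (hasDerivAt_pow 2 s).const_sub 1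
      have d2 : HasDerivAt ρ (-(2 * s) / (2 * ρ s)) s := d1.sqrt (one_sub_sq_pos hs).ne'
      have d3 : HasDerivAt (fun s => 1 - σ * s + ρ σ * ρ s)
          (-(σ * 1) + ρ σ * (-(2 * s) / (2 * ρ s))) s :=
        (((hasDerivAt_id' s).const_mul σ).const_sub 1).add (d2.const_mul _)
      refine ((d3.log hp.ne').const_mul (-(ρ σ)⁻¹)).congr_deriv ?_
      have key : (σ * ρ s + ρ σ * s) * (ρ s + ρ σ) = (s + σ) * (1 - σ * s + ρ σ * ρ s) := by
        linear_combination σ * h2 + s * hρσ2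
      have : 0 < ρ s + ρ σ := by positivity
      rw [hq]
      field_simp
      linear_combination key
    rw [integral_Icc_eq_integral_Ioc, ← intervalIntegral.integral_of_le (by norm_num),
      intervalIntegral.integral_eq_sub_of_hasDerivAt_of_le (by norm_num) hc hder
        ((intervalIntegrable_iff_integrableOn_Icc_of_le (by norm_num)).mpr hqi)]
    have e1 : ρ 1 = 0 := by simp [hρ]
    have e2 : ρ (-1) = 0 := by simp [hρ]
    rw [e1, e2, Real.log_div (by linarith [hσ.2]) (by linarith [hσ.1])]
    ring_nf
  have h0 : ∀ᵐ s : ℝ ∂(volume.restrict (Icc (-1 : ℝ) 1)), s ≠ σ :=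
    ae_restrict_of_ae (by simp [ae_iff])
  have hae : (fun s => (q s : ℂ)) =ᵐ[volume.restrict (Icc (-1 : ℝ) 1)]
      fun s => ((((ρ s)⁻¹ : ℝ) : ℂ) - (((ρ σ)⁻¹ : ℝ) : ℂ)) / ((s : ℂ) - σ) := by
    filter_upwards [h0, ae_mem_Ioo] with s hs hsI
    obtain ⟨h1, h2⟩ := hρ2 s hsI
    rw [← ofReal_sub, ← ofReal_sub, ← ofReal_div]
    congr 1
    have h3 : s - σ ≠ 0 := sub_ne_zero.mpr hs
    have : 0 < ρ s + ρ σ := by positivity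
    rw [hq]
    field_simp
    linear_combination h2 - hρσ2
  refine ⟨(hqi.ofReal (𝕜 := ℂ)).congr hae, ?_⟩
  rw [finHilbert, ← integral_congr_ae hae, integral_complex_ofReal, hInt]
  push_cast
  ring

theorem abs_log_div_le {R δ : ℝ} (hR : 0 < R) (hδ : |δ| ≤ R / 2) :
    |Real.log ((R - δ) / (R + δ))| ≤ 4 * |δ| / R := by
  obtain ⟨h1, h2⟩ := abs_le.mp hδ
  have hp : 0 < R - δ := by linarith
  have hq : 0 < R + δ := by linarith
  have key : ∀ a b : ℝ, R / 2 ≤ b → 0 < a → |a - b| ≤ 2 * |δ| →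
      Real.log (a / b) ≤ 4 * |δ| / R := by
    intro a b hb ha hab
    have hb0 : 0 < b := by linarith
    refine (Real.log_le_sub_one_of_pos (div_pos ha hb0)).trans ?_
    rw [div_sub_one hb0.ne', div_le_div_iff₀ hb0 hR]
    have := (le_abs_self _).trans hab
    nlinarith [abs_nonneg δ]
  rw [abs_le]
  constructor
  · have := key (R + δ) (R - δ) (by linarith) hq
      (by rw [show R + δ - (R - δ) = 2 * δ by ring, abs_mul, abs_two])
    rw [← inv_div, Real.log_inv] at this
    linarith
  · refine key (R - δ) (R + δ) (by linarith) hp ?_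
    rw [show R - δ - (R + δ) = 2 * -δ by ring, abs_mul, abs_two, abs_neg]

/-- Hölder's inequality against the tail of a truncated Cauchy kernel. -/
theorem norm_setIntegral_tail_le {p : ℝ} (hp : 2 < p) {ψ : ℝ → ℂ} (hψ : Measurable ψ)
    {σ τ r Q : ℝ} (hQ : 0 ≤ Q) (hh : σ ≠ τ)
    (hσ : ∫⁻ s in Ioo (σ - r) (σ + r), ENNReal.ofReal ((‖ψ s - ψ σ‖ / |s - σ|) ^ p) ≤
      ENNReal.ofReal (Q ^ p)) :
    ‖∫ s in Ioo (σ - r) (σ + r) \ Ioo (σ - 2 * |σ - τ|) (σ + 2 * |σ - τ|),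
      (ψ s - ψ σ) * ((σ : ℂ) - τ) / (((s : ℂ) - σ) * ((s : ℂ) - τ))‖ ≤
      Q * ((4 * (p - 1)) ^ (1 - 1 / p) * |σ - τ| ^ (1 - 1 / p)) := by
  set h := |σ - τ| with hhdef
  have hpos : 0 < h := abs_pos.mpr (sub_ne_zero.mpr hh)
  set E := Ioo (σ - r) (σ + r) \ Ioo (σ - 2 * h) (σ + 2 * h) with hE
  have hEm : MeasurableSet E := measurableSet_Ioo.diff measurableSet_Ioo
  have hfar : ∀ s ∈ E, 2 * h ≤ |s - σ| := by
    intro s hs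
    by_contra! hlt
    rw [abs_lt] at hlt
    exact hs.2 ⟨by linarith, by linarith⟩
  have hpp := holderConjugate_conj hp
  set p' := p / (p - 1) with hp'
  have hp1 : p' - 1 = 1 / (p - 1) := by
    rw [hp']; have : p - 1 ≠ 0 := by linarith
    field_simp; ring
  have hp1' : 0 < 1 / (p - 1) := by apply one_div_pos.mpr; linarith
  have hb : 1 - 1 / p = 1 / p' := by
    have := hpp.inv_add_inv_eq_one
    rw [one_div, one_div]; linarith
  have hp'0 : 0 < p' := hpp.symm.pos
  have hW : ((4 * (p - 1)) ^ (1 - 1 / p) * h ^ (1 - 1 / p)) ^ p' = 4 * (p - 1) * h := by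
    rw [← Real.mul_rpow (by linarith) hpos.le, hb, ← Real.rpow_mul
      (mul_nonneg (by linarith) hpos.le), one_div_mul_cancel hp'0.ne', Real.rpow_one]
  have hH := integral_mul_le_of_lintegral_rpow_le (μ := volume.restrict E) hpp
    (f := fun s => ‖ψ s - ψ σ‖ / |s - σ|) (w := fun s => 2 * h * |s - σ| ^ (-1 : ℝ))
    (fun s => by positivity) (fun s => by positivity)
    ((hψ.sub_const _).norm.div (by fun_prop)).aestronglyMeasurable
    ((measurable_abs_sub_rpow σ (-1)).const_mul _).aestronglyMeasurable hQ
    (W := (4 * (p - 1)) ^ (1 - 1 / p) * h ^ (1 - 1 / p))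
    (mul_nonneg (Real.rpow_nonneg (by linarith) _) (by positivity))
    ((lintegral_mono_set sdiff_subset).trans hσ) ?_
  · refine (norm_integral_le_of_norm_le hH.1 ?_).trans hH.2
    filter_upwards [ae_restrict_mem hEm] with s hs
    have h1 := hfar s hs
    have h2 : 0 < |s - σ| := by linarith
    have h3 : |s - σ| / 2 ≤ |s - τ| := by
      have : |s - σ| ≤ |s - τ| + h := by
        rw [hhdef, abs_sub_comm σ τ]; exact abs_sub_le s τ σ
      linarith
    rw [norm_div, norm_mul, norm_mul, norm_ofReal_sub_ofReal, norm_ofReal_sub_ofReal,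
      norm_ofReal_sub_ofReal, Real.rpow_neg_one, ← hhdef, mul_div_mul_comm]
    have h4 : h / |s - τ| ≤ 2 * h * |s - σ|⁻¹ := by
      rw [div_le_iff₀ (by linarith)]
      calc h = 2 * h * |s - σ|⁻¹ * (|s - σ| / 2) := by field_simp
        _ ≤ _ := by gcongr
    gcongr
  · rw [hW]
    have e1 : ∀ s, ENNReal.ofReal ((2 * h * |s - σ| ^ (-1 : ℝ)) ^ p') =
        ENNReal.ofReal ((2 * h) ^ p') * ENNReal.ofReal (|s - σ| ^ (-p')) := by
      intro s
      rw [Real.mul_rpow (by positivity) (by positivity), ← Real.rpow_mul (abs_nonneg _),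
        neg_one_mul, ENNReal.ofReal_mul (by positivity)]
    simp only [e1]
    rw [lintegral_const_mul _ (measurable_abs_sub_rpow σ _).ennreal_ofReal]
    refine (mul_le_mul_right ((lintegral_mono_set hfar).trans
      (setLIntegral_abs_sub_rpow_far_le (β := -p') (by linarith) (by positivity) σ)) _).trans ?_
    rw [← ENNReal.ofReal_mul (by positivity)]
    apply ENNReal.ofReal_le_ofReal
    rw [show -(-p' + 1) = p' - 1 by ring, hp1, Real.rpow_add (by positivity), Real.rpow_one,
      Real.rpow_neg (by positivity)]
    have : 0 < (2 * h) ^ p' := by positivity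
    apply le_of_eq
    field_simp
    ring

theorem integral_inv_sub_annulus {σ τ r ρ : ℝ} (hρr : ρ ≤ r)
    (h : |σ - τ| < ρ) (hl : -1 ≤ σ - r) (hr : σ + r ≤ 1) :
    IntegrableOn (fun s : ℝ => (s - τ)⁻¹) (Ioo (σ - r) (σ + r) \ Ioo (σ - ρ) (σ + ρ)) ∧
    ∫ s in Ioo (σ - r) (σ + r) \ Ioo (σ - ρ) (σ + ρ), (s - τ)⁻¹ =
      Real.log ((r - (τ - σ)) / (r + (τ - σ))) - Real.log ((ρ - (τ - σ)) / (ρ + (τ - σ))) := by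
  obtain ⟨h1, h2⟩ := abs_lt.mp h
  obtain ⟨i1, e1⟩ := integral_inv_sub_diff (a := σ - r) (b := σ + r) (σ := τ) hl
    (by linarith) (by linarith) hr
  obtain ⟨i2, e2⟩ := integral_inv_sub_diff (a := σ - ρ) (b := σ + ρ) (σ := τ) (by linarith)
    (by linarith) (by linarith) (by linarith)
  have hsub : Ioo (σ - r) (σ + r) ⊆ Icc (-1 : ℝ) 1 := fun s hs =>
    ⟨by linarith [hs.1], by linarith [hs.2]⟩
  have hsub2 : Ioo (σ - ρ) (σ + ρ) ⊆ Ioo (σ - r) (σ + r) :=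
    Ioo_subset_Ioo (by linarith) (by linarith)
  have i3 := i2.mono_set (sdiff_subset_sdiff_left hsub :
    Ioo (σ - r) (σ + r) \ Ioo (σ - ρ) (σ + ρ) ⊆ _)
  refine ⟨i3, ?_⟩
  have hun : Icc (-1 : ℝ) 1 \ Ioo (σ - ρ) (σ + ρ) = (Icc (-1 : ℝ) 1 \ Ioo (σ - r) (σ + r)) ∪
      (Ioo (σ - r) (σ + r) \ Ioo (σ - ρ) (σ + ρ)) := by
    ext s
    have := @hsub s
    have := @hsub2 s
    simp only [Set.mem_sdiff, mem_union]
    tauto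
  have hd : Disjoint (Icc (-1 : ℝ) 1 \ Ioo (σ - r) (σ + r))
      (Ioo (σ - r) (σ + r) \ Ioo (σ - ρ) (σ + ρ)) :=
    Set.disjoint_left.mpr fun s h1 h2 => h1.2 h2.1
  have e3 := setIntegral_union hd (measurableSet_Ioo.diff measurableSet_Ioo) i1 i3
  rw [← hun, e1, e2] at e3
  rw [show r - (τ - σ) = σ + r - τ by ring, show r + (τ - σ) = τ - (σ - r) by ring,
    show ρ - (τ - σ) = σ + ρ - τ by ring, show ρ + (τ - σ) = τ - (σ - ρ) by ring]
  linarith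

/-- Local regularity of the finite Hilbert transform. -/
theorem norm_finHilbert_sub_le_local {p : ℝ} (hp : 2 < p) {ψ : ℝ → ℂ} (hψ : Measurable ψ)
    {σ τ r Q : ℝ} (hQ : 0 ≤ Q) (hh : σ ≠ τ) (hr : 4 * |σ - τ| ≤ r)
    (hl : -1 ≤ σ - r) (hu : σ + r ≤ 1)
    (hσ : ∫⁻ s in Ioo (σ - r) (σ + r), ENNReal.ofReal ((‖ψ s - ψ σ‖ / |s - σ|) ^ p) ≤
      ENNReal.ofReal (Q ^ p))
    (hτ : ∫⁻ s in Ioo (σ - r) (σ + r), ENNReal.ofReal ((‖ψ s - ψ τ‖ / |s - τ|) ^ p) ≤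
      ENNReal.ofReal (Q ^ p))
    (hdσ : IntegrableOn (fun s => (ψ s - ψ σ) / ((s : ℂ) - σ)) (Icc (-1 : ℝ) 1))
    (hdτ : IntegrableOn (fun s => (ψ s - ψ τ) / ((s : ℂ) - τ)) (Icc (-1 : ℝ) 1)) {K : ℝ}
    (hfar : IntegrableOn (fun s => ‖ψ s‖ / (|s - σ| * |s - τ|))
      (Icc (-1 : ℝ) 1 \ Ioo (σ - r) (σ + r)))
    (hK : ∫ s in Icc (-1 : ℝ) 1 \ Ioo (σ - r) (σ + r), ‖ψ s‖ / (|s - σ| * |s - τ|) ≤ K) :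
    ‖finHilbert ψ σ - finHilbert ψ τ‖ ≤
      (2 * 4 ^ (1 - 1 / p) + (4 * (p - 1)) ^ (1 - 1 / p) + 6) * (Q * |σ - τ| ^ (1 - 1 / p)) +
        4 * |σ - τ| / r * ‖ψ τ‖ + |σ - τ| * K := by
  set h := |σ - τ| with hhdef
  have hpos : 0 < h := abs_pos.mpr (sub_ne_zero.mpr hh)
  obtain ⟨hστ1, hστ2⟩ := abs_le.mp (hhdef ▸ le_rfl : |σ - τ| ≤ h)
  set B := Ioo (σ - r) (σ + r) with hB
  set N := Ioo (σ - 2 * h) (σ + 2 * h) with hN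
  set b := 1 - 1 / p with hb
  have hpp := holderConjugate_conj hp
  have hBI : B ⊆ Icc (-1 : ℝ) 1 := fun s hs => ⟨by linarith [hs.1], by linarith [hs.2]⟩
  have hNB : N ⊆ B := Ioo_subset_Ioo (by linarith) (by linarith)
  have hNv : volume N ≤ ENNReal.ofReal (4 * h) := by
    rw [hN, Real.volume_Ioo]; ring_nf; rfl
  have nearmeas : ∀ a : ℝ, AEStronglyMeasurable (fun s => ‖ψ s - ψ a‖ / |s - a|)
      (volume.restrict B) := fun a =>
    ((hψ.sub_const _).norm.div (by fun_prop)).aestronglyMeasurable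
  have near : ∀ a : ℝ, (∫⁻ s in B, ENNReal.ofReal ((‖ψ s - ψ a‖ / |s - a|) ^ p) ≤
      ENNReal.ofReal (Q ^ p)) →
      ‖∫ s in N, (ψ s - ψ a) / ((s : ℂ) - a)‖ ≤ Q * (4 * h) ^ b := by
    intro a ha
    obtain ⟨j1, j2⟩ := integral_le_of_lintegral_rpow_le hpp hNB (fun s => by positivity)
      (nearmeas a) hQ (by positivity : 0 ≤ 4 * h) hNv ha
    refine (norm_integral_le_of_norm_le j1 (Eventually.of_forall fun s => ?_)).trans j2
    rw [norm_div, norm_ofReal_sub_ofReal]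
  have nσ := near σ hσ
  have nτ := near τ hτ
  have tail := norm_setIntegral_tail_le hp hψ hQ hh hσ
  rw [← hhdef, ← hB, ← hN, ← hb] at tail
  have hψd : ‖ψ σ - ψ τ‖ ≤ (Q + Q) * h ^ b :=
    norm_sub_le_of_lintegral_le hpp hψ.aestronglyMeasurable (by
      intro s hs
      rw [mem_uIoc] at hs
      rcases hs with hs | hs <;> constructor <;> linarith [hs.1, hs.2]) hQ hQ hσ hτ
  obtain ⟨ia, ea⟩ := integral_inv_sub_annulus (σ := σ) (τ := τ) (r := r) (ρ := 2 * h)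
    (by linarith) (by linarith) hl hu
  rw [← hB, ← hN] at ia ea
  set Lr := Real.log ((r - (τ - σ)) / (r + (τ - σ))) with hLr
  set Lh := Real.log ((2 * h - (τ - σ)) / (2 * h + (τ - σ))) with hLh
  have hLr1 : |Lr| ≤ 4 * h / r := by
    have := abs_log_div_le (R := r) (δ := τ - σ) (by linarith) (by rw [abs_sub_comm]; linarith)
    rwa [abs_sub_comm τ σ] at this
  have hLh1 : |Lh| ≤ 2 := by
    have := abs_log_div_le (R := 2 * h) (δ := τ - σ) (by linarith)
      (by rw [abs_sub_comm]; linarith)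
    rw [abs_sub_comm τ σ, ← hhdef, show 4 * h / (2 * h) = 2 by field_simp; norm_num] at this
    exact this
  have hLr2 : |Lr| ≤ 1 := hLr1.trans (by rw [div_le_one (by linarith)]; exact hr)
  have wσ := finHilbert_eq_window hdσ hl (by linarith : σ - r < σ) (by linarith : σ < σ + r) hu
  have wτ := finHilbert_eq_window hdτ hl (by linarith : σ - r < τ) (by linarith : τ < σ + r) hu
  rw [add_sub_cancel_left, sub_sub_cancel, div_self (by linarith), Real.log_one, ofReal_zero,
    mul_zero, add_zero] at wσ
  rw [show (σ + r - τ) / (τ - (σ - r)) = (r - (τ - σ)) / (r + (τ - σ)) by ring_nf, ← hLr] at wτ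
  have hBN : B = N ∪ B \ N := (union_sdiff_cancel hNB).symm
  have split : ∀ f : ℝ → ℂ, IntegrableOn f (Icc (-1 : ℝ) 1) →
      ∫ s in B, f s = (∫ s in N, f s) + ∫ s in B \ N, f s := by
    intro f hf
    conv_lhs => rw [hBN]
    exact setIntegral_union disjoint_sdiff_right (measurableSet_Ioo.diff measurableSet_Ioo)
      (hf.mono_set (hNB.trans hBI)) (hf.mono_set (sdiff_subset.trans hBI))
  have hfarB : ∀ s : ℝ, s ∉ B → r ≤ |s - σ| := by
    intro s hs
    by_contra! hlt
    rw [abs_lt] at hlt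
    exact hs ⟨by linarith, by linarith⟩
  have hne : ∀ s ∉ N, (s : ℂ) - σ ≠ 0 ∧ (s : ℂ) - τ ≠ 0 := by
    intro s hs
    constructor <;> apply ofReal_sub_ne_zero <;> rintro rfl <;>
      exact hs ⟨by linarith, by linarith⟩
  have mid : (∫ s in B \ N, (ψ s - ψ σ) / ((s : ℂ) - σ)) -
      (∫ s in B \ N, (ψ s - ψ τ) / ((s : ℂ) - τ)) =
      (∫ s in B \ N, (ψ s - ψ σ) * ((σ : ℂ) - τ) / (((s : ℂ) - σ) * ((s : ℂ) - τ))) -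
        (ψ σ - ψ τ) * (Lr - Lh : ℝ) := by
    have ib : IntegrableOn (fun s : ℝ => (ψ σ - ψ τ) * (((s - τ)⁻¹ : ℝ) : ℂ)) (B \ N) :=
      (ia.ofReal).const_mul _
    have k1 := hdσ.mono_set (sdiff_subset.trans hBI : B \ N ⊆ _)
    have k2 := hdτ.mono_set (sdiff_subset.trans hBI : B \ N ⊆ _)
    have k3 : IntegrableOn (fun s => (ψ s - ψ σ) / ((s : ℂ) - σ) - (ψ s - ψ τ) / ((s : ℂ) - τ))
      (B \ N) := k1.sub k2
    rw [← ea, ← integral_complex_ofReal, ← integral_const_mul, ← integral_sub k1 k2,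
      eq_sub_iff_add_eq, ← integral_add k3 ib]
    refine setIntegral_congr_fun (measurableSet_Ioo.diff measurableSet_Ioo) fun s hs => ?_
    obtain ⟨n1, n2⟩ := hne s hs.2
    simp only [ofReal_inv_sub]
    field_simp
    ring
  have far : ‖(∫ s in Icc (-1 : ℝ) 1 \ B, ψ s / ((s : ℂ) - σ)) -
      ∫ s in Icc (-1 : ℝ) 1 \ B, ψ s / ((s : ℂ) - τ)‖ ≤ h * K := by
    have hm : MeasurableSet (Icc (-1 : ℝ) 1 \ B) := measurableSet_Icc.diff measurableSet_Ioo
    have hne' : ∀ s ∈ Icc (-1 : ℝ) 1 \ B, (s : ℂ) - σ ≠ 0 ∧ (s : ℂ) - τ ≠ 0 := fun s hs =>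
      hne s fun h' => hs.2 (hNB h')
    have ii : ∀ a : ℝ, a ∈ Ioo (σ - r) (σ + r) →
        IntegrableOn (fun s => (ψ s - ψ a) / ((s : ℂ) - a)) (Icc (-1 : ℝ) 1) →
        IntegrableOn (fun s => ψ s / ((s : ℂ) - a)) (Icc (-1 : ℝ) 1 \ B) := by
      intro a ha hd
      have i1 : IntegrableOn (fun s : ℝ => ψ a * (((s - a)⁻¹ : ℝ) : ℂ)) (Icc (-1 : ℝ) 1 \ B) :=
        ((integral_inv_sub_diff hl ha.1 ha.2 hu).1.ofReal).const_mul _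
      refine ((hd.mono_set sdiff_subset).add i1).congr (Eventually.of_forall fun s => ?_)
      simp only [ofReal_inv_sub, Pi.add_apply]
      ring
    rw [← integral_sub (ii σ ⟨by linarith, by linarith⟩ hdσ) (ii τ ⟨by linarith, by linarith⟩ hdτ)]
    refine (norm_integral_le_of_norm_le (hfar.const_mul h) ?_).trans ?_
    · filter_upwards [ae_restrict_mem hm] with s hs
      obtain ⟨n1, n2⟩ := hne' s hs
      have e : ψ s / ((s : ℂ) - σ) - ψ s / ((s : ℂ) - τ) =
          ((σ : ℂ) - τ) * (ψ s / (((s : ℂ) - σ) * ((s : ℂ) - τ))) := by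
        field_simp
        ring
      rw [e, norm_mul, norm_div, norm_mul, norm_ofReal_sub_ofReal, norm_ofReal_sub_ofReal,
        norm_ofReal_sub_ofReal]
    · rw [integral_const_mul]
      exact mul_le_mul_of_nonneg_left hK hpos.le
  have e : finHilbert ψ σ - finHilbert ψ τ =
      ((∫ s in N, (ψ s - ψ σ) / ((s : ℂ) - σ)) - ∫ s in N, (ψ s - ψ τ) / ((s : ℂ) - τ)) +
      ((∫ s in B \ N, (ψ s - ψ σ) * ((σ : ℂ) - τ) / (((s : ℂ) - σ) * ((s : ℂ) - τ))) -
        (ψ σ - ψ τ) * (Lr - Lh : ℝ)) - ψ τ * Lr +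
      ((∫ s in Icc (-1 : ℝ) 1 \ B, ψ s / ((s : ℂ) - σ)) -
        ∫ s in Icc (-1 : ℝ) 1 \ B, ψ s / ((s : ℂ) - τ)) := by
    rw [wσ, wτ, ← hB, split _ hdσ, split _ hdτ, ← mid]
    ring
  have n1 : ‖(ψ σ - ψ τ) * (Lr - Lh : ℝ)‖ ≤ (Q + Q) * h ^ b * 3 := by
    rw [norm_mul, norm_real, Real.norm_eq_abs]
    gcongr
    exact (abs_sub _ _).trans (by linarith)
  have n2 : ‖ψ τ * (Lr : ℂ)‖ ≤ 4 * h / r * ‖ψ τ‖ := by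
    rw [norm_mul, norm_real, Real.norm_eq_abs, mul_comm]
    gcongr
  rw [Real.mul_rpow (by norm_num) hpos.le] at nσ nτ
  rw [e]
  refine (norm_add_le _ _).trans (add_le_add ((norm_sub_le _ _).trans (add_le_add
    ((norm_add_le _ _).trans (add_le_add (norm_sub_le _ _) (norm_sub_le _ _))) n2)) far) |>.trans ?_
  have : (2 * 4 ^ b + (4 * (p - 1)) ^ b + 6) * (Q * h ^ b) =
      (Q * (4 ^ b * h ^ b) + Q * (4 ^ b * h ^ b)) + (Q * ((4 * (p - 1)) ^ b * h ^ b) +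
        (Q + Q) * h ^ b * 3) := by ring
  rw [this]
  linarith

theorem rpow_le_of_comparable {x y c : ℝ} (hx : 0 < x) (hy : 0 < y) (hc : 1 ≤ c)
    (h1 : y ≤ c * x) (h2 : x ≤ c * y) (e : ℝ) : y ^ e ≤ c ^ |e| * x ^ e := by
  have hc0 : 0 < c := by linarith
  rcases le_total 0 e with he | he
  · rw [abs_of_nonneg he, ← Real.mul_rpow hc0.le hx.le]
    exact Real.rpow_le_rpow hy.le h1 he
  · have h3 : x / c ≤ y := by rwa [div_le_iff₀' hc0]
    refine (Real.rpow_le_rpow_of_nonpos (div_pos hx hc0) h3 he).trans (le_of_eq ?_)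
    rw [abs_of_nonpos he, Real.div_rpow hx.le hc0.le, Real.rpow_neg hc0.le, div_eq_inv_mul]

theorem add_rpow_le_two_rpow_mul {a b p : ℝ} (ha : 0 ≤ a) (hb : 0 ≤ b) (hp : 0 ≤ p) :
    (a + b) ^ p ≤ 2 ^ p * (a ^ p + b ^ p) := by
  rw [mul_add, ← Real.mul_rpow zero_le_two ha, ← Real.mul_rpow zero_le_two hb]
  have h1 : 0 ≤ (2 * a) ^ p := by positivity
  have h2 : 0 ≤ (2 * b) ^ p := by positivity
  rcases le_total a b with h | h
  · exact (Real.rpow_le_rpow (by positivity) (by linarith : a + b ≤ 2 * b) hp).trans (by linarith)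
  · exact (Real.rpow_le_rpow (by positivity) (by linarith : a + b ≤ 2 * a) hp).trans (by linarith)

theorem abs_endpoint_dist_sub_le (s σ : ℝ) : |(1 - |s|) - (1 - |σ|)| ≤ |s - σ| := by
  rw [sub_sub_sub_cancel_left, abs_sub_comm s σ]
  exact abs_abs_sub_abs_le σ s

/-- A Hölder function `v`, a weight `ω` behaving like the power `κ` of the distance to the
endpoints of `[-1,1]`, and a function `ψ` behaving like the quotient `v / ω`. -/
structure WeightedQuotient (v ψ : ℝ → ℂ) (ω : ℝ → ℝ) (α κ M : ℝ) : Prop where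
  measurable_v : Measurable v
  measurable_ψ : Measurable ψ
  α_pos : 0 < α
  α_lt_one : α < 1
  α_lt : α < κ
  lt_α : κ < α + 1
  M_nonneg : 0 ≤ M
  v_sub : ∀ s ∈ Icc (-1 : ℝ) 1, ∀ σ ∈ Icc (-1 : ℝ) 1, ‖v s - v σ‖ ≤ M * |s - σ| ^ α
  ψ_le : ∀ s ∈ Ioo (-1 : ℝ) 1, ‖ψ s‖ ≤ M * (1 - |s|) ^ (α - κ)
  ψ_sub : ∀ σ ∈ Ioo (-1 : ℝ) 1, ∀ s, |s - σ| ≤ (1 - |σ|) / 2 →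
    ‖ψ s - ψ σ‖ ≤ M * (1 - |σ|) ^ (-κ) * (‖v s - v σ‖ + (1 - |σ|) ^ (α - 1) * |s - σ|)
  ω_nonneg : ∀ s, 0 ≤ ω s
  ω_le : ∀ σ ∈ Ioo (-1 : ℝ) 1, ω σ ≤ M * (1 - |σ|) ^ κ
  ω_sub : ∀ σ ∈ Ioo (-1 : ℝ) 1, ∀ s, |s - σ| ≤ (1 - |σ|) / 2 →
    |ω s - ω σ| ≤ M * (1 - |σ|) ^ (κ - 1) * |s - σ|

namespace WeightedQuotient

variable {v ψ : ℝ → ℂ} {ω : ℝ → ℝ} {α κ M : ℝ}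

theorem integrableOn_ψ (H : WeightedQuotient v ψ ω α κ M) : IntegrableOn ψ (Icc (-1 : ℝ) 1) := by
  have h := (integrableOn_endpoint_weight (e := κ - α) (by linarith [H.lt_α])).const_mul M
  refine Integrable.mono' h H.measurable_ψ.aestronglyMeasurable ?_
  filter_upwards [ae_mem_Ioo] with s hs
  rw [neg_sub]
  exact H.ψ_le s hs

theorem mem_Icc_of_abs_sub_le {σ s : ℝ} (hσ : σ ∈ Ioo (-1 : ℝ) 1)
    (h : |s - σ| ≤ (1 - |σ|) / 2) : s ∈ Icc (-1 : ℝ) 1 := by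
  have h1 := abs_endpoint_dist_sub_le s σ
  have h2 := (abs_le.mp h1).1
  have h3 := one_sub_abs_pos hσ
  exact abs_le.mp (by linarith)

theorem norm_ψ_sub_le (H : WeightedQuotient v ψ ω α κ M) {σ s : ℝ} (hσ : σ ∈ Ioo (-1 : ℝ) 1)
    (h : |s - σ| ≤ (1 - |σ|) / 2) :
    ‖ψ s - ψ σ‖ ≤ M * (1 - |σ|) ^ (-κ) * (M + 1) * |s - σ| ^ α := by
  have hx := one_sub_abs_pos hσ
  have hM := H.M_nonneg
  refine (H.ψ_sub σ hσ s h).trans ?_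
  rw [mul_assoc _ (M + 1), add_mul, one_mul]
  gcongr
  · exact H.v_sub s (mem_Icc_of_abs_sub_le hσ h) σ (Ioo_subset_Icc_self hσ)
  · rcases eq_or_ne s σ with rfl | hne
    · simp only [sub_self, abs_zero, mul_zero]; positivity
    · have hp : 0 < |s - σ| := abs_pos.mpr (sub_ne_zero.mpr hne)
      calc (1 - |σ|) ^ (α - 1) * |s - σ| ≤ |s - σ| ^ (α - 1) * |s - σ| := by
            gcongr ?_ * _
            exact Real.rpow_le_rpow_of_nonpos hp (by linarith) (by linarith [H.α_lt_one])
        _ = |s - σ| ^ α := by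
            rw [← Real.rpow_add_one hp.ne', sub_add_cancel]

theorem integrableOn_sub_div_ψ (H : WeightedQuotient v ψ ω α κ M) {σ : ℝ}
    (hσ : σ ∈ Ioo (-1 : ℝ) 1) :
    IntegrableOn (fun s => (ψ s - ψ σ) / ((s : ℂ) - σ)) (Icc (-1 : ℝ) 1) :=
  integrableOn_sub_div H.integrableOn_ψ (half_pos (one_sub_abs_pos hσ)) H.α_pos
    fun _ _ h => H.norm_ψ_sub_le hσ h.le

theorem quarter_window {σ : ℝ} (hσ : σ ∈ Ioo (-1 : ℝ) 1) :
    -1 ≤ σ - (1 - |σ|) / 4 ∧ σ + (1 - |σ|) / 4 ≤ 1 := by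
  have hx := one_sub_abs_pos hσ
  constructor <;> linarith [neg_abs_le σ, le_abs_self σ]

theorem norm_ψ_div_far_le (H : WeightedQuotient v ψ ω α κ M) {σ : ℝ} (hσ : σ ∈ Ioo (-1 : ℝ) 1) :
    ∀ᵐ s ∂(volume.restrict (Icc (-1 : ℝ) 1 \
      Ioo (σ - (1 - |σ|) / 4) (σ + (1 - |σ|) / 4))),
      (1 - |σ|) / 4 ≤ |s - σ| ∧ ‖ψ s‖ / |s - σ| ≤
        9 * M * ((1 - |s|) ^ (-(κ - α)) / ((1 - |σ|) + (1 - |s|))) := by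
  have hx := one_sub_abs_pos hσ
  filter_upwards [ae_restrict_of_ae_restrict_of_subset sdiff_subset ae_mem_Ioo,
    ae_restrict_mem (measurableSet_Icc.diff measurableSet_Ioo)] with s hs hsB
  have hfar : (1 - |σ|) / 4 ≤ |s - σ| := by
    by_contra! h
    rw [abs_lt] at h
    exact hsB.2 ⟨by linarith, by linarith⟩
  refine ⟨hfar, ?_⟩
  have hxs := one_sub_abs_pos hs
  have h1 := (abs_le.mp (abs_endpoint_dist_sub_le s σ)).2
  rw [neg_sub]
  have hM := H.M_nonneg
  calc ‖ψ s‖ / |s - σ| ≤ M * (1 - |s|) ^ (α - κ) / (((1 - |σ|) + (1 - |s|)) / 9) := by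
        gcongr
        · exact H.ψ_le s hs
        · linarith
    _ = _ := by field_simp

/-- The finite Hilbert transform inherits the growth of `ψ` at the endpoints. -/
theorem exists_norm_finHilbert_le (H : WeightedQuotient v ψ ω α κ M) :
    ∃ C, 0 ≤ C ∧ ∀ σ ∈ Ioo (-1 : ℝ) 1, ‖finHilbert ψ σ‖ ≤ C * (1 - |σ|) ^ (α - κ) := by
  have hM := H.M_nonneg
  have hα := H.α_pos
  have he0 : 0 < κ - α := by linarith [H.α_lt]
  have he1 : κ - α < 1 := by linarith [H.lt_α]
  have he1' : 0 < 1 - (κ - α) := by linarith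
  set K := 4 / (1 - (κ - α)) + 4 / (κ - α) with hK
  have hK0 : 0 ≤ K := by positivity
  refine ⟨M * (M + 1) * (2 / α) + 9 * M * K, by positivity, fun σ hσ => ?_⟩
  have hx := one_sub_abs_pos hσ
  obtain ⟨hl, hu⟩ := quarter_window hσ
  set x := 1 - |σ| with hxd
  have w := finHilbert_eq_window (H.integrableOn_sub_div_ψ hσ) hl (by linarith : σ - x / 4 < σ)
    (by linarith : σ < σ + x / 4) hu
  rw [add_sub_cancel_left, sub_sub_cancel, div_self (by linarith), Real.log_one, ofReal_zero,
    mul_zero, add_zero] at w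
  have near : ‖∫ s in Ioo (σ - x / 4) (σ + x / 4), (ψ s - ψ σ) / ((s : ℂ) - σ)‖ ≤
      M * (M + 1) * (2 / α) * x ^ (α - κ) := by
    obtain ⟨i1, b1⟩ := integrableOn_abs_sub_rpow_near (β := α - 1) (R := x / 4) (by linarith)
      (by positivity) σ
    have hset : Ioo (σ - x / 4) (σ + x / 4) = {s | |s - σ| < x / 4} := by
      ext s
      rw [mem_ofPred_eq, abs_lt, mem_Ioo]
      constructor <;> rintro ⟨h1, h2⟩ <;> constructor <;> linarith
    rw [hset]
    refine (norm_integral_le_of_norm_le (i1.const_mul (M * x ^ (-κ) * (M + 1))) ?_).trans ?_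
    · filter_upwards [ae_restrict_mem (measurableSet_lt (by fun_prop) measurable_const)] with s hs
      rw [norm_div, norm_ofReal_sub_ofReal]
      rcases eq_or_ne s σ with rfl | hne
      · simp only [sub_self, norm_zero, zero_div]; positivity
      · have hp : 0 < |s - σ| := abs_pos.mpr (sub_ne_zero.mpr hne)
        rw [div_le_iff₀ hp, mul_assoc, ← Real.rpow_add_one hp.ne', sub_add_cancel]
        exact H.norm_ψ_sub_le hσ (by linarith)
    · rw [integral_const_mul]
      rw [sub_add_cancel] at b1
      calc _ ≤ M * x ^ (-κ) * (M + 1) * (2 / α * x ^ α) := by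
            gcongr
            refine b1.trans ?_
            gcongr
            linarith
        _ = _ := by
            rw [sub_eq_neg_add α, Real.rpow_add hx]
            ring
  have far : ‖∫ s in Icc (-1 : ℝ) 1 \ Ioo (σ - x / 4) (σ + x / 4), ψ s / ((s : ℂ) - σ)‖ ≤
      9 * M * K * x ^ (α - κ) := by
    obtain ⟨i1, b1⟩ := setIntegral_endpoint_weight_div_le he0 he1 hx
    refine (norm_integral_le_of_norm_le ((i1.mono_set sdiff_subset).const_mul (9 * M)) ?_).trans ?_
    · filter_upwards [H.norm_ψ_div_far_le hσ] with s hs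
      rw [norm_div, norm_ofReal_sub_ofReal]
      exact hs.2
    · rw [integral_const_mul, mul_assoc (9 * M)]
      gcongr
      rw [neg_sub] at b1
      refine le_trans (setIntegral_mono_set i1 ?_ sdiff_subset.eventuallyLE) (by simpa using b1)
      filter_upwards [ae_mem_Ioo] with s hs
      have := one_sub_abs_pos hs
      exact div_nonneg (Real.rpow_nonneg this.le _) (by linarith)
  rw [w, add_mul]
  exact (norm_add_le _ _).trans (add_le_add near far)

/-- `L^p` bound for difference quotients of `ψ` in a window away from the endpoints. -/
theorem lintegral_diffquot_le (H : WeightedQuotient v ψ ω α κ M) {p : ℝ} (hp : 2 < p)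
    {a Q : ℝ} (ha : a ∈ Ioo (-1 : ℝ) 1) (hQ : 0 ≤ Q)
    (hG : gagliardo p v a ≤ ENNReal.ofReal (Q ^ p)) {E : Set ℝ} (hE : MeasurableSet E)
    (hEa : ∀ s ∈ E, |s - a| ≤ (1 - |a|) / 2) (hEv : volume E ≤ ENNReal.ofReal (1 - |a|)) :
    ∫⁻ s in E, ENNReal.ofReal ((‖ψ s - ψ a‖ / |s - a|) ^ p) ≤
      ENNReal.ofReal ((2 * M * (1 - |a|) ^ (-κ) * (Q + (1 - |a|) ^ (α - 1 + 1 / p))) ^ p) := by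
  have hM := H.M_nonneg
  have hx := one_sub_abs_pos ha
  set x := 1 - |a| with hxd
  have hp0 : 0 < p := by linarith
  have hpt : ∀ s ∈ E, ENNReal.ofReal ((‖ψ s - ψ a‖ / |s - a|) ^ p) ≤
      ENNReal.ofReal ((2 * M * x ^ (-κ)) ^ p) *
        (ENNReal.ofReal ((‖v s - v a‖ / |s - a|) ^ p) + ENNReal.ofReal ((x ^ (α - 1)) ^ p)) := by
    intro s hs
    rw [← ENNReal.ofReal_add (by positivity) (by positivity), ← ENNReal.ofReal_mul (by positivity)]
    apply ENNReal.ofReal_le_ofReal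
    have h1 : ‖ψ s - ψ a‖ / |s - a| ≤ M * x ^ (-κ) * (‖v s - v a‖ / |s - a| + x ^ (α - 1)) := by
      rcases eq_or_ne s a with rfl | hne
      · simp only [sub_self, norm_zero, zero_div, zero_add]; positivity
      · have hsp : 0 < |s - a| := abs_pos.mpr (sub_ne_zero.mpr hne)
        rw [div_le_iff₀ hsp]
        refine (H.ψ_sub a ha s (hEa s hs)).trans (le_of_eq ?_)
        rw [← hxd]
        field_simp
    calc (‖ψ s - ψ a‖ / |s - a|) ^ p
        ≤ (M * x ^ (-κ) * (‖v s - v a‖ / |s - a| + x ^ (α - 1))) ^ p := by gcongr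
      _ = (M * x ^ (-κ)) ^ p * (‖v s - v a‖ / |s - a| + x ^ (α - 1)) ^ p :=
          Real.mul_rpow (by positivity) (by positivity)
      _ ≤ (M * x ^ (-κ)) ^ p * (2 ^ p * ((‖v s - v a‖ / |s - a|) ^ p + (x ^ (α - 1)) ^ p)) := by
          gcongr
          exact add_rpow_le_two_rpow_mul (by positivity) (by positivity) hp0.le
      _ = _ := by
          rw [show 2 * M * x ^ (-κ) = 2 * (M * x ^ (-κ)) by ring,
            Real.mul_rpow zero_le_two (by positivity)]
          ring
  have hEI : E ⊆ Icc (-1 : ℝ) 1 := fun s hs => mem_Icc_of_abs_sub_le ha (hEa s hs)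
  refine (setLIntegral_mono' hE hpt).trans ?_
  have hmv : Measurable fun s => ENNReal.ofReal ((‖v s - v a‖ / |s - a|) ^ p) :=
    (((H.measurable_v.sub_const _).norm.div (by fun_prop)).pow_const p).ennreal_ofReal
  rw [lintegral_const_mul _ (by fun_prop), lintegral_add_left hmv, setLIntegral_const]
  have h2 : ENNReal.ofReal ((x ^ (α - 1)) ^ p) * volume E ≤
      ENNReal.ofReal ((x ^ (α - 1 + 1 / p)) ^ p) := by
    refine (mul_le_mul_right hEv _).trans ?_
    rw [← ENNReal.ofReal_mul (by positivity)]
    apply ENNReal.ofReal_le_ofReal (le_of_eq _)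
    rw [← Real.rpow_mul hx.le, ← Real.rpow_mul hx.le, ← Real.rpow_add_one hx.ne']
    congr 1
    field_simp
  calc _ ≤ ENNReal.ofReal ((2 * M * x ^ (-κ)) ^ p) * (ENNReal.ofReal (Q ^ p) +
        ENNReal.ofReal ((x ^ (α - 1 + 1 / p)) ^ p)) := by
        gcongr
        exact (lintegral_mono_set hEI).trans hG
    _ ≤ _ := by
        rw [← ENNReal.ofReal_add (by positivity) (by positivity),
          ← ENNReal.ofReal_mul (by positivity), Real.mul_rpow (x := 2 * M * x ^ (-κ))
          (by positivity) (by positivity)]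
        apply ENNReal.ofReal_le_ofReal
        gcongr
        exact Real.add_rpow_le_rpow_add hQ (by positivity) (by linarith)

end WeightedQuotient

theorem mul_rpow_sub_one_le {h x α p : ℝ} (hp : 0 < p) (hh : 0 ≤ h) (hx : 0 < x) (hhx : h ≤ x) :
    h * x ^ (α - 1) ≤ h ^ (1 - 1 / p) * x ^ (α - 1 + 1 / p) := by
  rcases hh.eq_or_lt with rfl | hh
  · rw [zero_mul]; positivity
  · calc h * x ^ (α - 1) = h ^ (1 - 1 / p) * (h ^ (1 / p) * x ^ (α - 1)) := by
          rw [← mul_assoc, ← Real.rpow_add hh, sub_add_cancel, Real.rpow_one]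
      _ ≤ h ^ (1 - 1 / p) * (x ^ (1 / p) * x ^ (α - 1)) := by gcongr
      _ = _ := by rw [← Real.rpow_add hx, add_comm (1 / p)]

theorem rpow_le_mul_of_le_mul {h x c α p : ℝ} (hp : 1 ≤ p) (hh : 0 ≤ h) (hx : 0 < x) (hc : 1 ≤ c)
    (hxh : x ≤ c * h) : x ^ α ≤ c * (h ^ (1 - 1 / p) * x ^ (α - 1 + 1 / p)) := by
  have hp1 : 1 / p ≤ 1 := by rw [div_le_one (by linarith)]; exact hp
  have hp2 : 0 ≤ 1 / p := by positivity
  calc x ^ α = x ^ (1 - 1 / p) * x ^ (α - 1 + 1 / p) := by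
        rw [← Real.rpow_add hx]; congr 1; ring
    _ ≤ (c * h) ^ (1 - 1 / p) * x ^ (α - 1 + 1 / p) := by
        gcongr
    _ = c ^ (1 - 1 / p) * h ^ (1 - 1 / p) * x ^ (α - 1 + 1 / p) := by
        rw [Real.mul_rpow (by linarith) hh]
    _ ≤ c ^ (1 : ℝ) * h ^ (1 - 1 / p) * x ^ (α - 1 + 1 / p) := by
        gcongr
        linarith
    _ = _ := by rw [Real.rpow_one, mul_assoc]

namespace WeightedQuotient

variable {v ψ : ℝ → ℂ} {ω : ℝ → ℝ} {α κ M : ℝ}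

theorem integrableOn_far (H : WeightedQuotient v ψ ω α κ M) {σ τ : ℝ} (hσ : σ ∈ Ioo (-1 : ℝ) 1)
    (hh : |σ - τ| ≤ (1 - |σ|) / 16) :
    IntegrableOn (fun s => ‖ψ s‖ / (|s - σ| * |s - τ|))
      (Icc (-1 : ℝ) 1 \ Ioo (σ - (1 - |σ|) / 4) (σ + (1 - |σ|) / 4)) ∧
    ∫ s in Icc (-1 : ℝ) 1 \ Ioo (σ - (1 - |σ|) / 4) (σ + (1 - |σ|) / 4),
      ‖ψ s‖ / (|s - σ| * |s - τ|) ≤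
        48 * M / (1 - |σ|) * ((4 / (1 - (κ - α)) + 4 / (κ - α)) * (1 - |σ|) ^ (α - κ)) := by
  have hx := one_sub_abs_pos hσ
  have hM := H.M_nonneg
  obtain ⟨i1, b1⟩ := setIntegral_endpoint_weight_div_le (e := κ - α) (by linarith [H.α_lt])
    (by linarith [H.lt_α]) hx
  have i2 := (i1.mono_set (sdiff_subset (t := Ioo (σ - (1 - |σ|) / 4) (σ + (1 - |σ|) / 4)))).const_mul
    (48 * M / (1 - |σ|))
  have hpt : ∀ᵐ s ∂(volume.restrict (Icc (-1 : ℝ) 1 \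
      Ioo (σ - (1 - |σ|) / 4) (σ + (1 - |σ|) / 4))), ‖‖ψ s‖ / (|s - σ| * |s - τ|)‖ ≤
        48 * M / (1 - |σ|) * ((1 - |s|) ^ (-(κ - α)) / ((1 - |σ|) + (1 - |s|))) := by
    filter_upwards [H.norm_ψ_div_far_le hσ] with s hs
    obtain ⟨h1, h2⟩ := hs
    have h3 : 3 * (1 - |σ|) / 16 ≤ |s - τ| := by
      have := abs_sub_le s τ σ
      rw [abs_sub_comm τ σ] at this
      linarith
    rw [Real.norm_of_nonneg (by positivity), ← div_div]
    refine (div_le_div₀ ((by positivity : (0 : ℝ) ≤ _).trans h2) h2 (by positivity) h3).trans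
      (le_of_eq ?_)
    field_simp
    ring
  have hm : Measurable fun s => ‖ψ s‖ / (|s - σ| * |s - τ|) := by
    have := H.measurable_ψ
    fun_prop
  have i3 : IntegrableOn (fun s => ‖ψ s‖ / (|s - σ| * |s - τ|))
      (Icc (-1 : ℝ) 1 \ Ioo (σ - (1 - |σ|) / 4) (σ + (1 - |σ|) / 4)) :=
    Integrable.mono' i2 hm.aestronglyMeasurable hpt
  refine ⟨i3, ?_⟩
  refine (integral_mono_ae i3 i2 (hpt.mono fun s hs => (Real.le_norm_self _).trans hs)).trans ?_
  rw [integral_const_mul]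
  gcongr
  refine (setIntegral_mono_set i1 ?_ (ae_of_all _ sdiff_subset)).trans (b1.trans (le_of_eq ?_))
  · filter_upwards [ae_mem_Ioo] with s hs
    have := one_sub_abs_pos hs
    simp only [Pi.zero_apply]
    positivity
  · rw [neg_sub]

theorem norm_mul_finHilbert_le (H : WeightedQuotient v ψ ω α κ M) {C : ℝ}
    (hC : ∀ σ ∈ Ioo (-1 : ℝ) 1, ‖finHilbert ψ σ‖ ≤ C * (1 - |σ|) ^ (α - κ))
    {σ : ℝ} (hσ : σ ∈ Ioo (-1 : ℝ) 1) :
    ‖(ω σ : ℂ) * finHilbert ψ σ‖ ≤ M * C * (1 - |σ|) ^ α := by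
  have hx := one_sub_abs_pos hσ
  have hM := H.M_nonneg
  rw [norm_mul, Complex.norm_real, Real.norm_of_nonneg (H.ω_nonneg σ)]
  refine (mul_le_mul (H.ω_le σ hσ) (hC σ hσ) (norm_nonneg _) (by positivity)).trans (le_of_eq ?_)
  rw [show M * (1 - |σ|) ^ κ * (C * (1 - |σ|) ^ (α - κ)) =
    M * C * ((1 - |σ|) ^ κ * (1 - |σ|) ^ (α - κ)) by ring, ← Real.rpow_add hx,
    add_sub_cancel]

theorem norm_mul_finHilbert_sub_le_far (H : WeightedQuotient v ψ ω α κ M) {C p : ℝ} (hp : 2 < p)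
    (hC0 : 0 ≤ C) (hC : ∀ σ ∈ Ioo (-1 : ℝ) 1, ‖finHilbert ψ σ‖ ≤ C * (1 - |σ|) ^ (α - κ))
    {σ τ : ℝ} (hσ : σ ∈ Ioo (-1 : ℝ) 1) (hτ : τ ∈ Ioo (-1 : ℝ) 1)
    (hh : (1 - |σ|) / 16 ≤ |σ - τ|) :
    ‖(ω σ : ℂ) * finHilbert ψ σ - (ω τ : ℂ) * finHilbert ψ τ‖ ≤
      17 * M * C * (((1 - |σ|) ^ (α - 1 + 1 / p) + (1 - |τ|) ^ (α - 1 + 1 / p)) *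
        |σ - τ| ^ (1 - 1 / p)) := by
  have hx := one_sub_abs_pos hσ
  have hy := one_sub_abs_pos hτ
  have hM := H.M_nonneg
  have h1 := (abs_le.mp (abs_endpoint_dist_sub_le σ τ)).1
  have hp1 : 1 ≤ p := by linarith
  have e1 := rpow_le_mul_of_le_mul (α := α) (c := 17) hp1 (abs_nonneg (σ - τ)) hx (by norm_num)
    (by linarith)
  have e2 := rpow_le_mul_of_le_mul (α := α) (c := 17) hp1 (abs_nonneg (σ - τ)) hy (by norm_num)
    (by linarith)
  refine (norm_sub_le _ _).trans ((add_le_add (H.norm_mul_finHilbert_le hC hσ)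
    (H.norm_mul_finHilbert_le hC hτ)).trans ?_)
  have e3 := mul_le_mul_of_nonneg_left (add_le_add e1 e2) (mul_nonneg hM hC0)
  refine le_trans (le_of_eq (by ring)) (e3.trans (le_of_eq (by ring)))

theorem norm_mul_finHilbert_sub_le_near (H : WeightedQuotient v ψ ω α κ M) {C p : ℝ} (hp : 2 < p)
    (hC0 : 0 ≤ C) (hC : ∀ σ ∈ Ioo (-1 : ℝ) 1, ‖finHilbert ψ σ‖ ≤ C * (1 - |σ|) ^ (α - κ))
    {σ τ Qσ Qτ : ℝ} (hσ : σ ∈ Ioo (-1 : ℝ) 1) (hτ : τ ∈ Ioo (-1 : ℝ) 1) (hne : σ ≠ τ)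
    (hh : |σ - τ| ≤ (1 - |σ|) / 16) (hQσ : 0 ≤ Qσ) (hQτ : 0 ≤ Qτ)
    (hGσ : gagliardo p v σ ≤ ENNReal.ofReal (Qσ ^ p))
    (hGτ : gagliardo p v τ ≤ ENNReal.ofReal (Qτ ^ p)) :
    ‖(ω σ : ℂ) * finHilbert ψ σ - (ω τ : ℂ) * finHilbert ψ τ‖ ≤
      ((2 * 4 ^ (1 - 1 / p) + (4 * (p - 1)) ^ (1 - 1 / p) + 6) * (2 * M ^ 2 * 2 ^ |-κ|) +
        16 * M ^ 2 * 2 ^ |α - κ| + 48 * M ^ 2 * (4 / (1 - (κ - α)) + 4 / (κ - α)) +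
        M * C * 2 ^ |α - κ|) *
      ((Qσ + (1 - |σ|) ^ (α - 1 + 1 / p) + Qτ + (1 - |τ|) ^ (α - 1 + 1 / p)) *
        |σ - τ| ^ (1 - 1 / p)) := by
  have hx := one_sub_abs_pos hσ
  have hy := one_sub_abs_pos hτ
  have hM := H.M_nonneg
  have hd := abs_le.mp (abs_endpoint_dist_sub_le σ τ)
  have hcmp : ∀ e : ℝ, (1 - |τ|) ^ e ≤ 2 ^ |e| * (1 - |σ|) ^ e :=
    rpow_le_of_comparable hx hy one_le_two (by linarith) (by linarith)
  have hwin := quarter_window hσ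
  obtain ⟨hfar, hK⟩ := H.integrableOn_far hσ hh
  have hvol : volume (Ioo (σ - (1 - |σ|) / 4) (σ + (1 - |σ|) / 4)) =
      ENNReal.ofReal ((1 - |σ|) / 2) := by
    rw [Real.volume_Ioo]; congr 1; ring
  have wσ : ∀ s ∈ Ioo (σ - (1 - |σ|) / 4) (σ + (1 - |σ|) / 4), |s - σ| < (1 - |σ|) / 4 := by
    intro s hs
    rw [abs_lt]
    constructor <;> linarith [hs.1, hs.2]
  have lσ := H.lintegral_diffquot_le hp hσ hQσ hGσ measurableSet_Ioo
    (fun s hs => by linarith [wσ s hs])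
    (by rw [hvol]; exact ENNReal.ofReal_le_ofReal (by linarith))
  have lτ := H.lintegral_diffquot_le hp hτ hQτ hGτ
    (measurableSet_Ioo (a := σ - (1 - |σ|) / 4) (b := σ + (1 - |σ|) / 4))
    (fun s hs => by linarith [wσ s hs, abs_sub_le s σ τ])
    (by rw [hvol]; exact ENNReal.ofReal_le_ofReal (by linarith))
  have hκ2 : (1 : ℝ) ≤ 2 ^ |-κ| := Real.one_le_rpow one_le_two (abs_nonneg _)
  have hBC : 0 < 4 / (1 - (κ - α)) + 4 / (κ - α) := by
    have h1 : 0 < 1 - (κ - α) := by linarith [H.lt_α]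
    have h2 : 0 < κ - α := by linarith [H.α_lt]
    positivity
  set x := 1 - |σ|
  set y := 1 - |τ|
  set h := |σ - τ|
  set T := Qσ + x ^ (α - 1 + 1 / p) + Qτ + y ^ (α - 1 + 1 / p) with hT
  have hT0 : 0 ≤ T := by positivity
  set Q := 2 * M * 2 ^ |-κ| * x ^ (-κ) * T with hQ
  have leσ : 2 * M * x ^ (-κ) * (Qσ + x ^ (α - 1 + 1 / p)) ≤ Q := by
    have : Qσ + x ^ (α - 1 + 1 / p) ≤ T := by
      have : 0 ≤ y ^ (α - 1 + 1 / p) := by positivity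
      linarith
    calc _ = 2 * M * 1 * x ^ (-κ) * (Qσ + x ^ (α - 1 + 1 / p)) := by ring
      _ ≤ Q := by rw [hQ]; gcongr
  have leτ : 2 * M * y ^ (-κ) * (Qτ + y ^ (α - 1 + 1 / p)) ≤ Q := by
    have : Qτ + y ^ (α - 1 + 1 / p) ≤ T := by
      have : 0 ≤ x ^ (α - 1 + 1 / p) := by positivity
      linarith
    calc _ ≤ 2 * M * (2 ^ |-κ| * x ^ (-κ)) * T := by
          gcongr
          exact hcmp _
      _ = Q := by rw [hQ]; ring
  have hp0 : 0 < p := by linarith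
  have main := norm_finHilbert_sub_le_local hp H.measurable_ψ (r := x / 4) (Q := Q)
    (by positivity) hne (by linarith) hwin.1 hwin.2
    (lσ.trans (ENNReal.ofReal_le_ofReal (Real.rpow_le_rpow (by positivity) leσ hp0.le)))
    (lτ.trans (ENNReal.ofReal_le_ofReal (Real.rpow_le_rpow (by positivity) leτ hp0.le)))
    (H.integrableOn_sub_div_ψ hσ) (H.integrableOn_sub_div_ψ hτ) hfar hK
  set cp : ℝ := 2 * 4 ^ (1 - 1 / p) + (4 * (p - 1)) ^ (1 - 1 / p) + 6 with hcp
  have hcp0 : 0 ≤ cp := by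
    have : 0 < p - 1 := by linarith
    positivity
  have hh0 : 0 ≤ h := abs_nonneg _
  have hP : h * x ^ (α - 1) ≤ T * h ^ (1 - 1 / p) := by
    refine (mul_rpow_sub_one_le hp0 hh0 hx (by linarith)).trans ?_
    rw [mul_comm]
    gcongr
    have : 0 ≤ y ^ (α - 1 + 1 / p) := by positivity
    linarith
  have a1 : x ^ κ * x ^ (-κ) = 1 := by rw [← Real.rpow_add hx, add_neg_cancel, Real.rpow_zero]
  have a2 : x ^ κ * x ^ (α - κ) = x * x ^ (α - 1) := by
    rw [← Real.rpow_add hx, mul_comm x, ← Real.rpow_add_one hx.ne']; congr 1; ring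
  have a3 : x ^ (κ - 1) * x ^ (α - κ) = x ^ (α - 1) := by
    rw [← Real.rpow_add hx]; congr 1; ring
  have hωs : |ω σ - ω τ| ≤ M * x ^ (κ - 1) * h := by
    rw [abs_sub_comm]
    have := H.ω_sub σ hσ τ (by rw [abs_sub_comm]; linarith)
    rwa [abs_sub_comm τ σ] at this
  have hψτ : ‖ψ τ‖ ≤ M * (2 ^ |α - κ| * x ^ (α - κ)) :=
    (H.ψ_le τ hτ).trans (by gcongr; exact hcmp _)
  have hFτ : ‖finHilbert ψ τ‖ ≤ C * (2 ^ |α - κ| * x ^ (α - κ)) :=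
    (hC τ hτ).trans (by gcongr; exact hcmp _)
  have split : (ω σ : ℂ) * finHilbert ψ σ - (ω τ : ℂ) * finHilbert ψ τ =
      (ω σ : ℂ) * (finHilbert ψ σ - finHilbert ψ τ) + ((ω σ - ω τ : ℝ) : ℂ) * finHilbert ψ τ := by
    push_cast; ring
  rw [split]
  refine (norm_add_le _ _).trans ?_
  rw [norm_mul, norm_mul, Complex.norm_real, Complex.norm_real,
    Real.norm_of_nonneg (H.ω_nonneg σ), Real.norm_eq_abs]
  calc _ ≤ M * x ^ κ * (cp * (Q * h ^ (1 - 1 / p)) +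
          4 * h / (x / 4) * (M * (2 ^ |α - κ| * x ^ (α - κ))) +
          h * (48 * M / x * ((4 / (1 - (κ - α)) + 4 / (κ - α)) * x ^ (α - κ)))) +
        M * x ^ (κ - 1) * h * (C * (2 ^ |α - κ| * x ^ (α - κ))) := by
        gcongr
        · exact H.ω_le σ hσ
        · refine main.trans ?_
          gcongr
    _ = cp * (2 * M ^ 2 * 2 ^ |-κ|) * (x ^ κ * x ^ (-κ)) * (T * h ^ (1 - 1 / p)) +
        (16 * M ^ 2 * 2 ^ |α - κ| + 48 * M ^ 2 * (4 / (1 - (κ - α)) + 4 / (κ - α))) *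
          (h * (x ^ κ * x ^ (α - κ)) / x) +
        M * C * 2 ^ |α - κ| * (h * (x ^ (κ - 1) * x ^ (α - κ))) := by
        rw [hQ]
        generalize 4 / (1 - (κ - α)) + 4 / (κ - α) = B
        field_simp
        ring
    _ = cp * (2 * M ^ 2 * 2 ^ |-κ|) * (T * h ^ (1 - 1 / p)) +
        (16 * M ^ 2 * 2 ^ |α - κ| + 48 * M ^ 2 * (4 / (1 - (κ - α)) + 4 / (κ - α))) *
          (h * x ^ (α - 1)) + M * C * 2 ^ |α - κ| * (h * x ^ (α - 1)) := by
        rw [a1, a2, a3, mul_one, mul_left_comm h x, mul_div_cancel_left₀ _ hx.ne']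
    _ ≤ cp * (2 * M ^ 2 * 2 ^ |-κ|) * (T * h ^ (1 - 1 / p)) +
        (16 * M ^ 2 * 2 ^ |α - κ| + 48 * M ^ 2 * (4 / (1 - (κ - α)) + 4 / (κ - α))) *
          (T * h ^ (1 - 1 / p)) + M * C * 2 ^ |α - κ| * (T * h ^ (1 - 1 / p)) := by
        gcongr
    _ = _ := by ring

/-- The weighted finite Hilbert transform has a Hajłasz-type gradient controlled by the Gagliardo
function of `v` and a power of the distance to the endpoints. -/
theorem exists_norm_mul_finHilbert_sub_le (H : WeightedQuotient v ψ ω α κ M) {p : ℝ}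
    (hp : 2 < p) : ∃ C, 0 ≤ C ∧ ∀ σ ∈ Ioo (-1 : ℝ) 1, ∀ τ ∈ Ioo (-1 : ℝ) 1, ∀ Qσ Qτ : ℝ,
      0 ≤ Qσ → 0 ≤ Qτ → gagliardo p v σ ≤ ENNReal.ofReal (Qσ ^ p) →
      gagliardo p v τ ≤ ENNReal.ofReal (Qτ ^ p) →
      ‖(ω σ : ℂ) * finHilbert ψ σ - (ω τ : ℂ) * finHilbert ψ τ‖ ≤
        C * ((Qσ + (1 - |σ|) ^ (α - 1 + 1 / p) + Qτ + (1 - |τ|) ^ (α - 1 + 1 / p)) *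
          |σ - τ| ^ (1 - 1 / p)) := by
  obtain ⟨C, hC0, hC⟩ := H.exists_norm_finHilbert_le
  have hM := H.M_nonneg
  have h1 : 0 < 1 - (κ - α) := by linarith [H.lt_α]
  have h2 : 0 < κ - α := by linarith [H.α_lt]
  have h3 : 0 < p - 1 := by linarith
  refine ⟨((2 * 4 ^ (1 - 1 / p) + (4 * (p - 1)) ^ (1 - 1 / p) + 6) * (2 * M ^ 2 * 2 ^ |-κ|) +
        16 * M ^ 2 * 2 ^ |α - κ| + 48 * M ^ 2 * (4 / (1 - (κ - α)) + 4 / (κ - α)) +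
        M * C * 2 ^ |α - κ|) + 17 * M * C, by positivity, ?_⟩
  intro σ hσ τ hτ Qσ Qτ hQσ hQτ hGσ hGτ
  have hx := one_sub_abs_pos hσ
  have hy := one_sub_abs_pos hτ
  rw [add_mul _ (17 * M * C)]
  rcases eq_or_ne σ τ with rfl | hne
  · rw [sub_self, norm_zero]; positivity
  rcases le_total |σ - τ| ((1 - |σ|) / 16) with hh | hh
  · refine (H.norm_mul_finHilbert_sub_le_near hp hC0 hC hσ hτ hne hh hQσ hQτ hGσ hGτ).trans
      (le_add_of_nonneg_right (by positivity))
  · refine (H.norm_mul_finHilbert_sub_le_far hp hC0 hC hσ hτ hh).trans ?_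
    refine le_trans ?_ (le_add_of_nonneg_left (by positivity))
    gcongr ?_ * (?_ * ?_)
    linarith

end WeightedQuotient

theorem norm_le_of_holder_of_endpoints {v : ℝ → ℂ} {α C : ℝ}
    (hv : ∀ s ∈ Icc (-1 : ℝ) 1, ∀ σ ∈ Icc (-1 : ℝ) 1, ‖v s - v σ‖ ≤ C * |s - σ| ^ α)
    (h1 : v 1 = 0) (h2 : v (-1) = 0) {s : ℝ} (hs : s ∈ Icc (-1 : ℝ) 1) :
    ‖v s‖ ≤ C * (1 - |s|) ^ α := by
  rcases le_total 0 s with h | h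
  · have := hv s hs 1 (by simp)
    rw [h1, sub_zero, abs_sub_comm, abs_of_nonneg (by linarith [hs.2] : 0 ≤ 1 - s)] at this
    rwa [abs_of_nonneg h]
  · have := hv s hs (-1) (by simp)
    rw [h2, sub_zero, sub_neg_eq_add, abs_of_nonneg (by linarith [hs.1] : 0 ≤ s + 1)] at this
    rwa [abs_of_nonpos h, sub_neg_eq_add, add_comm]

theorem sqrt_one_sub_sq_bounds {σ : ℝ} (hσ : σ ∈ Icc (-1 : ℝ) 1) :
    Real.sqrt (1 - |σ|) ≤ Real.sqrt (1 - σ ^ 2) ∧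
      Real.sqrt (1 - σ ^ 2) ≤ Real.sqrt 2 * Real.sqrt (1 - |σ|) := by
  obtain ⟨h1, h2⟩ := one_sub_abs_le_one_sub_sq hσ
  refine ⟨Real.sqrt_le_sqrt h1, ?_⟩
  rw [← Real.sqrt_mul zero_le_two]
  exact Real.sqrt_le_sqrt h2

theorem sqrt_pow_eq_rpow {x : ℝ} (hx : 0 ≤ x) (n : ℕ) : Real.sqrt x ^ n = x ^ ((n : ℝ) / 2) := by
  rw [Real.sqrt_eq_rpow, ← Real.rpow_mul_natCast hx]; congr 1; ring

theorem sqrt_one_sub_sq_near {σ s : ℝ} (hσ : σ ∈ Ioo (-1 : ℝ) 1) (h : |s - σ| ≤ (1 - |σ|) / 2) :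
    Real.sqrt (1 - |σ|) / 2 ≤ Real.sqrt (1 - s ^ 2) ∧
    Real.sqrt (1 - s ^ 2) ≤ 2 * Real.sqrt (1 - |σ|) ∧
    |Real.sqrt (1 - s ^ 2) - Real.sqrt (1 - σ ^ 2)| ≤ 2 * |s - σ| / Real.sqrt (1 - |σ|) := by
  have hx := one_sub_abs_pos hσ
  have hs := WeightedQuotient.mem_Icc_of_abs_sub_le hσ h
  have hd := abs_le.mp (abs_endpoint_dist_sub_le s σ)
  obtain ⟨h1, h2⟩ := one_sub_abs_le_one_sub_sq hs
  have hR : 0 < Real.sqrt (1 - |σ|) := Real.sqrt_pos.mpr hx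
  have hRσ := (sqrt_one_sub_sq_bounds (Ioo_subset_Icc_self hσ)).1
  refine ⟨?_, ?_, ?_⟩
  · refine Real.le_sqrt_of_sq_le ?_
    rw [div_pow, Real.sq_sqrt hx.le]
    linarith
  · refine Real.sqrt_le_iff.mpr ⟨by positivity, ?_⟩
    rw [mul_pow, Real.sq_sqrt hx.le]
    linarith
  · rw [le_div_iff₀ hR]
    have e1 : |Real.sqrt (1 - s ^ 2) - Real.sqrt (1 - σ ^ 2)| *
        (Real.sqrt (1 - s ^ 2) + Real.sqrt (1 - σ ^ 2)) = |s - σ| * |s + σ| := by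
      rw [← abs_of_nonneg (add_nonneg (Real.sqrt_nonneg (1 - s ^ 2))
        (Real.sqrt_nonneg (1 - σ ^ 2))), ← abs_mul, ← abs_mul, ← abs_neg ((s - σ) * (s + σ))]
      congr 1
      have q1 := Real.mul_self_sqrt (by linarith [abs_le.mpr hs] : 0 ≤ 1 - s ^ 2)
      have q2 := Real.mul_self_sqrt (one_sub_sq_pos hσ).le
      linear_combination q1 - q2
    have e2 : |s + σ| ≤ 2 := abs_le.mpr ⟨by linarith [hs.1, hσ.1], by linarith [hs.2, hσ.2]⟩
    have e3 := Real.sqrt_nonneg (1 - s ^ 2)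
    calc _ ≤ |Real.sqrt (1 - s ^ 2) - Real.sqrt (1 - σ ^ 2)| *
        (Real.sqrt (1 - s ^ 2) + Real.sqrt (1 - σ ^ 2)) := by gcongr; linarith
      _ = |s - σ| * |s + σ| := e1
      _ ≤ |s - σ| * 2 := by gcongr
      _ = _ := mul_comm _ _

theorem abs_sqrt_pow_sub_le {σ s : ℝ} (hσ : σ ∈ Ioo (-1 : ℝ) 1) (h : |s - σ| ≤ (1 - |σ|) / 2)
    (n : ℕ) : |Real.sqrt (1 - s ^ 2) ^ n - Real.sqrt (1 - σ ^ 2) ^ n| ≤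
      n * 2 ^ n * (1 - |σ|) ^ ((n : ℝ) / 2 - 1) * |s - σ| := by
  have hx := one_sub_abs_pos hσ
  obtain ⟨-, h2, h3⟩ := sqrt_one_sub_sq_near hσ h
  have hR : 0 < Real.sqrt (1 - |σ|) := Real.sqrt_pos.mpr hx
  have h4 : Real.sqrt (1 - σ ^ 2) ≤ 2 * Real.sqrt (1 - |σ|) :=
    (sqrt_one_sub_sq_near hσ (by rw [sub_self, abs_zero]; positivity)).2.1
  rcases n with _ | n
  · simp
  refine (abs_pow_sub_pow_le _ _ _).trans ?_
  rw [abs_of_nonneg (Real.sqrt_nonneg _), abs_of_nonneg (Real.sqrt_nonneg _),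
    Nat.add_sub_cancel, Real.rpow_sub_one hx.ne', ← sqrt_pow_eq_rpow hx.le]
  have h5 : (1 - |σ|) = Real.sqrt (1 - |σ|) * Real.sqrt (1 - |σ|) := (Real.mul_self_sqrt hx.le).symm
  calc _ ≤ 2 * |s - σ| / Real.sqrt (1 - |σ|) * ((n + 1 : ℕ) : ℝ) *
        (2 * Real.sqrt (1 - |σ|)) ^ n := by
        have : max (Real.sqrt (1 - s ^ 2)) (Real.sqrt (1 - σ ^ 2)) ≤ 2 * Real.sqrt (1 - |σ|) :=
          max_le h2 h4
        gcongr
    _ = _ := by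
      rw [mul_pow, pow_succ (Real.sqrt (1 - |σ|)), pow_succ (2 : ℝ)]
      generalize Real.sqrt (1 - |σ|) = r at *
      rw [h5]
      field_simp

theorem weightedQuotient_sqrt_pow {v : ℝ → ℂ} (hv : Measurable v) {α C : ℝ} (hC : 0 ≤ C) {n : ℕ}
    (hα : 0 < α) (hα1 : α < 1) (h1 : α < (n : ℝ) / 2) (h2 : (n : ℝ) / 2 < α + 1)
    (hv0 : ∀ s ∈ Icc (-1 : ℝ) 1, ∀ σ ∈ Icc (-1 : ℝ) 1, ‖v s - v σ‖ ≤ C * |s - σ| ^ α)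
    (hv1 : v 1 = 0) (hv2 : v (-1) = 0) :
    WeightedQuotient v (fun s => v s / ((Real.sqrt (1 - s ^ 2) ^ n : ℝ) : ℂ))
      (fun s => Real.sqrt (1 - s ^ 2) ^ n) α ((n : ℝ) / 2)
      (2 ^ n * (1 + n * 2 ^ n) * (1 + C)) := by
  have hone : (1 : ℝ) ≤ 2 ^ n := one_le_pow₀ one_le_two
  have hW : (0 : ℝ) ≤ n * 2 ^ n := by positivity
  have hCM : C ≤ 2 ^ n * (1 + n * 2 ^ n) * (1 + C) := by
    calc C ≤ 1 * 1 * (1 + C) := by linarith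
      _ ≤ _ := by gcongr; linarith
  have hlow : ∀ σ ∈ Ioo (-1 : ℝ) 1, ∀ s, |s - σ| ≤ (1 - |σ|) / 2 →
      (1 - |σ|) ^ ((n : ℝ) / 2) / 2 ^ n ≤ Real.sqrt (1 - s ^ 2) ^ n := by
    intro σ hσ s hs
    have hx := one_sub_abs_pos hσ
    rw [← sqrt_pow_eq_rpow hx.le, ← div_pow]
    exact pow_le_pow_left₀ (by positivity) (sqrt_one_sub_sq_near hσ hs).1 n
  have hlow' : ∀ σ ∈ Ioo (-1 : ℝ) 1, (1 - |σ|) ^ ((n : ℝ) / 2) ≤ Real.sqrt (1 - σ ^ 2) ^ n := by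
    intro σ hσ
    have hx := one_sub_abs_pos hσ
    rw [← sqrt_pow_eq_rpow hx.le]
    exact pow_le_pow_left₀ (by positivity) (sqrt_one_sub_sq_bounds (Ioo_subset_Icc_self hσ)).1 n
  have hvx : ∀ s ∈ Icc (-1 : ℝ) 1, ‖v s‖ ≤ C * (1 - |s|) ^ α := fun s hs =>
    norm_le_of_holder_of_endpoints hv0 hv1 hv2 hs
  refine ⟨hv, by fun_prop, hα, hα1, h1, h2, by positivity, ?_, ?_, ?_, fun s => by positivity,
    ?_, ?_⟩
  · intro s hs σ hσ
    exact (hv0 s hs σ hσ).trans (by gcongr)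
  · intro s hs
    have hx := one_sub_abs_pos hs
    rw [norm_div, Complex.norm_real, Real.norm_of_nonneg (by positivity), Real.rpow_sub hx,
      ← mul_div_assoc]
    refine div_le_div₀ (by positivity) ?_ (by positivity) (hlow' s hs)
    exact (hvx s (Ioo_subset_Icc_self hs)).trans (by gcongr)
  · intro σ hσ s hs
    have hx := one_sub_abs_pos hσ
    have hσp : 0 < Real.sqrt (1 - σ ^ 2) ^ n := lt_of_lt_of_le (by positivity) (hlow' σ hσ)
    have hsp : 0 < Real.sqrt (1 - s ^ 2) ^ n := lt_of_lt_of_le (by positivity) (hlow σ hσ s hs)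
    have hσl := hlow' σ hσ
    have hsl := hlow σ hσ s hs
    have hsub := abs_sqrt_pow_sub_le hσ hs n
    have hvσ := hvx σ (Ioo_subset_Icc_self hσ)
    set a := Real.sqrt (1 - s ^ 2) ^ n
    set b := Real.sqrt (1 - σ ^ 2) ^ n
    set x := 1 - |σ|
    have ha : (a : ℂ) ≠ 0 := ofReal_ne_zero.mpr hsp.ne'
    have hb : (b : ℂ) ≠ 0 := ofReal_ne_zero.mpr hσp.ne'
    have split : v s / (a : ℂ) - v σ / (b : ℂ) =
        (v s - v σ) / a - v σ * ((a - b : ℝ) : ℂ) / (a * b) := by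
      push_cast; field_simp; ring
    rw [split]
    refine (norm_sub_le _ _).trans ?_
    rw [norm_div, norm_div, norm_mul, norm_mul, Complex.norm_real, Complex.norm_real,
      Complex.norm_real, Real.norm_of_nonneg hsp.le, Real.norm_of_nonneg hσp.le, Real.norm_eq_abs]
    calc _ ≤ ‖v s - v σ‖ / (x ^ ((n : ℝ) / 2) / 2 ^ n) +
          C * x ^ α * (n * 2 ^ n * x ^ ((n : ℝ) / 2 - 1) * |s - σ|) /
            (x ^ ((n : ℝ) / 2) / 2 ^ n * x ^ ((n : ℝ) / 2)) := by gcongr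
      _ = 2 ^ n * 1 * 1 * x ^ (-((n : ℝ) / 2)) * ‖v s - v σ‖ +
          2 ^ n * (n * 2 ^ n) * C * x ^ (-((n : ℝ) / 2)) * (x ^ (α - 1) * |s - σ|) := by
          rw [Real.rpow_neg hx.le, Real.rpow_sub_one hx.ne', Real.rpow_sub_one hx.ne']
          field_simp
      _ ≤ 2 ^ n * (1 + n * 2 ^ n) * (1 + C) * x ^ (-((n : ℝ) / 2)) * ‖v s - v σ‖ +
          2 ^ n * (1 + n * 2 ^ n) * (1 + C) * x ^ (-((n : ℝ) / 2)) *
            (x ^ (α - 1) * |s - σ|) := by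
          gcongr <;> linarith
      _ = _ := by ring
  · intro σ hσ
    have hx := one_sub_abs_pos hσ
    have h4 : Real.sqrt (1 - σ ^ 2) ≤ 2 * Real.sqrt (1 - |σ|) :=
      (sqrt_one_sub_sq_near hσ (by rw [sub_self, abs_zero]; positivity)).2.1
    calc Real.sqrt (1 - σ ^ 2) ^ n ≤ (2 * Real.sqrt (1 - |σ|)) ^ n := by gcongr
      _ = 2 ^ n * 1 * 1 * (1 - |σ|) ^ ((n : ℝ) / 2) := by
          rw [mul_pow, sqrt_pow_eq_rpow hx.le]; ring
      _ ≤ _ := by gcongr <;> linarith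
  · intro σ hσ s hs
    have hx := one_sub_abs_pos hσ
    refine (abs_sqrt_pow_sub_le hσ hs n).trans ?_
    gcongr ?_ * _ * _
    calc (n : ℝ) * 2 ^ n ≤ 1 * (1 + n * 2 ^ n) * 1 := by linarith
      _ ≤ _ := by gcongr; linarith

theorem exists_lintegral_abs_sub_rpow_le {e : ℝ} (he : e < 1) :
    ∃ K : ℝ≥0∞, K ≠ ⊤ ∧ ∀ σ ∈ Icc (-1 : ℝ) 1,
      ∫⁻ s in Icc (-1 : ℝ) 1, ENNReal.ofReal (|s - σ| ^ (-e)) ≤ K := by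
  refine ⟨ENNReal.ofReal (2 / (-e + 1) * 3 ^ (-e + 1)), ENNReal.ofReal_ne_top, fun σ hσ => ?_⟩
  obtain ⟨h1, h2⟩ := integrableOn_abs_sub_rpow_near (β := -e) (R := 3) (by linarith)
    (by norm_num) σ
  have hsub : Icc (-1 : ℝ) 1 ⊆ {s | |s - σ| < 3} := fun s hs => by
    rw [mem_ofPred_eq, abs_lt]
    constructor <;> linarith [hs.1, hs.2, hσ.1, hσ.2]
  refine (lintegral_mono_set hsub).trans ?_
  rw [← ofReal_integral_eq_lintegral_ofReal h1 (ae_of_all _ fun s => by positivity)]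
  exact ENNReal.ofReal_le_ofReal h2

/-- A Hajłasz-type inequality with an `L^q` gradient implies fractional Sobolev regularity. -/
theorem lintegral_gagliardo_lt_top {D : ℝ → ℂ} {g : ℝ → ℝ} (hg : Measurable g)
    (hg0 : ∀ σ, 0 ≤ g σ) {p q : ℝ} (hq : 0 < q) (hqp : q < p)
    (hgq : ∫⁻ σ in Icc (-1 : ℝ) 1, ENNReal.ofReal (g σ ^ q) ≠ ⊤)
    (hD : ∀ᵐ σ ∂(volume.restrict (Icc (-1 : ℝ) 1)), ∀ᵐ τ ∂(volume.restrict (Icc (-1 : ℝ) 1)),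
      ‖D τ - D σ‖ ≤ (g σ + g τ) * |τ - σ| ^ (1 - 1 / p)) :
    ∫⁻ σ in Icc (-1 : ℝ) 1, gagliardo q D σ < ⊤ := by
  have hp : 0 < p := hq.trans hqp
  obtain ⟨K, hK, hKb⟩ := exists_lintegral_abs_sub_rpow_le (e := q / p) (by rwa [div_lt_one hp])
  have hgm : Measurable fun σ => ENNReal.ofReal (g σ ^ q) := by
    have : Measurable fun σ => g σ ^ q := hg.pow_const q
    fun_prop
  have hkm : Measurable fun z : ℝ × ℝ => ENNReal.ofReal (|z.2 - z.1| ^ (-(q / p))) := by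
    have : Measurable fun z : ℝ × ℝ => |z.2 - z.1| ^ (-(q / p)) :=
      Measurable.pow_const (by fun_prop) _
    fun_prop
  have hpt : ∀ᵐ σ ∂(volume.restrict (Icc (-1 : ℝ) 1)), gagliardo q D σ ≤
      ∫⁻ τ in Icc (-1 : ℝ) 1, ENNReal.ofReal (2 ^ q) *
        ((ENNReal.ofReal (g σ ^ q) + ENNReal.ofReal (g τ ^ q)) *
          ENNReal.ofReal (|τ - σ| ^ (-(q / p)))) := by
    filter_upwards [hD] with σ hσ
    refine lintegral_mono_ae ?_
    filter_upwards [hσ] with τ hτ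
    have hgσ := hg0 σ
    have hgτ := hg0 τ
    rw [← ENNReal.ofReal_add (by positivity) (by positivity), ← ENNReal.ofReal_mul (by positivity),
      ← ENNReal.ofReal_mul (by positivity)]
    apply ENNReal.ofReal_le_ofReal
    rcases eq_or_ne τ σ with rfl | hne
    · rw [sub_self, norm_zero, zero_div, Real.zero_rpow hq.ne']; positivity
    have hh : 0 < |τ - σ| := abs_pos.mpr (sub_ne_zero.mpr hne)
    calc (‖D τ - D σ‖ / |τ - σ|) ^ q
        ≤ ((g σ + g τ) * |τ - σ| ^ (1 - 1 / p) / |τ - σ|) ^ q := by gcongr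
      _ = ((g σ + g τ) * |τ - σ| ^ (-(1 / p))) ^ q := by
          rw [mul_div_assoc, ← Real.rpow_sub_one hh.ne']
          congr 3; ring
      _ = (g σ + g τ) ^ q * |τ - σ| ^ (-(q / p)) := by
          rw [Real.mul_rpow (by positivity) (by positivity), ← Real.rpow_mul hh.le]
          congr 2; ring
      _ ≤ 2 ^ q * (g σ ^ q + g τ ^ q) * |τ - σ| ^ (-(q / p)) := by
          gcongr
          exact add_rpow_le_two_rpow_mul hgσ hgτ hq.le
      _ = _ := by ring
  have e1 : ∀ᵐ σ ∂(volume.restrict (Icc (-1 : ℝ) 1)),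
      ∫⁻ τ in Icc (-1 : ℝ) 1, ENNReal.ofReal (g σ ^ q) *
        ENNReal.ofReal (|τ - σ| ^ (-(q / p))) ≤ ENNReal.ofReal (g σ ^ q) * K := by
    filter_upwards [ae_restrict_mem measurableSet_Icc] with σ hσ
    rw [lintegral_const_mul' _ _ ENNReal.ofReal_ne_top]
    gcongr
    exact hKb σ hσ
  have f1 : ∫⁻ σ in Icc (-1 : ℝ) 1, ∫⁻ τ in Icc (-1 : ℝ) 1, ENNReal.ofReal (g σ ^ q) *
      ENNReal.ofReal (|τ - σ| ^ (-(q / p))) < ⊤ := by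
    refine (lintegral_mono_ae e1).trans_lt ?_
    rw [lintegral_mul_const' _ _ hK]
    exact ENNReal.mul_lt_top hgq.lt_top hK.lt_top
  have f2 : ∫⁻ σ in Icc (-1 : ℝ) 1, ∫⁻ τ in Icc (-1 : ℝ) 1, ENNReal.ofReal (g τ ^ q) *
      ENNReal.ofReal (|τ - σ| ^ (-(q / p))) < ⊤ := by
    rw [lintegral_lintegral_swap]
    · simpa only [abs_sub_comm] using f1
    · exact ((hgm.comp measurable_snd).mul hkm).aemeasurable
  refine (lintegral_mono_ae hpt).trans_lt ?_
  have hm1 : Measurable fun z : ℝ × ℝ => ENNReal.ofReal (g z.1 ^ q) *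
      ENNReal.ofReal (|z.2 - z.1| ^ (-(q / p))) := (hgm.comp measurable_fst).mul hkm
  have split : ∀ σ, ∫⁻ τ in Icc (-1 : ℝ) 1, ENNReal.ofReal (2 ^ q) *
        ((ENNReal.ofReal (g σ ^ q) + ENNReal.ofReal (g τ ^ q)) *
          ENNReal.ofReal (|τ - σ| ^ (-(q / p)))) = ENNReal.ofReal (2 ^ q) *
      ((∫⁻ τ in Icc (-1 : ℝ) 1, ENNReal.ofReal (g σ ^ q) *
        ENNReal.ofReal (|τ - σ| ^ (-(q / p)))) + ∫⁻ τ in Icc (-1 : ℝ) 1,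
        ENNReal.ofReal (g τ ^ q) * ENNReal.ofReal (|τ - σ| ^ (-(q / p)))) := by
    intro σ
    rw [lintegral_const_mul' _ _ ENNReal.ofReal_ne_top, ← lintegral_add_left]
    · simp only [add_mul]
    · exact hm1.comp (measurable_const.prodMk measurable_id)
  simp only [split]
  rw [lintegral_const_mul' _ _ ENNReal.ofReal_ne_top, lintegral_add_left]
  · exact ENNReal.mul_lt_top ENNReal.ofReal_lt_top (ENNReal.add_lt_top.mpr ⟨f1, f2⟩)
  · exact hm1.lintegral_prod_right'

theorem lintegral_gradient_ne_top {v : ℝ → ℂ} (hv : Measurable v) {p q β C : ℝ} (hq : 0 < q)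
    (hqp : q < p) (hC : 0 ≤ C) (hβ : -1 < β * q)
    (hG : ∫⁻ σ in Icc (-1 : ℝ) 1, gagliardo p v σ ≠ ⊤) :
    ∫⁻ σ in Icc (-1 : ℝ) 1, ENNReal.ofReal
      ((C * ((gagliardo p v σ).toReal ^ (1 / p) + (1 - |σ|) ^ β + 1)) ^ q) ≠ ⊤ := by
  have hp : 0 < p := hq.trans hqp
  have hm := measurable_gagliardo p hv
  have hx := integrableOn_endpoint_weight (e := -(β * q)) (by linarith)
  rw [neg_neg] at hx
  have hx' : ∫⁻ σ in Icc (-1 : ℝ) 1, ENNReal.ofReal ((1 - |σ|) ^ (β * q)) ≠ ⊤ :=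
    (hasFiniteIntegral_iff_ofReal (by
      filter_upwards [ae_mem_Ioo] with s hs
      have := one_sub_abs_pos hs
      simp only [Pi.zero_apply]; positivity)).mp hx.2 |>.ne
  have hpt : ∀ᵐ σ ∂(volume.restrict (Icc (-1 : ℝ) 1)), ENNReal.ofReal
      ((C * ((gagliardo p v σ).toReal ^ (1 / p) + (1 - |σ|) ^ β + 1)) ^ q) ≤
      ENNReal.ofReal (C ^ q * (2 ^ q * 2 ^ q)) *
        (gagliardo p v σ + ENNReal.ofReal ((1 - |σ|) ^ (β * q)) + 2) := by
    filter_upwards [ae_mem_Ioo, ae_lt_top' hm.aemeasurable hG] with σ hσ hfin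
    have hx := one_sub_abs_pos hσ
    set t := (gagliardo p v σ).toReal with ht
    have ht0 : 0 ≤ t := ENNReal.toReal_nonneg
    rw [← ENNReal.ofReal_toReal hfin.ne, ← ht, show (2 : ℝ≥0∞) = ENNReal.ofReal 2 by simp,
      ← ENNReal.ofReal_add (by positivity) (by positivity),
      ← ENNReal.ofReal_add (by positivity) (by positivity), ← ENNReal.ofReal_mul (by positivity)]
    apply ENNReal.ofReal_le_ofReal
    have h1 : (t ^ (1 / p)) ^ q ≤ 1 + t := by
      rw [← Real.rpow_mul ht0]
      have hqp' : 1 / p * q ≤ 1 := by rw [one_div_mul_eq_div, div_le_one hp]; exact hqp.le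
      rcases le_total t 1 with h | h
      · exact (Real.rpow_le_one ht0 h (by positivity)).trans (by linarith)
      · have := Real.rpow_le_rpow_of_exponent_le h hqp'
        rw [Real.rpow_one] at this
        linarith
    have h2pos : (1 : ℝ) ≤ 2 ^ q := Real.one_le_rpow one_le_two hq.le
    rw [Real.mul_rpow hC (by positivity), mul_assoc]
    gcongr
    calc (t ^ (1 / p) + (1 - |σ|) ^ β + 1) ^ q
        ≤ 2 ^ q * ((t ^ (1 / p) + (1 - |σ|) ^ β) ^ q + 1 ^ q) :=
          add_rpow_le_two_rpow_mul (by positivity) zero_le_one hq.le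
      _ ≤ 2 ^ q * (2 ^ q * ((t ^ (1 / p)) ^ q + ((1 - |σ|) ^ β) ^ q) + 2 ^ q * 1) := by
          rw [Real.one_rpow]
          gcongr
          · exact add_rpow_le_two_rpow_mul (by positivity) (by positivity) hq.le
          · linarith
      _ = 2 ^ q * 2 ^ q * ((t ^ (1 / p)) ^ q + (1 - |σ|) ^ (β * q) + 1) := by
          rw [Real.rpow_mul hx.le]; ring
      _ ≤ 2 ^ q * 2 ^ q * ((1 + t) + (1 - |σ|) ^ (β * q) + 1) := by gcongr
      _ = _ := by ring
  refine ((lintegral_mono_ae hpt).trans_lt ?_).ne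
  rw [lintegral_const_mul' _ _ ENNReal.ofReal_ne_top, lintegral_add_right _ measurable_const,
    lintegral_add_left hm]
  refine ENNReal.mul_lt_top ENNReal.ofReal_lt_top (ENNReal.add_lt_top.mpr
    ⟨ENNReal.add_lt_top.mpr ⟨hG.lt_top, hx'.lt_top⟩, ?_⟩)
  rw [lintegral_const, Measure.restrict_apply_univ, Real.volume_Icc]
  exact ENNReal.mul_lt_top (by simp) ENNReal.ofReal_lt_top

theorem sobWOn_of_gagliardo (A : AnalyticArc) {q : ℝ} (hq : 0 ≤ q) {d : ℂ → ℂ}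
    (hd : ∫⁻ σ in Icc (-1 : ℝ) 1, gagliardo q (fun s : ℝ => d (A.Ξ s)) σ < ⊤) : SobWOn A q d := by
  obtain ⟨c, C, hc, hC, hb, hder⟩ := A.exists_bilipschitz
  have hpt : ∀ x ∈ Icc (-1 : ℝ) 1, ∀ y ∈ Icc (-1 : ℝ) 1,
      ENNReal.ofReal ((‖d (A.Ξ x) - d (A.Ξ y)‖ / ‖A.Ξ x - A.Ξ y‖) ^ q
        * ‖deriv A.Ξ x‖ * ‖deriv A.Ξ y‖) ≤
      ENNReal.ofReal ((c⁻¹) ^ q * C * C) *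
        ENNReal.ofReal ((‖d (A.Ξ y) - d (A.Ξ x)‖ / |y - x|) ^ q) := by
    intro x hx y hy
    rw [← ENNReal.ofReal_mul (by positivity)]
    apply ENNReal.ofReal_le_ofReal
    calc _ ≤ (c⁻¹ * (‖d (A.Ξ y) - d (A.Ξ x)‖ / |y - x|)) ^ q * C * C := by
          have h1 : ‖d (A.Ξ x) - d (A.Ξ y)‖ / ‖A.Ξ x - A.Ξ y‖ ≤
              c⁻¹ * (‖d (A.Ξ y) - d (A.Ξ x)‖ / |y - x|) := by
            rcases eq_or_ne x y with rfl | hne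
            · simp
            · have hh : 0 < |y - x| := abs_pos.mpr (sub_ne_zero.mpr hne.symm)
              rw [norm_sub_rev, ← div_eq_inv_mul, div_div, mul_comm, abs_sub_comm]
              rw [abs_sub_comm] at hh
              gcongr
              exact (hb x hx y hy).1
          gcongr
          · exact (hder x hx).2
          · exact (hder y hy).2
      _ = _ := by rw [Real.mul_rpow (by positivity) (by positivity)]; ring
  have hle : ∀ x ∈ Icc (-1 : ℝ) 1, (∫⁻ y in Icc (-1 : ℝ) 1,
      ENNReal.ofReal ((‖d (A.Ξ x) - d (A.Ξ y)‖ / ‖A.Ξ x - A.Ξ y‖) ^ q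
        * ‖deriv A.Ξ x‖ * ‖deriv A.Ξ y‖)) ≤
      ENNReal.ofReal ((c⁻¹) ^ q * C * C) * gagliardo q (fun s : ℝ => d (A.Ξ s)) x := by
    intro x hx
    rw [gagliardo, ← lintegral_const_mul' _ _ ENNReal.ofReal_ne_top]
    exact setLIntegral_mono' measurableSet_Icc fun y hy => hpt x hx y hy
  refine (setLIntegral_mono' measurableSet_Icc hle).trans_lt ?_
  rw [lintegral_const_mul' _ _ ENNReal.ofReal_ne_top]
  exact ENNReal.mul_lt_top ENNReal.ofReal_lt_top hd

theorem SobWOn.lintegral_gagliardo_ne_top {A : AnalyticArc} {p : ℝ} (hp : 0 ≤ p) {θ : ℂ → ℂ}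
    (hθ : SobWOn A p θ) :
    ∫⁻ σ in Icc (-1 : ℝ) 1, gagliardo p (fun s : ℝ => θ (A.Ξ s)) σ ≠ ⊤ := by
  obtain ⟨c, C, hc, hC, hb, hder⟩ := A.exists_bilipschitz
  have hpt : ∀ x ∈ Icc (-1 : ℝ) 1, ∀ y ∈ Icc (-1 : ℝ) 1,
      ENNReal.ofReal ((‖θ (A.Ξ y) - θ (A.Ξ x)‖ / |y - x|) ^ p) ≤
      ENNReal.ofReal (C ^ p * c⁻¹ * c⁻¹) *
      ENNReal.ofReal ((‖θ (A.Ξ x) - θ (A.Ξ y)‖ / ‖A.Ξ x - A.Ξ y‖) ^ p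
        * ‖deriv A.Ξ x‖ * ‖deriv A.Ξ y‖) := by
    intro x hx y hy
    rw [← ENNReal.ofReal_mul (by positivity)]
    apply ENNReal.ofReal_le_ofReal
    have h1 : ‖θ (A.Ξ y) - θ (A.Ξ x)‖ / |y - x| ≤
        C * (‖θ (A.Ξ x) - θ (A.Ξ y)‖ / ‖A.Ξ x - A.Ξ y‖) := by
      rcases eq_or_ne x y with rfl | hne
      · simp
      · have hh : 0 < |x - y| := abs_pos.mpr (sub_ne_zero.mpr hne)
        have hb' := hb x hx y hy
        have hN : 0 < ‖A.Ξ x - A.Ξ y‖ := lt_of_lt_of_le (by positivity) hb'.1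
        rw [norm_sub_rev, abs_sub_comm, div_le_iff₀ hh, mul_div_assoc', div_mul_eq_mul_div,
          le_div_iff₀ hN]
        calc _ ≤ ‖θ (A.Ξ x) - θ (A.Ξ y)‖ * (C * |x - y|) := by gcongr; exact hb'.2
          _ = _ := by ring
    have h2 : 1 ≤ c⁻¹ * ‖deriv A.Ξ x‖ := by
      rw [← div_eq_inv_mul, one_le_div hc]; exact (hder x hx).1
    have h3 : 1 ≤ c⁻¹ * ‖deriv A.Ξ y‖ := by
      rw [← div_eq_inv_mul, one_le_div hc]; exact (hder y hy).1
    calc _ ≤ (C * (‖θ (A.Ξ x) - θ (A.Ξ y)‖ / ‖A.Ξ x - A.Ξ y‖)) ^ p * 1 * 1 := by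
          rw [mul_one, mul_one]; gcongr
      _ ≤ (C * (‖θ (A.Ξ x) - θ (A.Ξ y)‖ / ‖A.Ξ x - A.Ξ y‖)) ^ p *
          (c⁻¹ * ‖deriv A.Ξ x‖) * (c⁻¹ * ‖deriv A.Ξ y‖) := by gcongr
      _ = _ := by rw [Real.mul_rpow (by positivity) (by positivity)]; ring
  refine ((setLIntegral_mono' measurableSet_Icc fun x hx =>
    setLIntegral_mono' measurableSet_Icc fun y hy => hpt x hx y hy).trans_lt ?_).ne
  simp_rw [lintegral_const_mul' _ _ ENNReal.ofReal_ne_top]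
  exact ENNReal.mul_lt_top ENNReal.ofReal_lt_top hθ

theorem lintegral_gagliardo_lt_top_of_le_add {D E : ℝ → ℂ} {q L : ℝ} (hq : 0 < q) (hL : 0 ≤ L)
    (hD : ∫⁻ σ in Icc (-1 : ℝ) 1, gagliardo q D σ < ⊤)
    (hE : ∀ x ∈ Ioo (-1 : ℝ) 1, ∀ y ∈ Ioo (-1 : ℝ) 1,
      ‖E x - E y‖ ≤ ‖D x - D y‖ + L * |x - y|) :
    ∫⁻ σ in Icc (-1 : ℝ) 1, gagliardo q E σ < ⊤ := by
  have h1 : ∀ᵐ σ ∂(volume.restrict (Icc (-1 : ℝ) 1)), gagliardo q E σ ≤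
      ENNReal.ofReal (2 ^ q) * (gagliardo q D σ + ENNReal.ofReal (L ^ q) * 2) := by
    filter_upwards [ae_mem_Ioo] with σ hσ
    have h2 : ENNReal.ofReal (2 ^ q) * (gagliardo q D σ + ENNReal.ofReal (L ^ q) * 2) =
        ∫⁻ s in Icc (-1 : ℝ) 1, ENNReal.ofReal (2 ^ q) *
          (ENNReal.ofReal ((‖D s - D σ‖ / |s - σ|) ^ q) + ENNReal.ofReal (L ^ q)) := by
      rw [lintegral_const_mul' _ _ ENNReal.ofReal_ne_top, lintegral_add_right _ measurable_const,
        lintegral_const, Measure.restrict_apply_univ, Real.volume_Icc, gagliardo]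
      norm_num
    rw [h2]
    refine lintegral_mono_ae ?_
    filter_upwards [ae_mem_Ioo] with s hs
    rw [← ENNReal.ofReal_add (by positivity) (by positivity), ← ENNReal.ofReal_mul (by positivity)]
    apply ENNReal.ofReal_le_ofReal
    refine le_trans ?_ (add_rpow_le_two_rpow_mul (by positivity) hL hq.le)
    gcongr
    rcases eq_or_ne s σ with rfl | hne
    · simpa using hL
    · have hh : 0 < |s - σ| := abs_pos.mpr (sub_ne_zero.mpr hne)
      rw [div_le_iff₀ hh, add_mul, div_mul_cancel₀ _ hh.ne']
      exact hE s hs σ hσ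
  refine (lintegral_mono_ae h1).trans_lt ?_
  rw [lintegral_const_mul' _ _ ENNReal.ofReal_ne_top, lintegral_add_right _ measurable_const,
    lintegral_const, Measure.restrict_apply_univ, Real.volume_Icc]
  refine ENNReal.mul_lt_top ENNReal.ofReal_lt_top (ENNReal.add_lt_top.mpr ⟨hD, ?_⟩)
  exact ENNReal.mul_lt_top (ENNReal.mul_lt_top ENNReal.ofReal_lt_top (by simp))
    ENNReal.ofReal_lt_top

theorem WeightedQuotient.lintegral_gagliardo_lt_top {v ψ : ℝ → ℂ} {ω : ℝ → ℝ} {α κ M : ℝ}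
    (H : WeightedQuotient v ψ ω α κ M) {p q : ℝ} (hp : 2 < p) (hq : 0 < q) (hqp : q < p)
    (hαq : -1 < (α - 1 + 1 / p) * q)
    (hG : ∫⁻ σ in Icc (-1 : ℝ) 1, gagliardo p v σ ≠ ⊤) :
    ∫⁻ σ in Icc (-1 : ℝ) 1, gagliardo q (fun σ => (ω σ : ℂ) * finHilbert ψ σ) σ < ⊤ := by
  obtain ⟨C, hC, hD⟩ := H.exists_norm_mul_finHilbert_sub_le hp
  have hm := measurable_gagliardo p H.measurable_v
  have hp0 : 0 < p := by linarith
  refine _root_.lintegral_gagliardo_lt_top (p := p)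
    (g := fun σ => |C * ((gagliardo p v σ).toReal ^ (1 / p) + (1 - |σ|) ^ (α - 1 + 1 / p) + 1)|)
    ?_ (fun σ => abs_nonneg _) hq hqp ?_ ?_
  · have h1 : Measurable fun σ => (gagliardo p v σ).toReal ^ (1 / p) :=
      hm.ennreal_toReal.pow_const _
    have h2 := measurable_endpoint_weight (α - 1 + 1 / p)
    exact (((h1.add h2).add measurable_const).const_mul C).abs
  · refine ne_of_eq_of_ne (setLIntegral_congr_fun_ae measurableSet_Icc ?_)
      (lintegral_gradient_ne_top H.measurable_v hq hqp hC hαq hG)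
    have := ae_imp_of_ae_restrict (ae_mem_Ioo)
    filter_upwards [this] with σ hσ hσI
    have := one_sub_abs_pos (hσ hσI)
    rw [abs_of_nonneg (by positivity)]
  · filter_upwards [ae_mem_Ioo, ae_lt_top' hm.aemeasurable hG] with σ hσ hσf
    filter_upwards [ae_mem_Ioo, ae_lt_top' hm.aemeasurable hG] with τ hτ hτf
    have hx := one_sub_abs_pos hσ
    have hy := one_sub_abs_pos hτ
    have hQ : ∀ a, gagliardo p v a < ⊤ → gagliardo p v a ≤
        ENNReal.ofReal (((gagliardo p v a).toReal ^ (1 / p)) ^ p) := fun a ha => by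
      rw [← Real.rpow_mul ENNReal.toReal_nonneg, one_div_mul_cancel hp0.ne', Real.rpow_one,
        ENNReal.ofReal_toReal ha.ne]
    refine (hD τ hτ σ hσ _ _ (by positivity) (by positivity) (hQ τ hτf) (hQ σ hσf)).trans ?_
    refine le_trans ?_ (mul_le_mul_of_nonneg_right
      (add_le_add (le_abs_self _) (le_abs_self _)) (by positivity))
    rw [← mul_add, mul_assoc]
    exact mul_le_mul_of_nonneg_left (mul_le_mul_of_nonneg_right (by linarith) (by positivity)) hC

/-- Near-isometry of the weighted finite Hilbert transform in fractional Sobolev spaces, up to an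
affine correction. -/
theorem exists_affine_lintegral_gagliardo_lt_top {v : ℝ → ℂ} (hv : Measurable v) {p C : ℝ}
    (hp : 2 < p) (hC : 0 ≤ C)
    (hv0 : ∀ s ∈ Icc (-1 : ℝ) 1, ∀ σ ∈ Icc (-1 : ℝ) 1, ‖v s - v σ‖ ≤ C * |s - σ| ^ (1 - 2 / p))
    (hv1 : v 1 = 0) (hv2 : v (-1) = 0)
    (hG : ∫⁻ σ in Icc (-1 : ℝ) 1, gagliardo p v σ ≠ ⊤) :
    (∀ σ ∈ Ioo (-1 : ℝ) 1, IntegrableOn (fun s : ℝ => (v s / (Real.sqrt (1 - s ^ 2) : ℂ) -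
      v σ / (Real.sqrt (1 - σ ^ 2) : ℂ)) / ((s : ℂ) - σ)) (Icc (-1) 1)) ∧
    ∃ a b : ℂ, ∀ q, 2 < q → q < p → ∃ D : ℝ → ℂ,
      (∫⁻ σ in Icc (-1 : ℝ) 1, gagliardo q D σ < ⊤) ∧
      ∀ σ ∈ Ioo (-1 : ℝ) 1, (Real.sqrt (1 - σ ^ 2) : ℂ) *
        finHilbert (fun s => v s / (Real.sqrt (1 - s ^ 2) : ℂ)) σ =
          D σ + (Real.sqrt (1 - σ ^ 2) : ℂ) * (a + b * σ) := by
  have hp0 : 0 < p := by linarith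
  have hp2 : 2 / p < 1 := by rw [div_lt_one hp0]; exact hp
  have hp2' : 2 / p = 2 * (1 / p) := by ring
  have hpinv : 0 < 1 / p := by positivity
  have hholder : ∀ α, α ≤ 1 - 2 / p → ∀ s ∈ Icc (-1 : ℝ) 1, ∀ σ ∈ Icc (-1 : ℝ) 1,
      ‖v s - v σ‖ ≤ (C * 2 ^ (1 - 2 / p - α)) * |s - σ| ^ α := by
    intro α hα s hs σ hσ
    rcases eq_or_ne s σ with rfl | hne
    · rw [sub_self, norm_zero]; positivity
    · have hh : 0 < |s - σ| := abs_pos.mpr (sub_ne_zero.mpr hne)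
      have h2 : |s - σ| ≤ 2 := abs_le.mpr ⟨by linarith [hs.1, hσ.2], by linarith [hs.2, hσ.1]⟩
      refine (hv0 s hs σ hσ).trans ?_
      calc C * |s - σ| ^ (1 - 2 / p) = C * (|s - σ| ^ (1 - 2 / p - α) * |s - σ| ^ α) := by
            rw [← Real.rpow_add hh]; congr 2; ring
        _ ≤ C * (2 ^ (1 - 2 / p - α) * |s - σ| ^ α) := by
            gcongr
        _ = _ := by ring
  have key : ∀ α, 0 < α → α < 1 / 2 → α ≤ 1 - 2 / p →
      WeightedQuotient v (fun s => v s / (Real.sqrt (1 - s ^ 2) : ℂ))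
        (fun s => Real.sqrt (1 - s ^ 2)) α (1 / 2)
        (2 ^ 1 * (1 + (1 : ℕ) * 2 ^ 1) * (1 + C * 2 ^ (1 - 2 / p - α))) := by
    intro α h1 h2 h3
    have := weightedQuotient_sqrt_pow hv (n := 1) (by positivity) h1 (by linarith)
      (by push_cast; linarith) (by push_cast; linarith) (hholder α h3) hv1 hv2
    simpa only [pow_one, Nat.cast_one] using this
  constructor
  · obtain ⟨α, h1, h2⟩ := exists_between (show (0 : ℝ) < min (1 / 2) (1 - 2 / p) from
      lt_min (by norm_num) (by linarith))
    intro σ hσ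
    exact (key α h1 (h2.trans_le (min_le_left _ _)) (h2.trans_le (min_le_right _ _)).le
      ).integrableOn_sub_div_ψ hσ
  rcases le_or_gt p 4 with hp4 | hp4
  · refine ⟨0, 0, fun q hq hqp => ⟨_, ?_, fun σ _ => by
      simp only [zero_mul, add_zero, mul_zero]; rfl⟩⟩
    have hq0 : 0 < q := by linarith
    have i1 : 1 / 4 ≤ 1 / p := one_div_le_one_div_of_le hp0 hp4
    have i2 : 1 / p < 1 / q := one_div_lt_one_div_of_lt hq0 hqp
    have i3 : 1 / q < 1 / 2 := one_div_lt_one_div_of_lt two_pos hq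
    obtain ⟨α, h1, h2⟩ := exists_between (show 1 - 1 / p - 1 / q < min (1 / 2) (1 - 2 / p) from
      lt_min (by linarith) (by linarith))
    refine (key α (by linarith) (h2.trans_le (min_le_left _ _))
      (h2.trans_le (min_le_right _ _)).le).lintegral_gagliardo_lt_top hp hq0 hqp ?_ hG
    have : -(1 / q) < α - 1 + 1 / p := by linarith
    have := mul_lt_mul_of_pos_right this hq0
    rwa [neg_mul, one_div_mul_cancel hq0.ne'] at this
  · have i1 : 1 / p < 1 / 4 := one_div_lt_one_div_of_lt four_pos hp4
    have H := weightedQuotient_sqrt_pow hv (n := 3) hC (α := 1 - 2 / p) (by linarith) (by linarith)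
      (by push_cast; linarith) (by push_cast; linarith) hv0 hv1 hv2
    set ψ : ℝ → ℂ := fun s => v s / ((Real.sqrt (1 - s ^ 2) ^ 3 : ℝ) : ℂ) with hψ
    have hψi := H.integrableOn_ψ
    have hψi2 : IntegrableOn (fun s : ℝ => (s : ℂ) * ψ s) (Icc (-1) 1) := by
      refine Integrable.mono hψi (by have := H.measurable_ψ; fun_prop) ?_
      filter_upwards [ae_restrict_mem measurableSet_Icc] with s hs
      rw [norm_mul, Complex.norm_real, Real.norm_eq_abs]
      exact mul_le_of_le_one_left (norm_nonneg _) (abs_le.mpr hs)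
    refine ⟨-∫ s : ℝ in Icc (-1 : ℝ) 1, (s : ℂ) * ψ s, -∫ s in Icc (-1 : ℝ) 1, ψ s,
      fun q hq hqp => ⟨_, H.lintegral_gagliardo_lt_top hp (by linarith) hqp ?_ hG, ?_⟩⟩
    · have hq0 : 0 < q := by linarith
      rw [show (1 - 2 / p - 1 + 1 / p) * q = -(q / p) by ring, neg_lt_neg_iff, div_lt_one hp0]
      exact hqp
    · intro σ hσ
      have e1 : (fun s => v s / (Real.sqrt (1 - s ^ 2) : ℂ)) =
          fun s : ℝ => (((1 - s ^ 2 : ℝ)) : ℂ) * ψ s := by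
        ext s
        rw [hψ]
        rcases le_or_gt (1 - s ^ 2) 0 with h | h
        · simp [Real.sqrt_eq_zero_of_nonpos h]
        · have hr := Real.sqrt_pos.mpr h
          have hr' : (Real.sqrt (1 - s ^ 2) : ℂ) ≠ 0 := ofReal_ne_zero.mpr hr.ne'
          nth_rewrite 2 [← Real.sq_sqrt h.le]
          push_cast
          field_simp
      have e3 : (fun s : ℝ => ψ s * -((s : ℂ) + σ)) = fun s : ℝ => -((s : ℂ) * ψ s) - σ * ψ s := by
        ext s; ring
      have i5 : IntegrableOn (fun s : ℝ => ψ s * -((s : ℂ) + σ)) (Icc (-1) 1) := by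
        rw [e3]
        exact hψi2.neg.sub (hψi.const_mul _)
      have e2 := (finHilbert_mul (κ := fun s : ℝ => -((s : ℂ) + σ))
        (φ := fun s : ℝ => (((1 - s ^ 2 : ℝ)) : ℂ)) (ψ := ψ) (σ := σ)
        (H.integrableOn_sub_div_ψ hσ) i5 fun s => by push_cast; ring).2
      have e4 : (Real.sqrt (1 - σ ^ 2) : ℂ) * ((1 - σ ^ 2 : ℝ) : ℂ) =
          ((Real.sqrt (1 - σ ^ 2) ^ 3 : ℝ) : ℂ) := by
        nth_rewrite 2 [← Real.sq_sqrt (one_sub_sq_pos hσ).le]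
        push_cast
        ring
      have i6 : IntegrableOn (fun s : ℝ => -((s : ℂ) * ψ s)) (Icc (-1) 1) := hψi2.neg
      rw [e1, e2, e3, integral_sub i6 (hψi.const_mul _), integral_neg, integral_const_mul,
        mul_add, ← mul_assoc, e4]
      ring

theorem integrableOn_mul_kernel {ψ n : ℝ → ℂ} {σ B : ℝ} (hψ : IntegrableOn ψ (Icc (-1 : ℝ) 1))
    (hB : ∀ s ∈ Icc (-1 : ℝ) 1, ‖n s‖ ≤ B) (hn : ContinuousOn n (Icc (-1 : ℝ) 1 \ {σ})) :
    IntegrableOn (fun s => ψ s * n s) (Icc (-1 : ℝ) 1) := by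
  have hm : AEStronglyMeasurable n (volume.restrict (Icc (-1 : ℝ) 1)) := by
    have h1 := hn.aestronglyMeasurable (μ := volume)
      (measurableSet_Icc.diff (measurableSet_singleton σ))
    rwa [Measure.restrict_congr_set (sdiff_null_ae_eq_self (by simp))] at h1
  refine Integrable.mono' (hψ.norm.mul_const B) (hψ.1.mul hm) ?_
  filter_upwards [ae_restrict_mem measurableSet_Icc] with s hs
  rw [norm_mul]
  exact mul_le_mul_of_nonneg_left (hB s hs) (norm_nonneg _)

theorem eq_of_tendsto_truncated {ψ n G : ℝ → ℂ} {N : ℝ → ℝ} {σ c k C B : ℝ} {κ V : ℂ}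
    (hσ : σ ∈ Ioo (-1 : ℝ) 1) (hc : 0 < c) (hk : 0 < k) (hψ : IntegrableOn ψ (Icc (-1 : ℝ) 1))
    (hd : IntegrableOn (fun s => (ψ s - ψ σ) / ((s : ℂ) - σ)) (Icc (-1 : ℝ) 1))
    (hN : ∀ ε, MeasurableSet {s ∈ Icc (-1 : ℝ) 1 | ε ≤ N s})
    (hcN : ∀ s ∈ Icc (-1 : ℝ) 1, c * |s - σ| ≤ N s) (hN0 : N σ = 0)
    (hlim : Tendsto (fun s => N s / |s - σ|) (𝓝[≠] σ) (𝓝 k)) (hC : 0 < C)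
    (hCN : ∀ s ∈ Icc (-1 : ℝ) 1, N s ≤ C * |s - σ|)
    (hB : ∀ s ∈ Icc (-1 : ℝ) 1, ‖n s‖ ≤ B) (hn : ContinuousOn n (Icc (-1 : ℝ) 1 \ {σ}))
    (hG : ∀ᵐ s ∂(volume.restrict (Icc (-1 : ℝ) 1)), s ≠ σ →
      G s = κ * (ψ s * (1 / ((s : ℂ) - σ) + n s)))
    (hV : Tendsto (fun ε : ℝ => ∫ s in {s ∈ Icc (-1 : ℝ) 1 | ε ≤ N s}, G s) (𝓝[>] 0) (𝓝 V)) :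
    V = κ * (finHilbert ψ σ + ∫ s in Icc (-1 : ℝ) 1, ψ s * n s) := by
  have hInt := integrableOn_mul_kernel hψ hB hn
  have hpos : ∀ s ∈ Icc (-1 : ℝ) 1, s ≠ σ → 0 < N s := fun s hs hne =>
    (mul_pos hc (abs_pos.mpr (sub_ne_zero.mpr hne))).trans_le (hcN s hs)
  have h1 := tendsto_truncated_finHilbert hσ hc hk hd hN hcN hN0 hlim hC hCN
  have h2 := tendsto_setIntegral_truncated hInt hN hpos
  refine tendsto_nhds_unique hV (((h1.add h2).const_mul κ).congr' ?_)
  filter_upwards [self_mem_nhdsWithin] with ε hε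
  have hε : 0 < ε := hε
  have hsub : {s ∈ Icc (-1 : ℝ) 1 | ε ≤ N s} ⊆ Icc (-1 : ℝ) 1 := fun s hs => hs.1
  have i1 : IntegrableOn (fun s => ψ s / ((s : ℂ) - σ)) {s ∈ Icc (-1 : ℝ) 1 | ε ≤ N s} := by
    refine Integrable.mono' ((hψ.mono_set hsub).norm.mul_const (C / ε)) ?_ ?_
    · exact (hψ.mono_set hsub).1.div₀ (by fun_prop)
    · filter_upwards [ae_restrict_mem (hN ε)] with s hs
      have h3 : ε / C ≤ |s - σ| := by
        rw [div_le_iff₀' hC]; exact hs.2.trans (hCN s hs.1)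
      rw [norm_div, norm_ofReal_sub_ofReal, div_eq_mul_inv]
      gcongr
      rw [← inv_div]
      gcongr
  rw [← integral_add i1 (hInt.mono_set hsub), ← integral_const_mul]
  refine integral_congr_ae ?_
  filter_upwards [ae_restrict_of_ae_restrict_of_subset hsub hG,
    ae_restrict_mem (hN ε)] with s hs hsε
  have hne : s ≠ σ := by
    rintro rfl
    linarith [hsε.2]
  rw [hs hne]
  ring

/-- The singular integral on the arc, expressed through the finite Hilbert transform of the
pulled-back density and a smooth remainder. -/
theorem AnalyticArc.singular_integral_eq (A : AnalyticArc) {δ : ℝ} {g : ℂ → ℂ} {c : ℂ}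
    {θ srp SI : ℂ → ℂ} {w : ℝ → ℂ} {m : ℝ → ℝ → ℂ} {B : ℝ} (hδ : 0 < δ) (hc : c ≠ 0)
    (hVU : thickening δ realSeg ⊆ A.U) (hg0 : ∀ z ∈ thickening δ realSeg, g z ≠ 0)
    (hsrp : ∀ x ∈ Ioo (-1 : ℝ) 1, srp (A.Ξ x) = c * Real.sqrt (1 - x ^ 2) * g x)
    (hB : ∀ s ∈ Icc (-1 : ℝ) 1, ∀ σ ∈ Icc (-1 : ℝ) 1, ‖m s σ‖ ≤ B)
    (hm : ∀ s ∈ Icc (-1 : ℝ) 1, ∀ σ ∈ Icc (-1 : ℝ) 1, s ≠ σ →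
      g σ * deriv A.Ξ s / (g s * (A.Ξ s - A.Ξ σ)) = 1 / (s - σ) + m s σ)
    (hmc : ∀ σ ∈ Icc (-1 : ℝ) 1, ContinuousOn (fun s => m s σ) (Icc (-1 : ℝ) 1 \ {σ}))
    (hθ : ∀ᵐ x : ℝ ∂(volume.restrict (Icc (-1 : ℝ) 1)), θ (A.Ξ x) = w x)
    (hψ : IntegrableOn (fun s : ℝ => w s / (Real.sqrt (1 - s ^ 2) : ℂ)) (Icc (-1 : ℝ) 1))
    {σ : ℝ} (hσ : σ ∈ Ioo (-1 : ℝ) 1)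
    (hd : IntegrableOn (fun s : ℝ => (w s / (Real.sqrt (1 - s ^ 2) : ℂ) -
      w σ / (Real.sqrt (1 - σ ^ 2) : ℂ)) / ((s : ℂ) - σ)) (Icc (-1 : ℝ) 1))
    (hPV : IsPV A (fun t => θ t / srp t) (A.Ξ σ) ((Real.pi : ℂ) * Complex.I * SI (A.Ξ σ))) :
    (Real.pi : ℂ) * Complex.I * (srp (A.Ξ σ) * SI (A.Ξ σ)) = (Real.sqrt (1 - σ ^ 2) : ℂ) *
      (finHilbert (fun s => w s / (Real.sqrt (1 - s ^ 2) : ℂ)) σ +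
        ∫ s in Icc (-1 : ℝ) 1, w s / (Real.sqrt (1 - s ^ 2) : ℂ) * m s σ) := by
  obtain ⟨b, C, hb, hC, hbl, hder⟩ := A.exists_bilipschitz
  have hσI := Ioo_subset_Icc_self hσ
  have hmem : ∀ s ∈ Icc (-1 : ℝ) 1, (s : ℂ) ∈ thickening δ realSeg := fun s hs =>
    self_subset_thickening hδ _ (ofReal_mem_realSeg hs)
  have hcont : ContinuousOn (fun s : ℝ => ‖A.Ξ s - A.Ξ σ‖) (Icc (-1 : ℝ) 1) := by
    have : ContinuousOn (fun s : ℝ => A.Ξ s) (Icc (-1 : ℝ) 1) :=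
      A.diff.continuousOn.comp (by fun_prop) fun s hs => hVU (hmem s hs)
    fun_prop
  have hρ : 0 < Real.sqrt (1 - σ ^ 2) := Real.sqrt_pos.mpr (one_sub_sq_pos hσ)
  have hgσ := hg0 σ (hmem σ hσI)
  have hder' : HasDerivAt A.Ξ (deriv A.Ξ σ) σ :=
    (A.diff.differentiableAt (A.isOpen_U.mem_nhds (hVU (hmem σ hσI)))).hasDerivAt
  have key := eq_of_tendsto_truncated (N := fun s : ℝ => ‖A.Ξ s - A.Ξ σ‖) (c := b)
    (k := ‖deriv A.Ξ σ‖) (C := C) (B := B) (n := fun s => m s σ) (κ := (c * g σ)⁻¹)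
    hσ hb (hb.trans_le (hder σ hσI).1) hψ hd
    (fun ε => (hcont.preimage_isClosed_of_isClosed isClosed_Icc isClosed_Ici).measurableSet)
    (fun s hs => (hbl s hs σ hσI).1) (by simp) ?_ hC (fun s hs => (hbl s hs σ hσI).2)
    (fun s hs => hB s hs σ hσI) (hmc σ hσI) ?_ hPV
  · rw [hsrp σ hσ]
    calc _ = c * Real.sqrt (1 - σ ^ 2) * g σ * ((Real.pi : ℂ) * Complex.I * SI (A.Ξ σ)) := by ring
      _ = _ := by
        rw [key]
        field_simp
  · have h1 := hder'.comp_ofReal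
    rw [hasDerivAt_iff_tendsto_slope] at h1
    refine h1.norm.congr fun s => ?_
    rw [slope_def_module, norm_smul, norm_inv, Real.norm_eq_abs, inv_mul_eq_div]
  · filter_upwards [hθ, ae_mem_Ioo] with s hs hsI hne
    have hgs := hg0 s (hmem s (Ioo_subset_Icc_self hsI))
    have hρs : (Real.sqrt (1 - s ^ 2) : ℂ) ≠ 0 :=
      ofReal_ne_zero.mpr (Real.sqrt_pos.mpr (one_sub_sq_pos hsI)).ne'
    have hΞ : A.Ξ s - A.Ξ σ ≠ 0 := by
      rw [← norm_ne_zero_iff]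
      have := (hbl s (Ioo_subset_Icc_self hsI) σ hσI).1
      have h2 : 0 < |s - σ| := abs_pos.mpr (sub_ne_zero.mpr hne)
      exact (lt_of_lt_of_le (by positivity) this).ne'
    rw [← hm s (Ioo_subset_Icc_self hsI) σ hσI hne, hs, hsrp s hsI]
    field_simp

theorem abs_sqrt_one_sub_sq_sub_mul_le {σ τ : ℝ} (hσ : σ ∈ Icc (-1 : ℝ) 1)
    (hτ : τ ∈ Icc (-1 : ℝ) 1) :
    |Real.sqrt (1 - σ ^ 2) - Real.sqrt (1 - τ ^ 2)| * Real.sqrt (1 - σ ^ 2) ≤ 2 * |σ - τ| := by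
  have h1 : Real.sqrt (1 - σ ^ 2) ^ 2 = 1 - σ ^ 2 := Real.sq_sqrt (by nlinarith [hσ.1, hσ.2])
  have h2 : Real.sqrt (1 - τ ^ 2) ^ 2 = 1 - τ ^ 2 := Real.sq_sqrt (by nlinarith [hτ.1, hτ.2])
  have h3 := Real.sqrt_nonneg (1 - σ ^ 2)
  have h4 := Real.sqrt_nonneg (1 - τ ^ 2)
  calc _ ≤ |Real.sqrt (1 - σ ^ 2) - Real.sqrt (1 - τ ^ 2)| *
        |Real.sqrt (1 - σ ^ 2) + Real.sqrt (1 - τ ^ 2)| := by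
        gcongr
        rw [abs_of_nonneg (by positivity)]
        linarith
    _ = |σ + τ| * |σ - τ| := by
        rw [← abs_mul, ← abs_mul, ← abs_neg]
        congr 1
        linear_combination h2 - h1
    _ ≤ _ := by
        gcongr
        exact abs_le.mpr ⟨by linarith [hσ.1, hτ.1], by linarith [hσ.2, hτ.2]⟩

/-- A Lipschitz function vanishing at the endpoints stays Lipschitz after multiplication by
`√(1 - σ²)`. -/
theorem norm_sqrt_mul_sub_le {f : ℝ → ℂ} {L : ℝ} (hL : 0 ≤ L)
    (hf : ∀ σ ∈ Icc (-1 : ℝ) 1, ∀ τ ∈ Icc (-1 : ℝ) 1, ‖f σ - f τ‖ ≤ L * |σ - τ|)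
    (h1 : f 1 = 0) (h2 : f (-1) = 0) {σ τ : ℝ} (hσ : σ ∈ Icc (-1 : ℝ) 1)
    (hτ : τ ∈ Icc (-1 : ℝ) 1) :
    ‖(Real.sqrt (1 - σ ^ 2) : ℂ) * f σ - (Real.sqrt (1 - τ ^ 2) : ℂ) * f τ‖ ≤
      3 * L * |σ - τ| := by
  have hρσ := Real.sqrt_nonneg (1 - σ ^ 2)
  have hρτ := Real.sqrt_nonneg (1 - τ ^ 2)
  have hρσ1 : Real.sqrt (1 - σ ^ 2) ≤ 1 := Real.sqrt_le_one.mpr (by nlinarith)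
  have hρτ1 : Real.sqrt (1 - τ ^ 2) ≤ 1 := Real.sqrt_le_one.mpr (by nlinarith)
  have hsq : Real.sqrt (1 - σ ^ 2) ^ 2 = 1 - σ ^ 2 := Real.sq_sqrt (by nlinarith [hσ.1, hσ.2])
  have hB : ‖f σ‖ ≤ L * Real.sqrt (1 - σ ^ 2) := by
    have k1 := hf σ hσ 1 (by simp)
    have k2 := hf σ hσ (-1) (by simp)
    rw [h1, sub_zero, abs_of_nonpos (by linarith [hσ.2])] at k1
    rw [h2, sub_zero, abs_of_nonneg (by linarith [hσ.1])] at k2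
    have k3 : 1 - |σ| ≤ Real.sqrt (1 - σ ^ 2) := by
      have := abs_le.mpr hσ
      nlinarith [sq_abs σ, abs_nonneg σ]
    refine le_trans ?_ (mul_le_mul_of_nonneg_left k3 hL)
    rcases abs_cases σ with h | h <;> rw [h.1] <;> linarith
  calc _ = ‖((Real.sqrt (1 - σ ^ 2) - Real.sqrt (1 - τ ^ 2) : ℝ) : ℂ) * f σ +
        (Real.sqrt (1 - τ ^ 2) : ℂ) * (f σ - f τ)‖ := by push_cast; ring_nf
    _ ≤ |Real.sqrt (1 - σ ^ 2) - Real.sqrt (1 - τ ^ 2)| * (L * Real.sqrt (1 - σ ^ 2)) +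
        1 * (L * |σ - τ|) := by
        refine (norm_add_le _ _).trans ?_
        rw [norm_mul, norm_mul, norm_real, norm_real, Real.norm_eq_abs, Real.norm_eq_abs,
          abs_of_nonneg hρτ]
        gcongr
        exact hf σ hσ τ hτ
    _ ≤ _ := by
        have := mul_le_mul_of_nonneg_left (abs_sqrt_one_sub_sq_sub_mul_le hσ hτ) hL
        nlinarith

theorem exists_lipschitz_realSeg {f : ℂ → ℂ} {V : Set ℂ} (hV : IsOpen V) (hVs : realSeg ⊆ V)
    (hf : DifferentiableOn ℂ f V) :
    ∃ L, 0 ≤ L ∧ ∀ x ∈ Icc (-1 : ℝ) 1, ∀ y ∈ Icc (-1 : ℝ) 1, ‖f x - f y‖ ≤ L * |x - y| := by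
  have hc : IsCompact realSeg := isCompact_Icc.image continuous_ofReal
  have hconv : Convex ℝ realSeg := (convex_Icc (-1 : ℝ) 1).linear_image ofRealCLM.toLinearMap
  obtain ⟨L, hL⟩ := hc.exists_bound_of_continuousOn
    ((hf.deriv hV).continuousOn.mono hVs)
  refine ⟨|L|, abs_nonneg _, fun x hx y hy => ?_⟩
  have := hconv.norm_image_sub_le_of_norm_deriv_le
    (fun z hz => hf.differentiableAt (hV.mem_nhds (hVs hz)))
    (fun z hz => (hL z hz).trans (le_abs_self L)) (ofReal_mem_realSeg hy) (ofReal_mem_realSeg hx)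
  rwa [norm_ofReal_sub_ofReal] at this

theorem integrableOn_div_sqrt {w : ℝ → ℂ} (hw : Continuous w) :
    IntegrableOn (fun s : ℝ => w s / (Real.sqrt (1 - s ^ 2) : ℂ)) (Icc (-1 : ℝ) 1) := by
  obtain ⟨B, hB⟩ := isCompact_Icc.exists_bound_of_continuousOn
    (hw.continuousOn (s := Icc (-1 : ℝ) 1))
  have h1 : IntegrableOn (fun s : ℝ => (((Real.sqrt (1 - s ^ 2))⁻¹ : ℝ) : ℂ))
      (Icc (-1 : ℝ) 1) := integrableOn_inv_sqrt.ofReal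
  refine (integrableOn_mul_kernel (σ := 0) h1 hB hw.continuousOn).congr
    (Eventually.of_forall fun s => ?_)
  simp only [ofReal_inv]
  rw [div_eq_inv_mul]

/-- The version of `exists_affine_lintegral_gagliardo_lt_top` for densities that need not vanish
at the endpoints. -/
theorem exists_affine_of_continuous {w : ℝ → ℂ} (hw : Continuous w) {p C : ℝ} (hp : 2 < p)
    (hw0 : ∀ s ∈ Icc (-1 : ℝ) 1, ∀ σ ∈ Icc (-1 : ℝ) 1, ‖w s - w σ‖ ≤ C * |s - σ| ^ (1 - 2 / p))
    (hG : ∫⁻ σ in Icc (-1 : ℝ) 1, gagliardo p w σ ≠ ⊤) :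
    (∀ σ ∈ Ioo (-1 : ℝ) 1, IntegrableOn (fun s : ℝ => (w s / (Real.sqrt (1 - s ^ 2) : ℂ) -
      w σ / (Real.sqrt (1 - σ ^ 2) : ℂ)) / ((s : ℂ) - σ)) (Icc (-1) 1)) ∧
    ∃ a b : ℂ, ∀ q, 2 < q → q < p → ∃ D : ℝ → ℂ,
      (∫⁻ σ in Icc (-1 : ℝ) 1, gagliardo q D σ < ⊤) ∧
      ∀ σ ∈ Ioo (-1 : ℝ) 1, (Real.sqrt (1 - σ ^ 2) : ℂ) *
        finHilbert (fun s => w s / (Real.sqrt (1 - s ^ 2) : ℂ)) σ =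
          D σ + (Real.sqrt (1 - σ ^ 2) : ℂ) * (a + b * σ) := by
  set a₀ := (w 1 + w (-1)) / 2 with ha₀
  set b₀ := (w 1 - w (-1)) / 2 with hb₀
  set v : ℝ → ℂ := fun s => w s - (a₀ + b₀ * s) with hv
  have hdiff : ∀ s σ : ℝ, ‖v s - v σ‖ ≤ ‖w s - w σ‖ + ‖b₀‖ * |s - σ| := fun s σ => by
    have : v s - v σ = (w s - w σ) - b₀ * ((s : ℂ) - σ) := by simp only [hv]; ring
    rw [this]
    refine (norm_sub_le _ _).trans_eq ?_
    rw [norm_mul, norm_ofReal_sub_ofReal]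
  have hp0 : 0 < 2 / p := by positivity
  have hp1 : 2 / p < 1 := (div_lt_one (by linarith)).mpr hp
  have hlin : ∀ s ∈ Icc (-1 : ℝ) 1, ∀ σ ∈ Icc (-1 : ℝ) 1,
      |s - σ| ≤ 2 * |s - σ| ^ (1 - 2 / p) := by
    intro s hs σ hσ
    rcases eq_or_ne s σ with rfl | hne
    · simp only [sub_self, abs_zero]
      positivity
    have h0 : 0 < |s - σ| := abs_pos.mpr (sub_ne_zero.mpr hne)
    have h2 : |s - σ| ≤ 2 := abs_le.mpr ⟨by linarith [hs.1, hσ.2], by linarith [hs.2, hσ.1]⟩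
    have h3 : |s - σ| ^ (2 / p) ≤ 2 := by
      calc |s - σ| ^ (2 / p) ≤ 2 ^ (2 / p) := by gcongr
        _ ≤ (2 : ℝ) ^ (1 : ℝ) := Real.rpow_le_rpow_of_exponent_le (by norm_num) hp1.le
        _ = 2 := Real.rpow_one 2
    calc |s - σ| = |s - σ| ^ (2 / p) * |s - σ| ^ (1 - 2 / p) := by
          rw [← Real.rpow_add h0]; simp
      _ ≤ _ := by gcongr
  have hvG : ∫⁻ σ in Icc (-1 : ℝ) 1, gagliardo p v σ < ⊤ :=
    lintegral_gagliardo_lt_top_of_le_add (by linarith) (norm_nonneg b₀) hG.lt_top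
      fun x _ y _ => hdiff x y
  have hv0 : ∀ s ∈ Icc (-1 : ℝ) 1, ∀ σ ∈ Icc (-1 : ℝ) 1,
      ‖v s - v σ‖ ≤ (|C| + ‖b₀‖ * 2) * |s - σ| ^ (1 - 2 / p) := by
    intro s hs σ hσ
    have h1 := mul_le_mul_of_nonneg_left (hlin s hs σ hσ) (norm_nonneg b₀)
    have h2 : C * |s - σ| ^ (1 - 2 / p) ≤ |C| * |s - σ| ^ (1 - 2 / p) := by
      gcongr
      exact le_abs_self C
    linarith [hdiff s σ, hw0 s hs σ hσ]
  obtain ⟨hInt, a, b, hab⟩ := exists_affine_lintegral_gagliardo_lt_top (v := v)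
    (by fun_prop) hp (by positivity) hv0 (by simp [hv, ha₀, hb₀]; ring)
    (by simp [hv, ha₀, hb₀]; ring) hvG.ne
  have hρ : IntegrableOn (fun s : ℝ => (((Real.sqrt (1 - s ^ 2))⁻¹ : ℝ) : ℂ))
      (Icc (-1 : ℝ) 1) := integrableOn_inv_sqrt.ofReal
  have hsum : (fun s : ℝ => w s / (Real.sqrt (1 - s ^ 2) : ℂ)) = fun s : ℝ =>
      v s / (Real.sqrt (1 - s ^ 2) : ℂ) +
        (a₀ + b₀ * s) * (((Real.sqrt (1 - s ^ 2))⁻¹ : ℝ) : ℂ) := by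
    funext s
    simp only [hv, ofReal_inv]
    ring
  have hmul := fun σ (hσ : σ ∈ Ioo (-1 : ℝ) 1) =>
    finHilbert_mul (φ := fun s : ℝ => a₀ + b₀ * s) (κ := fun _ => b₀) (finHilbert_inv_sqrt hσ).1
      (hρ.mul_const b₀) (fun s => by ring)
  refine ⟨fun σ hσ => ?_, a + ∫ s : ℝ in Icc (-1 : ℝ) 1,
    (((Real.sqrt (1 - s ^ 2))⁻¹ : ℝ) : ℂ) * b₀, b, fun q hq hqp => ?_⟩
  · refine ((hInt σ hσ).add (hmul σ hσ).1).congr (Eventually.of_forall fun s => ?_)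
    have h1 := congrFun hsum s
    have h2 := congrFun hsum σ
    simp only [Pi.add_apply]
    rw [h1, h2]
    ring
  · obtain ⟨D, hD, hDe⟩ := hab q hq hqp
    refine ⟨D, hD, fun σ hσ => ?_⟩
    rw [hsum, finHilbert_add (hInt σ hσ) (hmul σ hσ).1, mul_add, hDe σ hσ, (hmul σ hσ).2,
      (finHilbert_inv_sqrt hσ).2]
    ring

theorem AnalyticArc.mem_arcInt_iff (A : AnalyticArc) {t : ℂ} :
    t ∈ A.arcInt ↔ ∃ σ ∈ Ioo (-1 : ℝ) 1, A.Ξ σ = t := by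
  have hU := fun (x : ℝ) (hx : x ∈ Icc (-1 : ℝ) 1) => A.seg_sub (ofReal_mem_realSeg hx)
  have h1 := hU 1 (by simp)
  have h2 := hU (-1) (by simp)
  have e1 := A.map_one
  have e2 := A.map_neg_one
  constructor
  · rintro ⟨⟨_, ⟨x, hx, rfl⟩, rfl⟩, hne⟩
    refine ⟨x, ⟨lt_of_le_of_ne hx.1 ?_, lt_of_le_of_ne hx.2 ?_⟩, rfl⟩
    · rintro rfl
      exact hne (by simp [e2])
    · rintro rfl
      exact hne (by simp [e1])
  · rintro ⟨x, hx, rfl⟩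
    have hxI := Ioo_subset_Icc_self hx
    refine ⟨mem_image_of_mem _ (ofReal_mem_realSeg hxI), ?_⟩
    rintro (h | h)
    · have := A.inj (hU x hxI) h1 (by simpa [e1] using h)
      exact hx.2.ne (by exact_mod_cast this)
    · have := A.inj (hU x hxI) h2 (by simpa [e2] using h)
      exact hx.1.ne' (by exact_mod_cast this)

theorem norm_integral_mul_kernel_sub_le {ψ : ℝ → ℂ} {m : ℝ → ℝ → ℂ} {B L : ℝ}
    (hψ : IntegrableOn ψ (Icc (-1 : ℝ) 1))
    (hB : ∀ s ∈ Icc (-1 : ℝ) 1, ∀ σ ∈ Icc (-1 : ℝ) 1, ‖m s σ‖ ≤ B)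
    (hL : ∀ s ∈ Icc (-1 : ℝ) 1, ∀ σ ∈ Icc (-1 : ℝ) 1, ∀ τ ∈ Icc (-1 : ℝ) 1,
      ‖m s σ - m s τ‖ ≤ L * |σ - τ|)
    (hmc : ∀ σ ∈ Icc (-1 : ℝ) 1, ContinuousOn (fun s => m s σ) (Icc (-1 : ℝ) 1 \ {σ}))
    {σ τ : ℝ} (hσ : σ ∈ Icc (-1 : ℝ) 1) (hτ : τ ∈ Icc (-1 : ℝ) 1) :
    ‖(∫ s in Icc (-1 : ℝ) 1, ψ s * m s σ) - ∫ s in Icc (-1 : ℝ) 1, ψ s * m s τ‖ ≤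
      (∫ s in Icc (-1 : ℝ) 1, ‖ψ s‖) * L * |σ - τ| := by
  rw [← integral_sub (integrableOn_mul_kernel hψ (fun s hs => hB s hs σ hσ) (hmc σ hσ))
    (integrableOn_mul_kernel hψ (fun s hs => hB s hs τ hτ) (hmc τ hτ)), mul_assoc,
    ← integral_mul_const]
  refine norm_integral_le_of_norm_le (hψ.norm.mul_const _) ?_
  filter_upwards [ae_restrict_mem measurableSet_Icc] with s hs
  rw [← mul_sub, norm_mul]
  exact mul_le_mul_of_nonneg_left (hL s hs σ hσ τ hτ) (norm_nonneg _)

theorem exists_linear_polynomial (y₁ y₂ : ℂ) :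
    ∃ ℓ : ℂ[X], ℓ.natDegree ≤ 1 ∧ ℓ.eval 1 = y₁ ∧ ℓ.eval (-1) = y₂ := by
  refine ⟨C ((y₁ - y₂) / 2) * X + C ((y₁ + y₂) / 2), natDegree_linear_le, ?_, ?_⟩ <;>
  · simp
    ring

theorem exists_decomposition_of_aestronglyMeasurable (A : AnalyticArc) (S : SqrtBranch A)
    (srp : ℂ → ℂ) (hsrp : BVplus A.Ξ S.sr srp)
    (θ : ℂ → ℂ) (p : ℝ) (hp : 2 < p) (hθ : SobWOn A p θ)
    (SI : ℂ → ℂ)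
    (hSI : ∀ τ ∈ A.arcInt,
      IsPV A (fun t => θ t / srp t) τ ((Real.pi : ℂ) * Complex.I * SI τ))
    (hu : AEStronglyMeasurable (fun x : ℝ => θ (A.Ξ x)) (volume.restrict (Icc (-1 : ℝ) 1))) :
    ∃ (d : ℂ → ℂ) (ℓ : Polynomial ℂ), ℓ.natDegree ≤ 1 ∧ d 1 = 0 ∧ d (-1) = 0 ∧
      (∀ q : ℝ, 2 < q → q < p → SobWOn A q d) ∧
      ∀ t ∈ A.arcInt, srp t * SI t = d t + srp t * ℓ.eval t := by
  classical
  obtain ⟨δ, g, c, hδ, hc, hVU, hg, hg0, hgs⟩ := A.exists_branch S srp hsrp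
  obtain ⟨m, B, L, hB, hL, hm, hmc⟩ := A.exists_kernel hδ hVU hg hg0
  obtain ⟨w, C, hw, hθw, hwC, hwG⟩ := exists_holder_representative hp hu
    (hθ.lintegral_gagliardo_ne_top (by linarith))
  obtain ⟨hInt, a, b, hab⟩ := exists_affine_of_continuous hw hp hwC hwG
  have hψ := integrableOn_div_sqrt hw
  have hself : realSeg ⊆ thickening δ realSeg := self_subset_thickening hδ _
  have hgI : ∀ x ∈ Icc (-1 : ℝ) 1, g x ≠ 0 := fun x hx => hg0 x (hself (ofReal_mem_realSeg hx))
  have hg1 : g 1 ≠ 0 := by simpa using hgI 1 (by simp)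
  have hg2 : g (-1) ≠ 0 := by simpa using hgI (-1) (by simp)
  have hπ : (Real.pi : ℂ) * Complex.I ≠ 0 :=
    mul_ne_zero (ofReal_ne_zero.mpr Real.pi_ne_zero) I_ne_zero
  set R : ℝ → ℂ := fun σ => a + b * σ +
    ∫ s in Icc (-1 : ℝ) 1, w s / (Real.sqrt (1 - s ^ 2) : ℂ) * m s σ with hR
  obtain ⟨ℓ, hℓ, hℓ1, hℓ2⟩ := exists_linear_polynomial
    (R 1 / ((Real.pi : ℂ) * Complex.I * c * g 1))
    (R (-1) / ((Real.pi : ℂ) * Complex.I * c * g (-1)))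
  obtain ⟨K, hK, hlip⟩ := exists_lipschitz_realSeg
    (f := fun z => (Real.pi : ℂ) * Complex.I * c * g z * ℓ.eval (A.Ξ z))
    isOpen_thickening hself
    ((hg.const_mul _).mul (ℓ.differentiable.comp_differentiableOn (A.diff.mono hVU)))
  set f : ℝ → ℂ := fun σ =>
    R σ - (Real.pi : ℂ) * Complex.I * c * g σ * ℓ.eval (A.Ξ σ) with hf
  set N : ℝ := ∫ s : ℝ in Icc (-1 : ℝ) 1, ‖w s / (Real.sqrt (1 - s ^ 2) : ℂ)‖ with hN
  have hN0 : 0 ≤ N := integral_nonneg fun s => norm_nonneg _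
  have hfl : ∀ σ ∈ Icc (-1 : ℝ) 1, ∀ τ ∈ Icc (-1 : ℝ) 1,
      ‖f σ - f τ‖ ≤ (‖b‖ + N * |L| + K) * |σ - τ| := by
    intro σ hσ τ hτ
    have h1 := norm_integral_mul_kernel_sub_le (L := |L|) hψ hB
      (fun s hs σ hσ τ hτ => (hL s hs σ hσ τ hτ).trans
        (mul_le_mul_of_nonneg_right (le_abs_self L) (abs_nonneg _))) hmc hσ hτ
    have h2 := hlip σ hσ τ hτ
    have h3 : ‖b * ((σ : ℂ) - τ)‖ = ‖b‖ * |σ - τ| := by rw [norm_mul, norm_ofReal_sub_ofReal]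
    have h4 : f σ - f τ = b * ((σ : ℂ) - τ) +
        ((∫ s in Icc (-1 : ℝ) 1, w s / (Real.sqrt (1 - s ^ 2) : ℂ) * m s σ) -
          ∫ s in Icc (-1 : ℝ) 1, w s / (Real.sqrt (1 - s ^ 2) : ℂ) * m s τ) -
        ((Real.pi : ℂ) * Complex.I * c * g σ * ℓ.eval (A.Ξ σ) -
          (Real.pi : ℂ) * Complex.I * c * g τ * ℓ.eval (A.Ξ τ)) := by
      simp only [hf, hR]; ring
    rw [h4, add_mul, add_mul, ← h3]
    exact (norm_sub_le _ _).trans (add_le_add ((norm_add_le _ _).trans (add_le_add le_rfl h1)) h2)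
  have hf1 : f 1 = 0 := by
    simp only [hf, ofReal_one, A.map_one, hℓ1]
    field_simp
    simp
  have hf2 : f (-1) = 0 := by
    simp only [hf, ofReal_neg, ofReal_one, A.map_neg_one, hℓ2]
    field_simp
    simp
  set d : ℂ → ℂ := fun t => if t ∈ A.arcInt then srp t * (SI t - ℓ.eval t) else 0 with hd
  refine ⟨d, ℓ, hℓ, by simp [hd, AnalyticArc.arcInt], by simp [hd, AnalyticArc.arcInt],
    fun q hq hqp => ?_, fun t ht => by simp only [hd, if_pos ht]; ring⟩
  obtain ⟨D, hD, hDe⟩ := hab q hq hqp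
  have hdΞ : ∀ σ ∈ Ioo (-1 : ℝ) 1, d (A.Ξ σ) = ((Real.pi : ℂ) * Complex.I)⁻¹ *
      (D σ + (Real.sqrt (1 - σ ^ 2) : ℂ) * f σ) := by
    intro σ hσ
    have hmem : A.Ξ σ ∈ A.arcInt := A.mem_arcInt_iff.mpr ⟨σ, hσ, rfl⟩
    have h1 := A.singular_integral_eq hδ hc hVU hg0 hgs hB hm hmc hθw hψ hσ (hInt σ hσ)
      (hSI _ hmem)
    rw [mul_add, hDe σ hσ] at h1
    rw [eq_inv_mul_iff_mul_eq₀ hπ]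
    simp only [hd, if_pos hmem, mul_sub, h1, hf, hR]
    rw [hgs σ hσ]
    ring
  refine sobWOn_of_gagliardo A (by linarith) (lintegral_gagliardo_lt_top_of_le_add
    (L := 3 * (‖b‖ + N * |L| + K)) (by linarith) (by positivity) hD fun x hx y hy => ?_)
  have h1 := norm_sqrt_mul_sub_le (by positivity) hfl hf1 hf2 (Ioo_subset_Icc_self hx)
    (Ioo_subset_Icc_self hy)
  have hπ1 : ‖((Real.pi : ℂ) * Complex.I)⁻¹‖ ≤ 1 := by
    rw [norm_inv, norm_mul, norm_I, mul_one, norm_real, Real.norm_of_nonneg Real.pi_pos.le]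
    exact inv_le_one_of_one_le₀ (by linarith [Real.pi_gt_three])
  rw [hdΞ x hx, hdΞ y hy, ← mul_sub, norm_mul, add_sub_add_comm]
  exact (mul_le_of_le_one_left (norm_nonneg _) hπ1).trans
    ((norm_add_le _ _).trans (add_le_add le_rfl h1))

/-- Principal values of a density that is not almost everywhere measurable vanish, since the
truncated Bochner integrals do. -/
theorem IsPV.eq_zero_of_not_aestronglyMeasurable {A : AnalyticArc} {S : SqrtBranch A}
    {srp : ℂ → ℂ} (hsrp : BVplus A.Ξ S.sr srp) {θ : ℂ → ℂ} {τ V : ℂ} (hτ : τ ∈ A.arcInt)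
    (hV : IsPV A (fun t => θ t / srp t) τ V)
    (hu : ¬ AEStronglyMeasurable (fun x : ℝ => θ (A.Ξ x)) (volume.restrict (Icc (-1 : ℝ) 1))) :
    V = 0 := by
  obtain ⟨σ, hσ, rfl⟩ := A.mem_arcInt_iff.mp hτ
  obtain ⟨δ, g, c, hδ, hc, hVU, hg, hg0, hgs⟩ := A.exists_branch S srp hsrp
  obtain ⟨b, C, hb, -, hbl, hder⟩ := A.exists_bilipschitz
  have hself : ∀ x ∈ Icc (-1 : ℝ) 1, (x : ℂ) ∈ thickening δ realSeg := fun x hx =>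
    self_subset_thickening hδ _ (ofReal_mem_realSeg hx)
  have hpos : ∀ x ∈ Icc (-1 : ℝ) 1, x ≠ σ → 0 < ‖A.Ξ x - A.Ξ σ‖ := fun x hx hne =>
    (mul_pos hb (abs_pos.mpr (sub_ne_zero.mpr hne))).trans_le
      (hbl x hx σ (Ioo_subset_Icc_self hσ)).1
  set T : ℝ → Set ℝ := fun ε => {x ∈ Icc (-1 : ℝ) 1 | ε ≤ ‖A.Ξ (x : ℂ) - A.Ξ σ‖} with hT
  set G : ℝ → ℂ := fun x => θ (A.Ξ (x : ℂ)) / srp (A.Ξ (x : ℂ)) / (A.Ξ (x : ℂ) - A.Ξ σ) *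
    deriv A.Ξ (x : ℂ) with hG
  set k : ℝ → ℂ := fun x => c * Real.sqrt (1 - x ^ 2) * g x * (A.Ξ x - A.Ξ σ) / deriv A.Ξ x
    with hk
  have hder0 : ∀ x ∈ Icc (-1 : ℝ) 1, deriv A.Ξ (x : ℂ) ≠ 0 := fun x hx =>
    norm_pos_iff.mp (hb.trans_le (hder x hx).1)
  have hcΞ : ContinuousOn (fun x : ℝ => A.Ξ x) (Icc (-1 : ℝ) 1) :=
    A.diff.continuousOn.comp (by fun_prop) fun s hs => hVU (hself s hs)
  have hcg : ContinuousOn (fun x : ℝ => g x) (Icc (-1 : ℝ) 1) :=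
    hg.continuousOn.comp (by fun_prop) hself
  have hcd : ContinuousOn (fun x : ℝ => deriv A.Ξ x) (Icc (-1 : ℝ) 1) :=
    (A.diff.deriv A.isOpen_U).continuousOn.comp (by fun_prop) fun s hs => hVU (hself s hs)
  have hkm : AEStronglyMeasurable k (volume.restrict (Icc (-1 : ℝ) 1)) := by
    refine ContinuousOn.aestronglyMeasurable (ContinuousOn.div ?_ hcd hder0) measurableSet_Icc
    have hρ : Continuous fun x : ℝ => (Real.sqrt (1 - x ^ 2) : ℂ) :=
      continuous_ofReal.comp (by fun_prop)
    exact ((continuousOn_const.mul hρ.continuousOn).mul hcg).mul (hcΞ.sub continuousOn_const)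
  have hsub : ∀ ε, T ε ⊆ Icc (-1 : ℝ) 1 := fun ε x hx => hx.1
  have hGu : ∀ ε, 0 < ε → AEStronglyMeasurable G (volume.restrict (T ε)) →
      AEStronglyMeasurable (fun x : ℝ => θ (A.Ξ x)) (volume.restrict (T ε)) := by
    intro ε hε h
    have hTm : MeasurableSet (T ε) :=
      ((hcΞ.sub continuousOn_const).norm.preimage_isClosed_of_isClosed isClosed_Icc
        isClosed_Ici).measurableSet
    refine (h.mul (hkm.mono_set (hsub ε))).congr ?_
    filter_upwards [ae_restrict_of_ae_restrict_of_subset (hsub ε) ae_mem_Ioo,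
      ae_restrict_mem hTm] with x hx hxT
    have h1 : A.Ξ x - A.Ξ σ ≠ 0 := norm_pos_iff.mp (hε.trans_le hxT.2)
    have h2 := hder0 x hxT.1
    have h3 := hg0 x (hself x hxT.1)
    have h4 : (Real.sqrt (1 - x ^ 2) : ℂ) ≠ 0 :=
      ofReal_ne_zero.mpr (Real.sqrt_pos.mpr (one_sub_sq_pos hx)).ne'
    simp only [Pi.mul_apply, hG, hk, hgs x hx]
    field_simp
  have hev : ∀ᶠ ε in 𝓝[>] (0 : ℝ), ¬ AEStronglyMeasurable G (volume.restrict (T ε)) := by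
    refine not_frequently.mp fun h1 => hu ?_
    have hfreq : ∀ n : ℕ, ∃ ε : ℝ, 0 < ε ∧ ε < 1 / ((n : ℝ) + 1) ∧
        AEStronglyMeasurable G (volume.restrict (T ε)) := by
      intro n
      obtain ⟨ε, h2, h3⟩ := (h1.and_eventually
        (Ioo_mem_nhdsGT (show (0 : ℝ) < 1 / ((n : ℝ) + 1) by positivity))).exists
      exact ⟨ε, h3.1, h3.2, h2⟩
    choose e he0 he1 heG using hfreq
    have hU := aestronglyMeasurable_iUnion_iff.mpr fun n => hGu (e n) (he0 n) (heG n)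
    have hcov : Icc (-1 : ℝ) 1 \ {σ} ⊆ ⋃ n, T (e n) := by
      intro x hx
      obtain ⟨n, hn⟩ := exists_nat_one_div_lt (hpos x hx.1 hx.2)
      exact mem_iUnion.mpr ⟨n, hx.1, ((he1 n).trans hn).le⟩
    have h1 := hU.mono_set hcov
    rwa [Measure.restrict_congr_set (sdiff_null_ae_eq_self (by simp))] at h1
  refine tendsto_nhds_unique hV (tendsto_const_nhds.congr' ?_)
  exact hev.mono fun ε hε => (integral_non_aestronglyMeasurable hε).symm

theorem sobWOn_zero (A : AnalyticArc) {q : ℝ} (hq : 0 < q) : SobWOn A q fun _ => 0 := by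
  simp [SobWOn, Real.zero_rpow (ne_of_gt hq)]

/-- **Sobolev smoothness of the singular integral `sr^± S(θ/sr⁺)`**
(Proposition 5.1 of the paper).  If `θ ∈ W_p^{1-1/p}`, `p ∈ (2,∞)`, then
`sr^± S(θ/sr⁺) = ± d + sr^± ℓ` on `Δ°`, where `d(±1) = 0`, `d ∈ W_q^{1-1/q}` for every
`q ∈ (2,p)`, and `ℓ` is a polynomial of degree at most `1`.  (Since `sr⁻ = -sr⁺`, the
two sign choices are equivalent, and the `+` version is stated.) -/
theorem singular_integral_sobolev_smoothness (A : AnalyticArc) (S : SqrtBranch A)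
    (srp : ℂ → ℂ) (hsrp : BVplus A.Ξ S.sr srp)
    (θ : ℂ → ℂ) (p : ℝ) (hp : 2 < p) (hθ : SobWOn A p θ)
    (SI : ℂ → ℂ)
    (hSI : ∀ τ ∈ A.arcInt,
      IsPV A (fun t => θ t / srp t) τ ((Real.pi : ℂ) * Complex.I * SI τ)) :
    ∃ (d : ℂ → ℂ) (ℓ : Polynomial ℂ), ℓ.natDegree ≤ 1 ∧ d 1 = 0 ∧ d (-1) = 0 ∧
      (∀ q : ℝ, 2 < q → q < p → SobWOn A q d) ∧
      ∀ t ∈ A.arcInt, srp t * SI t = d t + srp t * ℓ.eval t := by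
  by_cases hu : AEStronglyMeasurable (fun x : ℝ => θ (A.Ξ x)) (volume.restrict (Icc (-1 : ℝ) 1))
  · exact exists_decomposition_of_aestronglyMeasurable A S srp hsrp θ p hp hθ SI hSI hu
  · refine ⟨fun _ => 0, 0, by simp, rfl, rfl, fun q hq _ => sobWOn_zero A (by linarith),
      fun t ht => ?_⟩
    have h := (hSI t ht).eq_zero_of_not_aestronglyMeasurable hsrp ht hu
    have hπ : (Real.pi : ℂ) * Complex.I ≠ 0 :=
      mul_ne_zero (ofReal_ne_zero.mpr Real.pi_ne_zero) I_ne_zero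
    simp [(mul_eq_zero.mp h).resolve_left hπ]


end
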